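/- Let β > β_c and h = 0, and let μ̂ := lim_{m→∞} μ_{β,0}^+( · | η(i,0) = −1 for all i ∈ {−m,…,−1} ) (this weak limit exists by monotonicity). For n ∈ ℕ let A_n be the event that there exists an infinite nearest-neighbor path of +1 spins starting at (n,0) and entirely contained in {(x,y) ∈ ℤ² : x ≤ n}, and set B_m := ⋃_{n=1}^m A_n. Then μ̂(B_m) increases to 1 as m → ∞. -/

import Mathlib

open MeasureTheory Filter Topology ProbabilityTheory

noncomputable section

/-- Spin value of a Boolean spin: `true ↦ +1`, `false ↦ -1`. -/
def sval (b : Bool) : ℝ := if b then 1 else -1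

/-- Two-dimensional spin configurations. -/
abbrev Cfg2 := ℤ × ℤ → Bool

/-- Two-sided sequences over an alphabet `A`. -/
abbrev ZSeq (A : Type*) := ℤ → A

/-- Pasts: index `k` corresponds to the coordinate `-(k+1)`. -/
abbrev Past (A : Type*) := ℕ → A

/-- The four nearest neighbours of a site of `ℤ²`. -/
def nbrs (x : ℤ × ℤ) : Finset (ℤ × ℤ) :=
  {(x.1 + 1, x.2), (x.1 - 1, x.2), (x.1, x.2 + 1), (x.1, x.2 - 1)}

/-- Boltzmann weight
`exp(β[Σ_{{x,y}⊆Λ, x∼y} ω_x ω_y + Σ_{x∈Λ, y∉Λ, x∼y} ω_x σ_y] − h Σ_{x∈Λ} ω_x)`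
(the sum over unordered pairs inside `Λ` is written as half the ordered sum). -/
def isingWeight (β h : ℝ) (Λ : Finset (ℤ × ℤ)) (σ ω : Cfg2) : ℝ :=
  Real.exp (β * ((∑ x ∈ Λ, ∑ y ∈ Λ.filter (fun y => y ∈ nbrs x),
        sval (ω x) * sval (ω y)) / 2
      + ∑ x ∈ Λ, ∑ y ∈ (nbrs x).filter (fun y => y ∉ Λ), sval (ω x) * sval (σ y))
    - h * ∑ x ∈ Λ, sval (ω x))

/-- Fill in the values `τ` inside `Λ` and `σ` outside. -/
def fill (Λ : Finset (ℤ × ℤ)) (σ : Cfg2) (τ : ↥Λ → Bool) : Cfg2 :=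
  fun x => if hx : x ∈ Λ then τ ⟨x, hx⟩ else σ x

/-- The finite-volume Ising measure in `Λ` with boundary condition `σ`, viewed as a measure on
the full configuration space, the spins outside `Λ` being frozen to `σ`. -/
def isingFV (β h : ℝ) (Λ : Finset (ℤ × ℤ)) (σ : Cfg2) : Measure Cfg2 :=
  (∑ τ : ↥Λ → Bool, ENNReal.ofReal (isingWeight β h Λ σ (fill Λ σ τ)))⁻¹ •
    ∑ τ : ↥Λ → Bool,
      ENNReal.ofReal (isingWeight β h Λ σ (fill Λ σ τ)) • Measure.dirac (fill Λ σ τ)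

/-- The box `[-n,n]²`. -/
def box (n : ℕ) : Finset (ℤ × ℤ) :=
  (Finset.Icc (-(n : ℤ)) (n : ℤ)) ×ˢ (Finset.Icc (-(n : ℤ)) (n : ℤ))

/-- Convergence of a sequence of measures on a product space in the sense of convergence of the
measures of all finite-dimensional cylinder events; for probability measures on `{−1,+1}^ι`
this is exactly weak convergence. -/
def CylTendsto {ι A : Type*} [MeasurableSpace A] (μs : ℕ → Measure (ι → A))
    (μ : Measure (ι → A)) : Prop :=
  ∀ (s : Finset ι) (f : ι → A),
    Tendsto (fun n => μs n {η | ∀ i ∈ s, η i = f i}) atTop (𝓝 (μ {η | ∀ i ∈ s, η i = f i}))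

/-- `μ` is the plus phase `μ_{β,h}^+`: the weak limit of the finite-volume Ising measures on
`[-n,n]²` with all-plus boundary conditions. -/
def IsPlusPhase (β h : ℝ) (μ : Measure Cfg2) : Prop :=
  IsProbabilityMeasure μ ∧ CylTendsto (fun n => isingFV β h (box n) (fun _ => true)) μ

/-- `μ` is the minus phase `μ_{β,h}^-`. -/
def IsMinusPhase (β h : ℝ) (μ : Measure Cfg2) : Prop :=
  IsProbabilityMeasure μ ∧ CylTendsto (fun n => isingFV β h (box n) (fun _ => false)) μ

/-- The critical inverse temperature `β_c = ln(1+√2)/2`. -/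
def betaCrit : ℝ := Real.log (1 + Real.sqrt 2) / 2

/-- Projection of a two-dimensional configuration onto the line `ℤ × {0}`. -/
def lineProj (η : Cfg2) : ZSeq Bool := fun i => η (i, 0)

/-- The Schonmann projection of a measure on `{−1,+1}^{ℤ²}`. -/
def schonmann (μ : Measure Cfg2) : Measure (ZSeq Bool) := μ.map lineProj

/-- Restriction of a two-sided sequence to its strict past; index `k` is coordinate `-(k+1)`. -/
def restrictPast {A : Type*} (ω : ZSeq A) : Past A := fun k => ω (-(k + 1 : ℤ))

/-- The shift on two-sided sequences. -/
def shiftSeq {A : Type*} : ZSeq A → ZSeq A := fun ω i => ω (i + 1)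

/-- The σ-algebra `ℱ_{<0}` generated by the coordinates of negative index. -/
def pastSigma (A : Type*) [MeasurableSpace A] : MeasurableSpace (ZSeq A) :=
  MeasurableSpace.comap (fun ω : ZSeq A => restrictPast ω) inferInstance

/-- The σ-algebra generated by the coordinates in `S`. -/
def sigmaOn {ι A : Type*} [MeasurableSpace A] (S : Set ι) : MeasurableSpace (ι → A) :=
  MeasurableSpace.comap (fun ω : ι → A => S.restrict ω) inferInstance

/-- A g-function on the alphabet `A`: measurable, `[0,1]`-valued, normalized. -/
def IsGFunction {A : Type*} [Fintype A] [MeasurableSpace A] (P : A → Past A → ℝ) : Prop :=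
  (∀ a, Measurable (P a)) ∧ ∀ ω, (∑ a : A, P a ω) = 1 ∧ ∀ a, P a ω ∈ Set.Icc (0 : ℝ) 1

/-- `μ` is a translation-invariant g-measure consistent with the g-function `P`: for each `a`,
`ω ↦ P a (restrictPast ω)` is a version of the conditional probability `μ(X₀ = a | ℱ_{<0})`. -/
def IsGMeasure {A : Type*} [MeasurableSpace A] (μ : Measure (ZSeq A))
    (P : A → Past A → ℝ) : Prop :=
  IsProbabilityMeasure μ ∧ μ.map shiftSeq = μ ∧
    ∀ a : A, (fun ω => P a (restrictPast ω))
      =ᵐ[μ] μ[Set.indicator {ω : ZSeq A | ω 0 = a} (fun _ => (1 : ℝ)) | pastSigma A]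

/-- The `k`-th variation of a g-function: the supremum of `|P a ω − P a σ|` over pasts agreeing
on the coordinates `−k,…,−1`. -/
def varG {A : Type*} (P : A → Past A → ℝ) (k : ℕ) : ℝ :=
  sSup {d : ℝ | ∃ (a : A) (ω σ' : Past A), (∀ j < k, ω j = σ' j) ∧ d = |P a ω - P a σ'|}

/-- Elementary conditional probability `μ(B | A)`, as a real number. -/
def condProbR {X : Type*} [MeasurableSpace X] (μ : Measure X) (B A : Set X) : ℝ :=
  ((μ[|A]) B).toReal

/-- The event that `η_i = ω` (suitably reindexed) for `−n ≤ i ≤ −1` and `η_i = b`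
for `−(n+l) ≤ i ≤ −(n+1)`. -/
def pastEvt (n l : ℕ) (b : Bool) (ω : Past Bool) : Set (ZSeq Bool) :=
  {η | (∀ i : ℤ, -(n : ℤ) ≤ i → i ≤ -1 → η i = ω (i.natAbs - 1)) ∧
       (∀ i : ℤ, -((n : ℤ) + l) ≤ i → i ≤ -((n : ℤ) + 1) → η i = b)}

/-- The event that `η_i = b` for `−(n+l) ≤ i ≤ −n`. -/
def blockEvt (n l : ℕ) (b : Bool) : Set (ZSeq Bool) :=
  {η | ∀ i : ℤ, -((n : ℤ) + l) ≤ i → i ≤ -(n : ℤ) → η i = b}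

/-- The event that `η_i = b` for `−n ≤ i ≤ −1`. -/
def allBlock (n : ℕ) (b : Bool) : Set (ZSeq Bool) :=
  {η | ∀ i : ℤ, -(n : ℤ) ≤ i → i ≤ -1 → η i = b}

/-- `P` is the g-function `P^{+,b}` obtained from `ν` by conditioning on the symbol `b`
in the far past: `P(a|ω) = lim_n lim_l ν(η₀ = a | η = b on [−(n+l),−(n+1)], η = ω on [−n,−1])`,
both iterated limits being required to exist. -/
def IsCondG (ν : Measure (ZSeq Bool)) (b : Bool) (P : Bool → Past Bool → ℝ) : Prop :=
  ∀ (a : Bool) (ω : Past Bool), ∃ L : ℕ → ℝ,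
    (∀ n, Tendsto (fun l => condProbR ν {η | η 0 = a} (pastEvt n l b ω)) atTop (𝓝 (L n))) ∧
    Tendsto L atTop (𝓝 (P a ω))

/-- `ν'` is the iterated weak limit `lim_n lim_l ν( · | η = b on [−(n+l),−n])`. -/
def IsCondLimitMeasure (ν : Measure (ZSeq Bool)) (b : Bool) (ν' : Measure (ZSeq Bool)) : Prop :=
  ∃ νseq : ℕ → Measure (ZSeq Bool),
    (∀ n, CylTendsto (fun l => ν[|blockEvt n l b]) (νseq n)) ∧ CylTendsto νseq ν'

/-- Stochastic domination: `ν ≤ μ` iff `ν B ≤ μ B` for every increasing measurable event `B`. -/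
def StochDom {A : Type*} [MeasurableSpace A] [Preorder A]
    (ν μ : Measure (ZSeq A)) : Prop :=
  ∀ B : Set (ZSeq A), MeasurableSet B → (∀ ⦃x y : ZSeq A⦄, x ≤ y → x ∈ B → y ∈ B) → ν B ≤ μ B

/-- `π` is the i.i.d. product measure with `π(η_i = +1) = ρ` for each coordinate. -/
def IsBernoulliProd (ρ : ℝ) (π : Measure (ZSeq Bool)) : Prop :=
  IsProbabilityMeasure π ∧ ∀ (s : Finset ℤ) (f : ℤ → Bool),
    π {η | ∀ i ∈ s, η i = f i} = ∏ i ∈ s, ENNReal.ofReal (if f i then ρ else 1 - ρ)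

/-- Splicing of pasts: coordinates `−k,…,−1` (indices `< k`) from `ω`, the rest from `σ`. -/
def splice {A : Type*} (σ ω : Past A) (k : ℕ) : Past A := fun j => if j < k then ω j else σ j

/-- `ν'` is an extreme point of the convex set of g-measures consistent with `P`. -/
def ExtremeGMeasure (ν' : Measure (ZSeq Bool)) (P : Bool → Past Bool → ℝ) : Prop :=
  IsGMeasure ν' P ∧
  ∀ ν₁ ν₂ : Measure (ZSeq Bool), IsGMeasure ν₁ P → IsGMeasure ν₂ P →
    ∀ t : ℝ, t ∈ Set.Ioo (0 : ℝ) 1 →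
      ν' = ENNReal.ofReal t • ν₁ + ENNReal.ofReal (1 - t) • ν₂ → ν₁ = ν' ∧ ν₂ = ν'

/-- The event that the spins on the line are `−1` on `{−m,…,−n} × {0}`. -/
def lineMinusEvt (n m : ℕ) : Set Cfg2 :=
  {η | ∀ i : ℤ, -(m : ℤ) ≤ i → i ≤ -(n : ℤ) → η (i, 0) = false}

/-- Nearest-neighbour adjacency in `ℤ²` (`‖x−y‖₁ = 1`). -/
def adj2 (x y : ℤ × ℤ) : Prop := (x.1 - y.1).natAbs + (x.2 - y.2).natAbs = 1

/-- The event `A_n`: there is an infinite nearest-neighbour path of `+1` spins starting at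
`(n,0)` entirely contained in the half-plane `{x ≤ n}`. -/
def plusPathEvt (n : ℕ) : Set Cfg2 :=
  {η | ∃ γ : ℕ → ℤ × ℤ, γ 0 = ((n : ℤ), 0) ∧ (∀ j, adj2 (γ j) (γ (j + 1))) ∧
    Function.Injective γ ∧ (∀ j, (γ j).1 ≤ (n : ℤ)) ∧ ∀ j, η (γ j) = true}

/-- The block map for the decimation `ν_{l,k}`: the `j`-th letter consists of the spins on
`[j(k+l), j(k+l)+l−1]`. -/
def blockMap (l k : ℕ) (η : ZSeq Bool) : ZSeq (Fin l → Bool) :=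
  fun j r => η (j * ((k : ℤ) + l) + r)

end

namespace PlusPath

section Energy

variable {V : Type*} [DecidableEq V]

open Classical in
/-- Energy of the edges touching `F` when the set of minus spins is `σ`; every disagreeing edge
counts twice. -/
noncomputable def energy (nb : V → Finset V) (F : Finset V) (σ : Set V) : ℕ :=
  ∑ x ∈ F, ∑ y ∈ nb x, (if y ∈ F then 1 else 2) * (if (x ∈ σ ↔ y ∈ σ) then 0 else 1)

/-- Number of edges between `M` and its complement. -/
def cut (nb : V → Finset V) (M : Finset V) : ℕ :=
  ∑ x ∈ M, ∑ y ∈ nb x, if y ∈ M then 0 else 1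

/-- Number of edges between `A` and the complement of `A ∪ F`. -/
def outerCut (nb : V → Finset V) (F A : Finset V) : ℕ :=
  ∑ x ∈ A, ∑ y ∈ nb x, if y ∈ A ∪ F then 0 else 1

theorem sum_nb_eq (nb : V → Finset V) {A U : Finset V} (hA : A ⊆ U) (hU : ∀ x ∈ A, nb x ⊆ U)
    (g : V → V → ℕ) :
    ∑ x ∈ A, ∑ y ∈ nb x, g x y
      = ∑ x ∈ U, ∑ y ∈ U, if y ∈ nb x ∧ x ∈ A then g x y else 0 := by
  rw [← Finset.sum_subset hA]
  · refine Finset.sum_congr rfl fun x hx => ?_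
    rw [← Finset.sum_subset (hU x hx)]
    · exact Finset.sum_congr rfl fun y hy => by simp [hx, hy]
    · intro y _ hy; simp [hy]
  · intro x _ hx; simp [hx]

theorem energy_congr (nb : V → Finset V) {F : Finset V} {σ τ : Set V}
    (h : ∀ x ∈ F, (x ∈ σ ↔ x ∈ τ)) (h' : ∀ x ∈ F, ∀ y ∈ nb x, y ∉ F → (y ∈ σ ↔ y ∈ τ)) :
    energy nb F σ = energy nb F τ := by
  classical
  unfold energy
  refine Finset.sum_congr rfl fun x hx => Finset.sum_congr rfl fun y hy => ?_
  have hy' : y ∈ σ ↔ y ∈ τ := by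
    by_cases hyF : y ∈ F
    · exact h y hyF
    · exact h' x hx y hy hyF
  simp only [h x hx, hy']

theorem energy_compl (nb : V → Finset V) (F : Finset V) (σ : Set V) :
    energy nb F σᶜ = energy nb F σ := by
  classical
  unfold energy
  simp only [Set.mem_compl_iff, not_iff_not]

theorem energy_union (nb : V → Finset V) (hs : ∀ x y, y ∈ nb x → x ∈ nb y) {F G : Finset V}
    (hd : Disjoint F G) (h : ∀ x ∈ F, ∀ y ∈ nb x, y ∉ G) (σ : Set V) :
    energy nb (F ∪ G) σ = energy nb F σ + energy nb G σ := by
  classical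
  unfold energy
  rw [Finset.sum_union hd]
  congr 1
  · refine Finset.sum_congr rfl fun x hx => Finset.sum_congr rfl fun y hy => ?_
    simp [h x hx y hy]
  · refine Finset.sum_congr rfl fun x hx => Finset.sum_congr rfl fun y hy => ?_
    have : y ∉ F := fun hyF => h y hyF x (hs _ _ hy) hx
    simp [this]

theorem energy_image (nb : V → Finset V) (e : V ≃ V)
    (he : ∀ x, nb (e x) = (nb x).map e.toEmbedding) (F : Finset V) (σ : Set V) :
    energy nb (F.map e.toEmbedding) σ = energy nb F (e ⁻¹' σ) := by
  classical
  unfold energy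
  rw [Finset.sum_map]
  refine Finset.sum_congr rfl fun x _ => ?_
  simp only [Equiv.coe_toEmbedding]
  rw [he, Finset.sum_map]
  refine Finset.sum_congr rfl fun y _ => ?_
  simp

theorem two_mul_cut (nb : V → Finset V) (hs : ∀ x y, y ∈ nb x → x ∈ nb y) {F A f : Finset V}
    (hAF : Disjoint A F) (hf : f ⊆ F) :
    2 * cut nb (A ∪ f) = energy nb F ↑(A ∪ f) + 2 * outerCut nb F A := by
  classical
  set M := A ∪ f with hM
  have hs' : ∀ x y, y ∈ nb x ↔ x ∈ nb y := fun x y => ⟨hs x y, hs y x⟩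
  obtain ⟨U, hU⟩ : ∃ U : Finset V, U = (A ∪ F) ∪ (A ∪ F).biUnion nb := ⟨_, rfl⟩
  have hAFU : A ∪ F ⊆ U := by rw [hU]; exact Finset.subset_union_left
  have hnb : ∀ x ∈ A ∪ F, nb x ⊆ U := fun x hx => by
    rw [hU]; exact (Finset.subset_biUnion_of_mem nb hx).trans Finset.subset_union_right
  have hMAF : M ⊆ A ∪ F := Finset.union_subset_union_right hf
  have hFAF : F ⊆ A ∪ F := Finset.subset_union_right
  have hAAF : A ⊆ A ∪ F := Finset.subset_union_left
  have hMF : ∀ x, x ∉ F → (x ∈ M ↔ x ∈ A) := fun x hx => by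
    rw [hM, Finset.mem_union]; exact ⟨fun h => h.resolve_right fun h => hx (hf h), Or.inl⟩
  have e1 : cut nb M = ∑ x ∈ U, ∑ y ∈ U, if y ∈ nb x ∧ x ∈ M ∧ y ∉ M then 1 else 0 := by
    unfold cut
    rw [sum_nb_eq nb (hMAF.trans hAFU) fun x hx => hnb x (hMAF hx)]
    refine Finset.sum_congr rfl fun x _ => Finset.sum_congr rfl fun y _ => ?_
    by_cases h1 : y ∈ nb x <;> by_cases h2 : x ∈ M <;> by_cases h3 : y ∈ M <;> simp [h1, h2, h3]
  have e1' : cut nb M = ∑ x ∈ U, ∑ y ∈ U, if y ∈ nb x ∧ y ∈ M ∧ x ∉ M then 1 else 0 := by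
    rw [e1, Finset.sum_comm]
    refine Finset.sum_congr rfl fun x _ => Finset.sum_congr rfl fun y _ => ?_
    simp only [hs' x y]
  have e3 : outerCut nb F A
      = ∑ x ∈ U, ∑ y ∈ U, if y ∈ nb x ∧ x ∈ M ∧ y ∉ M ∧ x ∉ F ∧ y ∉ F then 1 else 0 := by
    unfold outerCut
    rw [sum_nb_eq nb (hAAF.trans hAFU) fun x hx => hnb x (hAAF hx)]
    refine Finset.sum_congr rfl fun x _ => Finset.sum_congr rfl fun y _ => ?_
    by_cases hx : x ∈ F
    · have : x ∉ A := fun h => Finset.disjoint_left.1 hAF h hx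
      simp [hx, this]
    · by_cases hy : y ∈ F
      · simp [hy]
      · have h1 := hMF x hx
        have h2 := hMF y hy
        simp only [h1, h2, hx, hy, Finset.mem_union, or_false, not_false_eq_true, and_true]
        by_cases h1 : y ∈ nb x <;> by_cases h2 : x ∈ A <;> by_cases h3 : y ∈ A <;>
          simp [h1, h2, h3]
  have e3' : outerCut nb F A
      = ∑ x ∈ U, ∑ y ∈ U, if y ∈ nb x ∧ y ∈ M ∧ x ∉ M ∧ x ∉ F ∧ y ∉ F then 1 else 0 := by
    rw [e3, Finset.sum_comm]
    refine Finset.sum_congr rfl fun x _ => Finset.sum_congr rfl fun y _ => ?_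
    simp only [hs' x y]
    refine if_congr ?_ rfl rfl
    tauto
  have e2 : energy nb F ↑M = ∑ x ∈ U, ∑ y ∈ U,
      ((if y ∈ nb x ∧ x ∈ F ∧ ¬(x ∈ M ↔ y ∈ M) then 1 else 0)
        + if y ∈ nb x ∧ x ∈ F ∧ y ∉ F ∧ ¬(x ∈ M ↔ y ∈ M) then 1 else 0) := by
    unfold energy
    rw [sum_nb_eq nb (hFAF.trans hAFU) fun x hx => hnb x (hFAF hx)]
    refine Finset.sum_congr rfl fun x _ => Finset.sum_congr rfl fun y _ => ?_
    simp only [Finset.mem_coe]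
    by_cases h1 : y ∈ nb x <;> by_cases h2 : x ∈ F <;> by_cases h3 : y ∈ F <;>
      by_cases h4 : (x ∈ M ↔ y ∈ M) <;> simp [h1, h2, h3, h4]
  have e4 : ∑ x ∈ U, ∑ y ∈ U, (if y ∈ nb x ∧ x ∈ F ∧ y ∉ F ∧ ¬(x ∈ M ↔ y ∈ M) then 1 else 0)
      = ∑ x ∈ U, ∑ y ∈ U, if y ∈ nb x ∧ y ∈ F ∧ x ∉ F ∧ ¬(x ∈ M ↔ y ∈ M) then 1 else 0 := by
    rw [Finset.sum_comm]
    refine Finset.sum_congr rfl fun x _ => Finset.sum_congr rfl fun y _ => ?_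
    simp only [hs' x y]
    refine if_congr ?_ rfl rfl
    tauto
  have e5 : 2 * cut nb M = cut nb M + cut nb M := two_mul _
  have e6 : 2 * outerCut nb F A = outerCut nb F A + outerCut nb F A := two_mul _
  rw [e5, e6]
  nth_rewrite 1 [e1]
  nth_rewrite 1 [e1']
  nth_rewrite 1 [e3]
  nth_rewrite 1 [e3']
  rw [e2]
  simp only [Finset.sum_add_distrib]
  rw [e4]
  simp only [← Finset.sum_add_distrib]
  refine Finset.sum_congr rfl fun x _ => Finset.sum_congr rfl fun y _ => ?_
  by_cases h1 : y ∈ nb x <;> by_cases h2 : x ∈ F <;> by_cases h3 : y ∈ F <;>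
      by_cases h4 : x ∈ M <;> by_cases h5 : y ∈ M <;> simp [h1, h2, h3, h4, h5]

theorem cut_inter_add_cut_union_le (nb : V → Finset V) (M N : Finset V) :
    cut nb (M ∩ N) + cut nb (M ∪ N) ≤ cut nb M + cut nb N := by
  classical
  obtain ⟨U, hU⟩ : ∃ U : Finset V, U = (M ∪ N) ∪ (M ∪ N).biUnion nb := ⟨_, rfl⟩
  have hMU : M ∪ N ⊆ U := by rw [hU]; exact Finset.subset_union_left
  have hnb : ∀ x ∈ M ∪ N, nb x ⊆ U := fun x hx => by
    rw [hU]; exact (Finset.subset_biUnion_of_mem nb hx).trans Finset.subset_union_right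
  have e : ∀ K ⊆ M ∪ N, cut nb K = ∑ x ∈ U, ∑ y ∈ U, if y ∈ nb x ∧ x ∈ K ∧ y ∉ K then 1 else 0 := by
    intro K hK
    unfold cut
    rw [sum_nb_eq nb (hK.trans hMU) fun x hx => hnb x (hK hx)]
    refine Finset.sum_congr rfl fun x _ => Finset.sum_congr rfl fun y _ => ?_
    by_cases h1 : y ∈ nb x <;> by_cases h2 : x ∈ K <;> by_cases h3 : y ∈ K <;> simp [h1, h2, h3]
  rw [e _ (Finset.inter_subset_left.trans Finset.subset_union_left), e _ subset_rfl,
    e _ Finset.subset_union_left, e _ Finset.subset_union_right]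
  simp only [← Finset.sum_add_distrib]
  refine Finset.sum_le_sum fun x _ => Finset.sum_le_sum fun y _ => ?_
  by_cases h1 : y ∈ nb x <;> by_cases h2 : x ∈ M <;> by_cases h3 : y ∈ M <;>
      by_cases h4 : x ∈ N <;> by_cases h5 : y ∈ N <;> simp [h1, h2, h3, h4, h5]

theorem cut_map (nb : V → Finset V) (e : V ≃ V)
    (he : ∀ x, nb (e x) = (nb x).map e.toEmbedding) (M : Finset V) :
    cut nb (M.map e.toEmbedding) = cut nb M := by
  unfold cut
  rw [Finset.sum_map]
  refine Finset.sum_congr rfl fun x _ => ?_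
  simp only [Equiv.coe_toEmbedding]
  rw [he, Finset.sum_map]
  refine Finset.sum_congr rfl fun y _ => ?_
  simp

end Energy

section Law

abbrev Site := ℤ × ℤ

theorem mem_nbrs {x y : Site} : y ∈ nbrs x ↔
    y = (x.1 + 1, x.2) ∨ y = (x.1 - 1, x.2) ∨ y = (x.1, x.2 + 1) ∨ y = (x.1, x.2 - 1) := by
  simp [nbrs]

theorem nbrs_symm (x y : Site) (h : y ∈ nbrs x) : x ∈ nbrs y := by
  rw [mem_nbrs] at *
  rcases h with rfl | rfl | rfl | rfl <;> simp

theorem card_nbrs (x : Site) : (nbrs x).card = 4 := by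
  obtain ⟨a, b⟩ := x
  unfold nbrs
  rw [Finset.card_insert_of_notMem, Finset.card_insert_of_notMem, Finset.card_insert_of_notMem,
    Finset.card_singleton] <;> simp <;> omega

/-- Weight of the configuration with set of minus spins `M`. -/
noncomputable def wt (s : ℝ) (M : Finset Site) : ℝ := s ^ (2 * cut nbrs M)

/-- Partition function with `A` frozen to minus and the complement of `Λ` frozen to plus. -/
noncomputable def Zp (s : ℝ) (A Λ : Finset Site) : ℝ := ∑ M ∈ Finset.Icc A Λ, wt s M

open Classical in
/-- Weight of an event with `A` frozen to minus and the complement of `Λ` frozen to plus. -/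
noncomputable def Wev (s : ℝ) (A Λ : Finset Site) (E : Finset Site → Prop) : ℝ :=
  ∑ M ∈ Finset.Icc A Λ, if E M then wt s M else 0

/-- Probability of an event with `A` frozen to minus and the complement of `Λ` frozen to plus. -/
noncomputable def Pr (s : ℝ) (A Λ : Finset Site) (E : Finset Site → Prop) : ℝ :=
  Wev s A Λ E / Zp s A Λ

variable {s : ℝ}

theorem wt_pos (hs : 0 < s) (M : Finset Site) : 0 < wt s M := pow_pos hs _

theorem Zp_pos (hs : 0 < s) {A Λ : Finset Site} (h : A ⊆ Λ) : 0 < Zp s A Λ :=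
  Finset.sum_pos (fun M _ => wt_pos hs M) ⟨A, Finset.mem_Icc.2 ⟨le_rfl, h⟩⟩

theorem Wev_nonneg (hs : 0 < s) (A Λ : Finset Site) (E : Finset Site → Prop) : 0 ≤ Wev s A Λ E :=
  Finset.sum_nonneg fun M _ => by split_ifs <;> [exact (wt_pos hs M).le; exact le_rfl]

theorem Pr_nonneg (hs : 0 < s) (A Λ : Finset Site) (E : Finset Site → Prop) : 0 ≤ Pr s A Λ E :=
  div_nonneg (Wev_nonneg hs _ _ _) (Finset.sum_nonneg fun M _ => (wt_pos hs M).le)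

theorem Wev_mono_event (hs : 0 < s) {A Λ : Finset Site} {E E' : Finset Site → Prop}
    (h : ∀ M, A ⊆ M → M ⊆ Λ → E M → E' M) : Wev s A Λ E ≤ Wev s A Λ E' := by
  classical
  refine Finset.sum_le_sum fun M hM => ?_
  rw [Finset.mem_Icc] at hM
  by_cases hE : E M
  · simp [hE, h M hM.1 hM.2 hE]
  · simp only [hE, if_false]
    split_ifs <;> [exact (wt_pos hs M).le; exact le_rfl]

theorem Pr_mono_event (hs : 0 < s) {A Λ : Finset Site} {E E' : Finset Site → Prop}
    (h : ∀ M, A ⊆ M → M ⊆ Λ → E M → E' M) : Pr s A Λ E ≤ Pr s A Λ E' :=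
  div_le_div_of_nonneg_right (Wev_mono_event hs h)
    (Finset.sum_nonneg fun M _ => (wt_pos hs M).le)

theorem Wev_congr {A Λ : Finset Site} {E E' : Finset Site → Prop}
    (h : ∀ M, A ⊆ M → M ⊆ Λ → (E M ↔ E' M)) : Wev s A Λ E = Wev s A Λ E' := by
  classical
  refine Finset.sum_congr rfl fun M hM => ?_
  rw [Finset.mem_Icc] at hM
  exact if_congr (h M hM.1 hM.2) rfl rfl

theorem Pr_congr {A Λ : Finset Site} {E E' : Finset Site → Prop}
    (h : ∀ M, A ⊆ M → M ⊆ Λ → (E M ↔ E' M)) : Pr s A Λ E = Pr s A Λ E' := by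
  unfold Pr; rw [Wev_congr h]

theorem Wev_true (A Λ : Finset Site) : Wev s A Λ (fun _ => True) = Zp s A Λ := by
  simp [Wev, Zp]

theorem Wev_le_Zp (hs : 0 < s) (A Λ : Finset Site) (E : Finset Site → Prop) :
    Wev s A Λ E ≤ Zp s A Λ := by
  rw [← Wev_true]; exact Wev_mono_event hs fun _ _ _ _ => trivial

theorem Pr_le_one (hs : 0 < s) (A Λ : Finset Site) (E : Finset Site → Prop) :
    Pr s A Λ E ≤ 1 :=
  div_le_one_of_le₀ (Wev_le_Zp hs _ _ _) (Finset.sum_nonneg fun M _ => (wt_pos hs M).le)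

theorem Wev_superset {A A' Λ : Finset Site} (h : A ⊆ A') :
    Wev s A Λ (fun M => A' ⊆ M) = Zp s A' Λ := by
  unfold Wev Zp
  trans ∑ M ∈ (Finset.Icc A Λ).filter (A' ⊆ ·), wt s M
  · rw [Finset.sum_filter]
    exact Finset.sum_congr rfl fun M _ => by by_cases hM : A' ⊆ M <;> simp [hM]
  refine Finset.sum_congr ?_ fun _ _ => rfl
  ext M
  simp only [Finset.mem_filter, Finset.mem_Icc]
  exact ⟨fun h => ⟨h.2, h.1.2⟩, fun h' => ⟨⟨h.trans h'.1, h'.2⟩, h'.1⟩⟩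

theorem Pr_superset {A J Λ : Finset Site} :
    Pr s A Λ (fun M => J ⊆ M) = Zp s (A ∪ J) Λ / Zp s A Λ := by
  unfold Pr
  rw [← Wev_superset (A := A) (A' := A ∪ J) Finset.subset_union_left]
  congr 1
  exact Wev_congr fun M hM _ => ⟨fun h => Finset.union_subset hM h,
    fun h => (Finset.subset_union_right).trans h⟩

/-- Monotonicity of the law in the frozen minus set and in the volume (Holley). -/
theorem Pr_mono (hs : 0 < s) (hs1 : s ≤ 1) {A Λ A' Λ' : Finset Site} (hAΛ : A ⊆ Λ)
    (hAA : A ⊆ A') (hA' : A' ⊆ Λ') (hΛ : Λ ⊆ Λ') {E : Finset Site → Prop}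
    (hE : ∀ M N, M ⊆ N → E M → E N) : Pr s A Λ E ≤ Pr s A' Λ' E := by
  classical
  unfold Pr
  rw [div_le_div_iff₀ (Zp_pos hs hAΛ) (Zp_pos hs hA')]
  let f₁ : Finset Site → ℝ := fun M => if M ∈ Finset.Icc A Λ ∧ E M then wt s M else 0
  let f₂ : Finset Site → ℝ := fun M => if M ∈ Finset.Icc A' Λ' then wt s M else 0
  let f₃ : Finset Site → ℝ := fun M => if M ∈ Finset.Icc A Λ then wt s M else 0
  let f₄ : Finset Site → ℝ := fun M => if M ∈ Finset.Icc A' Λ' ∧ E M then wt s M else 0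
  have n : ∀ (p : Prop) [Decidable p] M, 0 ≤ if p then wt s M else 0 := fun p _ M => by
    split_ifs <;> [exact (wt_pos hs M).le; exact le_rfl]
  have key := four_functions_theorem (f₁ := f₁) (f₂ := f₂) (f₃ := f₃) (f₄ := f₄)
    (fun M => n _ M) (fun M => n _ M) (fun M => n _ M) (fun M => n _ M) (by
      intro M N
      by_cases h1 : M ∈ Finset.Icc A Λ ∧ E M
      swap
      · simp only [f₁, h1, if_false, zero_mul]; exact mul_nonneg (n _ _) (n _ _)
      by_cases h2 : N ∈ Finset.Icc A' Λ'
      swap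
      · simp only [f₂, h2, if_false, mul_zero]; exact mul_nonneg (n _ _) (n _ _)
      have h3 : M ⊓ N ∈ Finset.Icc A Λ := by
        have := h1.1
        rw [Finset.mem_Icc] at *
        exact ⟨le_inf this.1 (hAA.trans h2.1), inf_le_left.trans this.2⟩
      have h4 : M ⊔ N ∈ Finset.Icc A' Λ' ∧ E (M ⊔ N) := by
        refine ⟨?_, hE M _ le_sup_left h1.2⟩
        have := h1.1
        rw [Finset.mem_Icc] at *
        exact ⟨h2.1.trans le_sup_right, sup_le (this.2.trans hΛ) h2.2⟩
      simp only [f₁, f₂, f₃, f₄, if_pos h1, if_pos h2, if_pos h3, if_pos h4]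
      unfold wt
      rw [← pow_add, ← pow_add, ← mul_add, ← mul_add]
      exact pow_le_pow_of_le_one hs.le hs1
        (Nat.mul_le_mul_left _ (cut_inter_add_cut_union_le nbrs M N)))
    ((Finset.Icc A Λ)) ((Finset.Icc A' Λ'))
  have e1 : ∑ M ∈ Finset.Icc A Λ, f₁ M = Wev s A Λ E := by
    unfold Wev
    exact Finset.sum_congr rfl fun M hM => if_congr (by simp only [hM, true_and]) rfl rfl
  have e2 : ∑ M ∈ Finset.Icc A' Λ', f₂ M = Zp s A' Λ' :=
    Finset.sum_congr rfl fun M hM => by simp only [f₂, hM, if_true]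
  have e3 : ∀ S : Finset (Finset Site), ∑ M ∈ S, f₃ M ≤ Zp s A Λ := by
    intro S
    calc ∑ M ∈ S, f₃ M ≤ ∑ M ∈ S ∪ Finset.Icc A Λ, f₃ M :=
          Finset.sum_le_sum_of_subset_of_nonneg Finset.subset_union_left fun M _ _ => n _ M
      _ = ∑ M ∈ Finset.Icc A Λ, f₃ M := (Finset.sum_subset Finset.subset_union_right
          fun M _ hM => by simp only [f₃, hM, if_false]).symm
      _ = _ := Finset.sum_congr rfl fun M hM => by simp only [f₃, hM, if_true]
  have e4 : ∀ S : Finset (Finset Site), ∑ M ∈ S, f₄ M ≤ Wev s A' Λ' E := by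
    intro S
    calc ∑ M ∈ S, f₄ M ≤ ∑ M ∈ S ∪ Finset.Icc A' Λ', f₄ M :=
          Finset.sum_le_sum_of_subset_of_nonneg Finset.subset_union_left fun M _ _ => n _ M
      _ = ∑ M ∈ Finset.Icc A' Λ', f₄ M := (Finset.sum_subset Finset.subset_union_right
          fun M _ hM => by simp only [f₄, hM, false_and, if_false]).symm
      _ = _ := by
        unfold Wev
        exact Finset.sum_congr rfl fun M hM => if_congr (by simp only [hM, true_and]) rfl rfl
  rw [e1, e2] at key
  refine key.trans ?_
  rw [mul_comm (Wev s A' Λ' E)]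
  exact mul_le_mul (e3 _) (e4 _) (Finset.sum_nonneg fun M _ => n _ M)
    (Zp_pos hs hAΛ).le

theorem sum_Icc_eq {A Λ : Finset Site} (h : A ⊆ Λ) (g : Finset Site → ℝ) :
    ∑ M ∈ Finset.Icc A Λ, g M = ∑ f ∈ (Λ \ A).powerset, g (A ∪ f) := by
  rw [Finset.Icc_eq_image_powerset h, Finset.sum_image]
  intro f hf f' hf' hff
  rw [Finset.mem_coe, Finset.mem_powerset] at hf hf'
  have d : ∀ g ⊆ Λ \ A, (A ∪ g) \ A = g := fun g hg => by
    rw [Finset.union_sdiff_left]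
    exact Finset.sdiff_eq_self_of_disjoint (Finset.disjoint_of_subset_left hg
      Finset.sdiff_disjoint)
  rw [← d f hf, ← d f' hf']
  exact congrArg (· \ A) hff

theorem wt_union {F A f : Finset Site} (hAF : Disjoint A F) (hf : f ⊆ F) :
    wt s (A ∪ f) = s ^ energy nbrs F ↑(A ∪ f) * s ^ (2 * outerCut nbrs F A) := by
  unfold wt
  rw [two_mul_cut nbrs nbrs_symm hAF hf, pow_add]

/-- The conditional law of the free spins only depends on the frozen spins adjacent to them. -/
theorem Pr_eq_of_agree (hs : 0 < s) {A Λ A' Λ' F : Finset Site} (hA : A ⊆ Λ) (hA' : A' ⊆ Λ')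
    (hF : Λ \ A = F) (hF' : Λ' \ A' = F)
    (hag : ∀ x ∈ F, ∀ y ∈ nbrs x, y ∉ F → (y ∈ A ↔ y ∈ A')) {E E' : Finset Site → Prop}
    (hE : ∀ f ⊆ F, (E (A ∪ f) ↔ E' (A' ∪ f))) : Pr s A Λ E = Pr s A' Λ' E' := by
  classical
  have hdA : Disjoint A F := hF ▸ Finset.disjoint_sdiff
  have hdA' : Disjoint A' F := hF' ▸ Finset.disjoint_sdiff
  have hen : ∀ f ⊆ F, energy nbrs F (↑(A ∪ f) : Set Site) = energy nbrs F ↑(A' ∪ f) := by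
    intro f hf
    refine energy_congr nbrs (fun x hx => ?_) (fun x hx y hy hyF => ?_)
    · have h1 := Finset.disjoint_right.1 hdA hx
      have h2 := Finset.disjoint_right.1 hdA' hx
      simp [h1, h2]
    · have := hag x hx y hy hyF
      simp [this]
  obtain ⟨c, hc, hw⟩ : ∃ c : ℝ, 0 < c ∧ ∀ f ⊆ F, wt s (A ∪ f) = c * wt s (A' ∪ f) := by
    refine ⟨s ^ (2 * outerCut nbrs F A) / s ^ (2 * outerCut nbrs F A'), by positivity, ?_⟩
    intro f hf
    rw [wt_union hdA hf, wt_union hdA' hf, hen f hf]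
    field_simp
  have e1 : Wev s A Λ E = c * Wev s A' Λ' E' := by
    unfold Wev
    rw [sum_Icc_eq hA, sum_Icc_eq hA', hF, hF', Finset.mul_sum]
    refine Finset.sum_congr rfl fun f hf => ?_
    rw [Finset.mem_powerset] at hf
    by_cases h : E' (A' ∪ f)
    · simp [(hE f hf).2 h, h, hw f hf]
    · have h' : ¬ E (A ∪ f) := fun h' => h ((hE f hf).1 h')
      simp [h', h]
  have e2 : Zp s A Λ = c * Zp s A' Λ' := by
    unfold Zp
    rw [sum_Icc_eq hA, sum_Icc_eq hA', hF, hF', Finset.mul_sum]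
    exact Finset.sum_congr rfl fun f hf => hw f (Finset.mem_powerset.1 hf)
  unfold Pr
  rw [e1, e2, mul_div_mul_left _ _ hc.ne']

theorem sum_Icc_map (e : Site ≃ Site) (A Λ : Finset Site) (g : Finset Site → ℝ) :
    ∑ M ∈ Finset.Icc (A.map e.toEmbedding) (Λ.map e.toEmbedding), g M
      = ∑ M ∈ Finset.Icc A Λ, g (M.map e.toEmbedding) := by
  symm
  refine Finset.sum_bij (fun M _ => M.map e.toEmbedding) ?_ ?_ ?_ fun _ _ => rfl
  · intro M hM
    rw [Finset.mem_Icc] at *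
    exact ⟨Finset.map_subset_map.2 hM.1, Finset.map_subset_map.2 hM.2⟩
  · intro M _ N _ h; exact Finset.map_injective _ h
  · intro M hM
    have : (M.map e.symm.toEmbedding).map e.toEmbedding = M := by
      rw [Finset.map_map]; ext x; simp
    refine ⟨M.map e.symm.toEmbedding, ?_, this⟩
    rw [Finset.mem_Icc] at *
    rw [← this] at hM
    exact ⟨Finset.map_subset_map.1 hM.1, Finset.map_subset_map.1 hM.2⟩

theorem Zp_map (e : Site ≃ Site) (he : ∀ x, nbrs (e x) = (nbrs x).map e.toEmbedding)
    (A Λ : Finset Site) : Zp s (A.map e.toEmbedding) (Λ.map e.toEmbedding) = Zp s A Λ := by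
  unfold Zp
  rw [sum_Icc_map]
  exact Finset.sum_congr rfl fun M _ => by unfold wt; rw [cut_map nbrs e he]

theorem Pr_map (e : Site ≃ Site) (he : ∀ x, nbrs (e x) = (nbrs x).map e.toEmbedding)
    (A Λ : Finset Site) (E : Finset Site → Prop) :
    Pr s (A.map e.toEmbedding) (Λ.map e.toEmbedding) E
      = Pr s A Λ (fun M => E (M.map e.toEmbedding)) := by
  unfold Pr
  rw [Zp_map e he]
  congr 1
  unfold Wev
  rw [sum_Icc_map]
  exact Finset.sum_congr rfl fun M _ => by unfold wt; rw [cut_map nbrs e he]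

theorem cut_insert_le (M : Finset Site) (x : Site) :
    cut nbrs (insert x M) ≤ cut nbrs M + 4 := by
  by_cases hx : x ∈ M
  · rw [Finset.insert_eq_of_mem hx]; omega
  unfold cut
  rw [Finset.sum_insert hx, add_comm]
  refine add_le_add (Finset.sum_le_sum fun y _ => Finset.sum_le_sum fun z _ => ?_) ?_
  · by_cases hz : z ∈ M <;> simp [hz]
    split_ifs <;> omega
  · calc ∑ y ∈ nbrs x, (if y ∈ insert x M then 0 else 1) ≤ ∑ y ∈ nbrs x, 1 :=
        Finset.sum_le_sum fun y _ => by split_ifs <;> omega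
      _ = 4 := by simp [card_nbrs]

theorem cut_erase_le (M : Finset Site) (x : Site) :
    cut nbrs (M.erase x) ≤ cut nbrs M + 4 := by
  by_cases hx : x ∈ M
  swap
  · rw [Finset.erase_eq_of_notMem hx]; omega
  obtain ⟨N, hN, rfl⟩ : ∃ N, x ∉ N ∧ M = insert x N :=
    ⟨M.erase x, Finset.notMem_erase _ _, (Finset.insert_erase hx).symm⟩
  rw [Finset.erase_insert hN]
  have h1 : cut nbrs N = ∑ y ∈ N, ∑ z ∈ nbrs y, (if z ∈ insert x N then 0 else 1)
      + ∑ y ∈ N, ∑ z ∈ nbrs y, if z = x then 1 else 0 := by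
    unfold cut
    rw [← Finset.sum_add_distrib]
    refine Finset.sum_congr rfl fun y _ => ?_
    rw [← Finset.sum_add_distrib]
    refine Finset.sum_congr rfl fun z _ => ?_
    by_cases h : z = x
    · subst h; simp [hN]
    · simp [h]
  have h2 : ∑ y ∈ N, ∑ z ∈ nbrs y, (if z = x then 1 else 0) ≤ 4 := by
    calc ∑ y ∈ N, ∑ z ∈ nbrs y, (if z = x then 1 else 0)
        = ∑ y ∈ N, if y ∈ nbrs x then 1 else 0 := by
          refine Finset.sum_congr rfl fun y _ => ?_
          rw [Finset.sum_ite_eq']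
          exact if_congr ⟨nbrs_symm _ _, nbrs_symm _ _⟩ rfl rfl
      _ = (N.filter (· ∈ nbrs x)).card := by rw [Finset.card_filter]
      _ ≤ (nbrs x).card := Finset.card_le_card fun y hy => (Finset.mem_filter.1 hy).2
      _ = 4 := card_nbrs x
  have h3 : ∑ y ∈ N, ∑ z ∈ nbrs y, (if z ∈ insert x N then 0 else 1) ≤ cut nbrs (insert x N) := by
    unfold cut
    exact Finset.sum_le_sum_of_subset (Finset.subset_insert _ _)
  omega

theorem Zp_insert_ge (hs : 0 < s) (hs1 : s ≤ 1) {A Λ : Finset Site} {x : Site} (hx : x ∈ Λ) :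
    Zp s A Λ ≤ (1 + (s ^ 8)⁻¹) * Zp s (insert x A) Λ := by
  classical
  have h1 : Zp s A Λ = ∑ M ∈ (Finset.Icc A Λ).filter (x ∈ ·), wt s M
      + ∑ M ∈ (Finset.Icc A Λ).filter (x ∉ ·), wt s M := by
    unfold Zp; rw [Finset.sum_filter_add_sum_filter_not]
  have h2 : ∑ M ∈ (Finset.Icc A Λ).filter (x ∈ ·), wt s M ≤ Zp s (insert x A) Λ := by
    refine Finset.sum_le_sum_of_subset_of_nonneg (fun M hM => ?_) fun M _ _ => (wt_pos hs M).le
    rw [Finset.mem_filter, Finset.mem_Icc] at hM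
    exact Finset.mem_Icc.2 ⟨Finset.insert_subset hM.2 hM.1.1, hM.1.2⟩
  have h3 : ∑ M ∈ (Finset.Icc A Λ).filter (x ∉ ·), wt s M
      ≤ (s ^ 8)⁻¹ * Zp s (insert x A) Λ := by
    unfold Zp
    rw [Finset.mul_sum]
    calc ∑ M ∈ (Finset.Icc A Λ).filter (x ∉ ·), wt s M
        ≤ ∑ M ∈ (Finset.Icc A Λ).filter (x ∉ ·), (s ^ 8)⁻¹ * wt s (insert x M) := by
          refine Finset.sum_le_sum fun M _ => ?_
          rw [inv_mul_eq_div, le_div_iff₀ (by positivity)]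
          unfold wt
          rw [← pow_add]
          exact pow_le_pow_of_le_one hs.le hs1 (by have := cut_insert_le M x; omega)
      _ = ∑ M ∈ ((Finset.Icc A Λ).filter (x ∉ ·)).image (insert x), (s ^ 8)⁻¹ * wt s M := by
          rw [Finset.sum_image]
          intro M hM N hN h
          rw [Finset.mem_coe, Finset.mem_filter] at hM hN
          rw [← Finset.erase_insert hM.2, ← Finset.erase_insert hN.2]
          exact congrArg (·.erase x) h
      _ ≤ _ := by
          refine Finset.sum_le_sum_of_subset_of_nonneg (fun M hM => ?_)
            fun M _ _ => mul_nonneg (by positivity) (wt_pos hs M).le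
          obtain ⟨N, hN, rfl⟩ := Finset.mem_image.1 hM
          rw [Finset.mem_filter, Finset.mem_Icc] at hN
          exact Finset.mem_Icc.2 ⟨Finset.insert_subset_insert _ hN.1.1,
            Finset.insert_subset hx hN.1.2⟩
  rw [h1, add_mul, one_mul]
  exact add_le_add h2 h3

end Law

section PowerIteration

open Matrix

variable {ι : Type*} [Fintype ι] [DecidableEq ι]

theorem exists_orthonormal_eigenvectors (T : Module.End ℝ (ι → ℝ))
    (hs : ∀ f g, f ⬝ᵥ T g = T f ⬝ᵥ g) : ∃ (e : ι → ι → ℝ) (l : ι → ℝ),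
      (∀ i, T (e i) = l i • e i) ∧ (∀ i j, e i ⬝ᵥ e j = if i = j then 1 else 0) ∧
      ∀ u : ι → ℝ, u = ∑ i, (e i ⬝ᵥ u) • e i := by
  have hM : (LinearMap.toMatrix' T).IsHermitian := by
    ext i j
    have := hs (Pi.single i 1) (Pi.single j 1)
    simp only [single_dotProduct, dotProduct_single, one_mul, mul_one] at this
    simp [LinearMap.toMatrix'_apply, this]
  refine ⟨fun i => (hM.eigenvectorBasis i).ofLp, hM.eigenvalues, fun i => ?_, fun i j => ?_,
    fun u => ?_⟩
  · have := hM.mulVec_eigenvectorBasis i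
    rw [← this, LinearMap.toMatrix'_mulVec]
  · have := hM.eigenvectorBasis.inner_eq_ite i j
    rw [← this]
    simp [PiLp.inner_apply, dotProduct, mul_comm]
  · have := hM.eigenvectorBasis.sum_repr (WithLp.toLp 2 u)
    have h2 := congrArg WithLp.ofLp this
    simp only [WithLp.ofLp_sum, WithLp.ofLp_smul] at h2
    refine h2.symm.trans (Finset.sum_congr rfl fun i _ => ?_)
    congr 1
    rw [OrthonormalBasis.repr_apply_apply]
    simp [PiLp.inner_apply, dotProduct, mul_comm]

theorem power_iteration (T : Module.End ℝ (ι → ℝ)) (hs : ∀ f g, f ⬝ᵥ T g = T f ⬝ᵥ g)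
    (hp : ∀ f, f ≠ 0 → 0 < f ⬝ᵥ T f) {u : ι → ℝ} (hu : u ≠ 0) :
    ∃ l : ℝ, 0 < l ∧ ∃ φ : ι → ℝ, T φ = l • φ ∧ 0 < u ⬝ᵥ φ ∧
      Tendsto (fun n : ℕ => (l ^ n)⁻¹ • (T ^ n) u) atTop (𝓝 φ) := by
  obtain ⟨e, l, hT, ho, hb⟩ := exists_orthonormal_eigenvectors T hs
  have he : ∀ i, e i ≠ 0 := fun i h => by
    have := ho i i
    simp [h] at this
  have hl : ∀ i, 0 < l i := fun i => by
    have := hp (e i) (he i)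
    rw [hT, dotProduct_smul, ho i i] at this
    simpa using this
  set c : ι → ℝ := fun i => e i ⬝ᵥ u with hc
  obtain ⟨i₀, hi₀, hmax⟩ : ∃ i₀, c i₀ ≠ 0 ∧ ∀ i, c i ≠ 0 → l i ≤ l i₀ := by
    have hne : (Finset.univ.filter fun i => c i ≠ 0).Nonempty := by
      by_contra h
      rw [Finset.not_nonempty_iff_eq_empty, Finset.filter_eq_empty_iff] at h
      refine hu ?_
      rw [hb u]
      refine Finset.sum_eq_zero fun i hi => ?_
      have : c i = 0 := by simpa using h hi
      change c i • e i = 0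
      rw [this, zero_smul]
    obtain ⟨i₀, h1, h2⟩ := Finset.exists_max_image _ l hne
    exact ⟨i₀, (Finset.mem_filter.1 h1).2, fun i hi => h2 i (by simp [hi])⟩
  have hpow : ∀ n : ℕ, (T ^ n) u = ∑ i, (c i * l i ^ n) • e i := by
    intro n
    induction n with
    | zero => simpa using hb u
    | succ n ih =>
      rw [pow_succ', Module.End.mul_apply, ih, map_sum]
      refine Finset.sum_congr rfl fun i _ => ?_
      rw [map_smul, hT, smul_smul]
      ring_nf
  refine ⟨l i₀, hl i₀, ∑ i, (if l i = l i₀ then c i else 0) • e i, ?_, ?_, ?_⟩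
  · rw [map_sum, Finset.smul_sum]
    refine Finset.sum_congr rfl fun i _ => ?_
    rw [map_smul, hT, smul_smul, smul_smul]
    split_ifs with h
    · rw [h, mul_comm]
    · simp
  · rw [dotProduct_sum]
    have : ∀ i, u ⬝ᵥ (if l i = l i₀ then c i else 0) • e i = if l i = l i₀ then c i ^ 2 else 0 := by
      intro i
      rw [dotProduct_smul, dotProduct_comm]
      split_ifs <;> simp [hc, sq]
    simp only [this]
    refine lt_of_lt_of_le (pow_pos (abs_pos.2 hi₀) 2)
      (le_trans (le_of_eq ?_) (Finset.single_le_sum (f := fun i => if l i = l i₀ then c i ^ 2 else 0)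
        (fun i _ => by positivity) (Finset.mem_univ i₀)))
    simp
  · simp only [hpow, Finset.smul_sum]
    refine tendsto_finsetSum _ fun i _ => ?_
    simp only [smul_smul]
    refine Tendsto.smul_const ?_ (e i)
    by_cases hci : c i = 0
    · simp [hci]
    by_cases h : l i = l i₀
    · simp only [h, if_true]
      refine tendsto_const_nhds.congr fun n => ?_
      have := (pow_pos (hl i₀) n).ne'
      field_simp
    · simp only [h, if_false]
      have h1 : l i / l i₀ < 1 := (div_lt_one (hl i₀)).2 (lt_of_le_of_ne (hmax i hci) h)
      have h2 := (tendsto_pow_atTop_nhds_zero_of_lt_one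
        (div_nonneg (hl i).le (hl i₀).le) h1).const_mul (c i)
      rw [mul_zero] at h2
      refine h2.congr fun n => ?_
      rw [div_pow]
      have := (pow_pos (hl i₀) n).ne'
      field_simp

end PowerIteration

section Transfer

open Matrix

/-- Domain wall variables of a column: entry `j` says whether spins `j` and `j + 1` differ. -/
abbrev Wall (h : ℕ) := Fin (h + 1) → Bool

abbrev Op (h : ℕ) := Module.End ℝ (Wall h → ℝ)

variable {h : ℕ}

def flip (i : Fin (h + 1)) (S : Wall h) : Wall h := Function.update S i (!S i)

theorem flip_flip (i : Fin (h + 1)) (S : Wall h) : flip i (flip i S) = S := by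
  ext j; by_cases hj : j = i
  · subst hj; simp [flip]
  · simp [flip, hj]

theorem flip_comm (i j : Fin (h + 1)) (S : Wall h) : flip i (flip j S) = flip j (flip i S) := by
  ext k
  by_cases hi : k = i <;> by_cases hj : k = j
  · subst hi; subst hj; rfl
  · subst hi; simp [flip, hj]
  · subst hj; simp [flip, hi]
  · simp [flip, hi, hj]

noncomputable def sgn (i : Fin (h + 1)) (S : Wall h) : ℝ := if S i then -1 else 1

theorem sgn_mul_self (i : Fin (h + 1)) (S : Wall h) : sgn i S * sgn i S = 1 := by
  unfold sgn; split_ifs <;> norm_num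

theorem sgn_flip (i k : Fin (h + 1)) (S : Wall h) :
    sgn i (flip k S) = (if i = k then -1 else 1) * sgn i S := by
  unfold sgn flip
  by_cases hik : i = k
  · subst hik; cases S i <;> simp
  · simp [hik]

noncomputable def walsh (T : Finset (Fin (h + 1))) (S : Wall h) : ℝ := ∏ i ∈ T, sgn i S

theorem walsh_flip (T : Finset (Fin (h + 1))) (k : Fin (h + 1)) (S : Wall h) :
    walsh T (flip k S) = (if k ∈ T then -1 else 1) * walsh T S := by
  unfold walsh
  simp only [sgn_flip, Finset.prod_mul_distrib]
  rw [Finset.prod_ite_eq']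

/-- Number of domain walls. -/
def walls (S : Wall h) : ℕ := ∑ i, if S i then 1 else 0

noncomputable def flipOp (i : Fin (h + 1)) : Op h := LinearMap.funLeft ℝ ℝ (flip i)

@[simp] theorem flipOp_apply (i : Fin (h + 1)) (f : Wall h → ℝ) (S : Wall h) :
    flipOp i f S = f (flip i S) := rfl

noncomputable def pairOp (i : Fin h) : Op h := flipOp i.castSucc * flipOp i.succ

@[simp] theorem pairOp_apply (i : Fin h) (f : Wall h → ℝ) (S : Wall h) :
    pairOp i f S = f (flip i.succ (flip i.castSucc S)) := rfl

noncomputable def bondOp (t : ℝ) (i : Fin h) : Op h := 1 + t • pairOp i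

@[simp] theorem bondOp_apply (t : ℝ) (i : Fin h) (f : Wall h → ℝ) (S : Wall h) :
    bondOp t i f S = f S + t * f (flip i.succ (flip i.castSucc S)) := rfl

noncomputable def horOp (t : ℝ) (L : List (Fin h)) : Op h := (L.map (bondOp t)).prod

noncomputable def verOp (h : ℕ) (s : ℝ) : Op h := LinearMap.mulLeft ℝ fun S => s ^ walls S

@[simp] theorem verOp_apply (s : ℝ) (f : Wall h → ℝ) (S : Wall h) :
    verOp h s f S = s ^ walls S * f S := rfl

/-- Fermion operators of the Jordan–Wigner transform. -/
noncomputable def fermE (j : Fin (h + 1)) : Op h :=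
  LinearMap.mulLeft ℝ (walsh (Finset.univ.filter (· < j))) * flipOp j

noncomputable def fermO (j : Fin (h + 1)) : Op h :=
  LinearMap.mulLeft ℝ (walsh (Finset.univ.filter (· ≤ j))) * flipOp j

@[simp] theorem fermE_apply (j : Fin (h + 1)) (f : Wall h → ℝ) (S : Wall h) :
    fermE j f S = walsh (Finset.univ.filter (· < j)) S * f (flip j S) := rfl

@[simp] theorem fermO_apply (j : Fin (h + 1)) (f : Wall h → ℝ) (S : Wall h) :
    fermO j f S = walsh (Finset.univ.filter (· ≤ j)) S * f (flip j S) := rfl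

theorem pairOp_comm (i j : Fin h) : Commute (pairOp i) (pairOp j) := by
  refine LinearMap.ext fun f => funext fun S => ?_
  simp only [Module.End.mul_apply, pairOp_apply]
  congr 1
  rw [flip_comm j.castSucc, flip_comm j.succ, flip_comm j.castSucc i.castSucc,
    flip_comm j.succ i.castSucc]

theorem walls_flip (j : Fin (h + 1)) (S : Wall h) :
    walls (flip j S) + (if S j then 1 else 0) = walls S + (if S j then 0 else 1) := by
  unfold walls
  rw [← Finset.add_sum_erase _ _ (Finset.mem_univ j),
    ← Finset.add_sum_erase (a := j) Finset.univ (fun i => if S i then 1 else 0) (Finset.mem_univ j)]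
  have : ∑ x ∈ Finset.univ.erase j, (if flip j S x = true then 1 else 0)
      = ∑ x ∈ Finset.univ.erase j, if S x = true then 1 else 0 := by
    refine Finset.sum_congr rfl fun x hx => ?_
    rw [Finset.mem_erase] at hx
    simp [flip, hx.1]
  rw [this]
  cases h : S j <;> simp [flip, h] <;> omega

theorem fermO_eq (j : Fin (h + 1)) (S : Wall h) :
    walsh (Finset.univ.filter (· ≤ j)) S = sgn j S * walsh (Finset.univ.filter (· < j)) S := by
  have : (Finset.univ.filter (· ≤ j)) = insert j (Finset.univ.filter (· < j)) := by
    ext k; simp [le_iff_eq_or_lt]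
  unfold walsh
  rw [this, Finset.prod_insert (by simp)]

variable {s : ℝ}

theorem verOp_fermE (hs : 0 < s) (j : Fin (h + 1)) : verOp h s * fermE j
    = (((s⁻¹ + s) / 2) • fermE j + ((s⁻¹ - s) / 2) • fermO j) * verOp h s := by
  refine LinearMap.ext fun f => funext fun S => ?_
  simp only [Module.End.mul_apply, LinearMap.add_apply, LinearMap.smul_apply, Pi.add_apply,
    Pi.smul_apply, verOp_apply, fermE_apply, fermO_apply, fermO_eq, smul_eq_mul]
  have := walls_flip j S
  unfold sgn
  cases hS : S j
  · simp only [hS, Bool.false_eq_true, if_false] at this ⊢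
    rw [show walls (flip j S) = walls S + 1 by omega, pow_succ]
    field_simp
    ring
  · simp only [hS, if_true] at this ⊢
    rw [show walls S = walls (flip j S) + 1 by omega, pow_succ]
    ring

theorem verOp_fermO (hs : 0 < s) (j : Fin (h + 1)) : verOp h s * fermO j
    = (((s⁻¹ + s) / 2) • fermO j + ((s⁻¹ - s) / 2) • fermE j) * verOp h s := by
  refine LinearMap.ext fun f => funext fun S => ?_
  simp only [Module.End.mul_apply, LinearMap.add_apply, LinearMap.smul_apply, Pi.add_apply,
    Pi.smul_apply, verOp_apply, fermE_apply, fermO_apply, fermO_eq, smul_eq_mul]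
  have := walls_flip j S
  unfold sgn
  cases hS : S j
  · simp only [hS, Bool.false_eq_true, if_false] at this ⊢
    rw [show walls (flip j S) = walls S + 1 by omega, pow_succ]
    field_simp
    ring
  · simp only [hS, if_true] at this ⊢
    rw [show walls S = walls (flip j S) + 1 by omega, pow_succ]
    ring

theorem pairOp_fermE_of_ne (i : Fin h) (j : Fin (h + 1)) (hij : j ≠ i.succ) :
    pairOp i * fermE j = fermE j * pairOp i := by
  refine LinearMap.ext fun f => funext fun S => ?_
  simp only [Module.End.mul_apply, pairOp_apply, fermE_apply, walsh_flip, Finset.mem_filter,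
    Finset.mem_univ, true_and]
  have : (i.succ < j) ↔ (i.castSucc < j) := by
    rw [Fin.lt_def, Fin.lt_def]
    have : (j : ℕ) ≠ i + 1 := fun h => hij (Fin.ext (by simpa using h))
    simp; omega
  rw [flip_comm j, flip_comm j]
  simp only [this]
  split_ifs <;> ring

theorem pairOp_fermO_of_ne (i : Fin h) (j : Fin (h + 1)) (hij : j ≠ i.castSucc) :
    pairOp i * fermO j = fermO j * pairOp i := by
  refine LinearMap.ext fun f => funext fun S => ?_
  simp only [Module.End.mul_apply, pairOp_apply, fermO_apply, walsh_flip, Finset.mem_filter,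
    Finset.mem_univ, true_and]
  have : (i.succ ≤ j) ↔ (i.castSucc ≤ j) := by
    rw [Fin.le_def, Fin.le_def]
    have : (j : ℕ) ≠ i := fun h => hij (Fin.ext (by simpa using h))
    simp; omega
  rw [flip_comm j, flip_comm j]
  simp only [this]
  split_ifs <;> ring

theorem filter_le_castSucc (i : Fin h) :
    (Finset.univ.filter (· ≤ i.castSucc)) = Finset.univ.filter (· < i.succ) := by
  ext k
  simp [Fin.lt_def, Fin.le_def]

theorem pairOp_fermE (i : Fin h) : pairOp i * fermE i.succ = - fermO i.castSucc := by
  refine LinearMap.ext fun f => funext fun S => ?_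
  simp only [Module.End.mul_apply, pairOp_apply, fermE_apply, fermO_apply, walsh_flip,
    LinearMap.neg_apply, Pi.neg_apply, flip_flip, filter_le_castSucc]
  simp [Fin.lt_def]

theorem fermE_pairOp (i : Fin h) : fermE i.succ * pairOp i = fermO i.castSucc := by
  refine LinearMap.ext fun f => funext fun S => ?_
  simp only [Module.End.mul_apply, pairOp_apply, fermE_apply, fermO_apply, filter_le_castSucc]
  rw [flip_comm i.castSucc, flip_flip]

theorem pairOp_fermO (i : Fin h) : pairOp i * fermO i.castSucc = - fermE i.succ := by
  refine LinearMap.ext fun f => funext fun S => ?_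
  simp only [Module.End.mul_apply, pairOp_apply, fermE_apply, fermO_apply, walsh_flip,
    LinearMap.neg_apply, Pi.neg_apply, filter_le_castSucc]
  rw [flip_comm i.castSucc, flip_flip]
  simp [Fin.lt_def]

theorem fermO_pairOp (i : Fin h) : fermO i.castSucc * pairOp i = fermE i.succ := by
  refine LinearMap.ext fun f => funext fun S => ?_
  simp only [Module.End.mul_apply, pairOp_apply, fermE_apply, fermO_apply, filter_le_castSucc,
    flip_flip]

end Transfer

section Gap

open Matrix

variable {h : ℕ} {s t : ℝ}

theorem bondOp_commute {i : Fin h} {Γ : Op h} (hc : pairOp i * Γ = Γ * pairOp i) :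
    Commute (bondOp t i) Γ := by
  unfold bondOp Commute SemiconjBy
  rw [add_mul, mul_add, one_mul, mul_one, smul_mul_assoc, mul_smul_comm, hc]

theorem horOp_commute {L : List (Fin h)} {Γ : Op h}
    (hc : ∀ i ∈ L, pairOp i * Γ = Γ * pairOp i) : Commute (horOp t L) Γ := by
  unfold horOp
  induction L with
  | nil => simp
  | cons i L ih =>
    rw [List.map_cons, List.prod_cons]
    exact (bondOp_commute (hc i (by simp))).mul_left (ih fun j hj => hc j (by simp [hj]))

theorem bondOp_fermE (ht : t ^ 2 ≠ 1) (i : Fin h) : bondOp t i * fermE i.succ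
    = (((1 + t ^ 2) / (1 - t ^ 2)) • fermE i.succ - (2 * t / (1 - t ^ 2)) • fermO i.castSucc)
      * bondOp t i := by
  unfold bondOp
  rw [add_mul, sub_mul, mul_add, mul_add, smul_mul_assoc, one_mul, smul_mul_assoc, smul_mul_assoc,
    mul_smul_comm, mul_smul_comm, smul_mul_assoc, smul_mul_assoc, pairOp_fermE, fermE_pairOp,
    fermO_pairOp, mul_one, mul_one]
  have : 1 - t ^ 2 ≠ 0 := sub_ne_zero.2 ht.symm
  match_scalars <;> field_simp <;> ring

theorem bondOp_fermO (ht : t ^ 2 ≠ 1) (i : Fin h) : bondOp t i * fermO i.castSucc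
    = (((1 + t ^ 2) / (1 - t ^ 2)) • fermO i.castSucc - (2 * t / (1 - t ^ 2)) • fermE i.succ)
      * bondOp t i := by
  unfold bondOp
  rw [add_mul, sub_mul, mul_add, mul_add, smul_mul_assoc, one_mul, smul_mul_assoc, smul_mul_assoc,
    mul_smul_comm, mul_smul_comm, smul_mul_assoc, smul_mul_assoc, pairOp_fermO, fermE_pairOp,
    fermO_pairOp, mul_one, mul_one]
  have : 1 - t ^ 2 ≠ 0 := sub_ne_zero.2 ht.symm
  match_scalars <;> field_simp <;> ring

/-- Transfer of horizontal bonds over all rows. -/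
noncomputable def horAll (h : ℕ) (t : ℝ) : Op h := horOp t (List.finRange h)

theorem horAll_conj {i : Fin h} {Γ Γ' : Op h}
    (h1 : ∀ j, j ≠ i → pairOp j * Γ = Γ * pairOp j)
    (hi : bondOp t i * Γ = Γ' * bondOp t i) : horAll h t * Γ = Γ' * horAll h t := by
  obtain ⟨L₁, L₂, hL⟩ := List.append_of_mem (List.mem_finRange i)
  have hn := List.nodup_finRange h
  have e : horAll h t = horOp t L₁ * bondOp t i * horOp t L₂ := by
    unfold horAll horOp
    rw [hL, List.map_append, List.prod_append, List.map_cons, List.prod_cons, mul_assoc]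
  rw [hL, List.nodup_append, List.nodup_cons] at hn
  have hm2 : ∀ j ∈ L₂, j ≠ i := fun j hj hji => hn.2.1.1 (hji ▸ hj)
  have hm1 : ∀ j ∈ L₁, j ≠ i := fun j hj hji => hn.2.2 j hj i (by simp) hji
  have c1 : Commute (bondOp t i) (horOp t L₁) := by
    refine bondOp_commute ?_
    unfold horOp
    refine Commute.list_prod_right _ _ fun x hx => ?_
    obtain ⟨j, _, rfl⟩ := List.mem_map.1 hx
    exact (bondOp_commute (pairOp_comm j i)).symm
  have e' : horAll h t = bondOp t i * horOp t L₁ * horOp t L₂ := by rw [e, c1.eq]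
  have c2 := (horOp_commute (t := t) (Γ := Γ) fun j hj => h1 j (hm2 j hj)).eq
  have c3 := (horOp_commute (t := t) (Γ := Γ) fun j hj => h1 j (hm1 j hj)).eq
  rw [e']
  calc bondOp t i * horOp t L₁ * horOp t L₂ * Γ
      = bondOp t i * (horOp t L₁ * (horOp t L₂ * Γ)) := by simp only [mul_assoc]
    _ = bondOp t i * Γ * (horOp t L₁ * horOp t L₂) := by
        rw [c2, ← mul_assoc (horOp t L₁), c3]; simp only [mul_assoc]
    _ = _ := by rw [hi]; simp only [mul_assoc]

theorem horAll_fermE (ht : t ^ 2 ≠ 1) (i : Fin h) : horAll h t * fermE i.succ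
    = (((1 + t ^ 2) / (1 - t ^ 2)) • fermE i.succ - (2 * t / (1 - t ^ 2)) • fermO i.castSucc)
      * horAll h t :=
  horAll_conj (fun j hj => pairOp_fermE_of_ne j _ fun h => hj (Fin.succ_injective _ h).symm)
    (bondOp_fermE ht i)

theorem horAll_fermO (ht : t ^ 2 ≠ 1) (i : Fin h) : horAll h t * fermO i.castSucc
    = (((1 + t ^ 2) / (1 - t ^ 2)) • fermO i.castSucc - (2 * t / (1 - t ^ 2)) • fermE i.succ)
      * horAll h t :=
  horAll_conj (fun j hj => pairOp_fermO_of_ne j _ fun h => hj (Fin.castSucc_injective _ h).symm)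
    (bondOp_fermO ht i)

theorem horAll_fermE_zero : horAll h t * fermE 0 = fermE 0 * horAll h t :=
  horOp_commute fun i _ => pairOp_fermE_of_ne i _ (Fin.succ_ne_zero i).symm

theorem horAll_fermO_last : horAll h t * fermO (Fin.last h) = fermO (Fin.last h) * horAll h t :=
  horOp_commute fun i _ => pairOp_fermO_of_ne i _ (Fin.castSucc_lt_last i).ne'

theorem dotProduct_flipOp (i : Fin (h + 1)) (f g : Wall h → ℝ) :
    f ⬝ᵥ flipOp i g = flipOp i f ⬝ᵥ g := by
  let e : Wall h ≃ Wall h := ⟨flip i, flip i, flip_flip i, flip_flip i⟩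
  unfold dotProduct
  rw [← e.sum_comp]
  refine Finset.sum_congr rfl fun S _ => ?_
  change f (flip i S) * g (flip i (flip i S)) = f (flip i S) * g S
  rw [flip_flip]

theorem dotProduct_verOp (f g : Wall h → ℝ) :
    f ⬝ᵥ verOp h s g = verOp h s f ⬝ᵥ g := by
  unfold dotProduct
  refine Finset.sum_congr rfl fun S _ => ?_
  simp only [verOp_apply]
  ring

theorem dotProduct_pairOp (i : Fin h) (f g : Wall h → ℝ) :
    f ⬝ᵥ pairOp i g = pairOp i f ⬝ᵥ g := by
  have e : pairOp i = flipOp i.succ * flipOp i.castSucc := by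
    refine LinearMap.ext fun f => funext fun S => ?_
    simp [Module.End.mul_apply, flip_comm i.succ]
  nth_rewrite 1 [e]
  unfold pairOp
  rw [Module.End.mul_apply, Module.End.mul_apply, dotProduct_flipOp, dotProduct_flipOp]

theorem dotProduct_bondOp (i : Fin h) (f g : Wall h → ℝ) :
    f ⬝ᵥ bondOp t i g = bondOp t i f ⬝ᵥ g := by
  unfold bondOp
  simp only [LinearMap.add_apply, LinearMap.smul_apply, Module.End.one_apply, dotProduct_add,
    add_dotProduct, dotProduct_smul, smul_dotProduct, dotProduct_pairOp]

theorem pairOp_horOp (i : Fin h) (L : List (Fin h)) : Commute (pairOp i) (horOp t L) := by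
  unfold horOp
  refine Commute.list_prod_right _ _ fun x hx => ?_
  obtain ⟨j, _, rfl⟩ := List.mem_map.1 hx
  exact (bondOp_commute (pairOp_comm j i)).symm

theorem dotProduct_horOp (L : List (Fin h)) (f g : Wall h → ℝ) :
    f ⬝ᵥ horOp t L g = horOp t L f ⬝ᵥ g := by
  induction L generalizing f g with
  | nil => simp [horOp]
  | cons i L ih =>
    have c : Commute (bondOp t i) (horOp t L) := bondOp_commute (pairOp_horOp i L)
    have e : horOp t (i :: L) = bondOp t i * horOp t L := by simp [horOp]
    rw [e]
    nth_rewrite 2 [c.eq]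
    rw [Module.End.mul_apply, Module.End.mul_apply, dotProduct_bondOp, ih]

theorem dotProduct_horOp_ge (ht0 : 0 ≤ t) (ht1 : t ≤ 1) (L : List (Fin h)) (f : Wall h → ℝ) :
    (1 - t) ^ L.length * (f ⬝ᵥ f) ≤ f ⬝ᵥ horOp t L f := by
  induction L generalizing f with
  | nil => simp [horOp]
  | cons i L ih =>
    have e : horOp t (i :: L) = bondOp t i * horOp t L := by simp [horOp]
    have c := pairOp_horOp (t := t) i L
    have hnn : ∀ g : Wall h → ℝ, 0 ≤ g ⬝ᵥ horOp t L g := fun g =>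
      le_trans (mul_nonneg (pow_nonneg (by linarith) _)
        (Finset.sum_nonneg fun S _ => mul_self_nonneg _)) (ih g)
    have h1 := hnn (f + pairOp i f)
    have h2 : pairOp i f ⬝ᵥ horOp t L (pairOp i f) = f ⬝ᵥ horOp t L f := by
      rw [← dotProduct_pairOp, ← Module.End.mul_apply (pairOp i), c.eq,
        Module.End.mul_apply]
      congr 2
      funext S
      simp only [pairOp_apply]
      rw [flip_comm i.succ, flip_comm i.succ, flip_flip, flip_flip]
    have h3 : pairOp i f ⬝ᵥ horOp t L f = f ⬝ᵥ horOp t L (pairOp i f) := by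
      rw [← dotProduct_pairOp, ← Module.End.mul_apply, c.eq, Module.End.mul_apply]
    rw [map_add, dotProduct_add, add_dotProduct, add_dotProduct, h2, h3] at h1
    have h4 : f ⬝ᵥ horOp t (i :: L) f
        = f ⬝ᵥ horOp t L f + t * (f ⬝ᵥ horOp t L (pairOp i f)) := by
      rw [e, Module.End.mul_apply]
      unfold bondOp
      simp only [LinearMap.add_apply, LinearMap.smul_apply, Module.End.one_apply, dotProduct_add,
        dotProduct_smul, smul_eq_mul]
      rw [← Module.End.mul_apply, c.eq, Module.End.mul_apply]
    have h5 := ih f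
    rw [h4, List.length_cons, pow_succ]
    have h6 := mul_le_mul_of_nonneg_left h5 (sub_nonneg.2 ht1)
    nlinarith

/-- The symmetric transfer matrix. -/
noncomputable def trOp (h : ℕ) (s : ℝ) : Op h := verOp h s * horAll h (s ^ 2) * verOp h s

theorem dotProduct_trOp (f g : Wall h → ℝ) : f ⬝ᵥ trOp h s g = trOp h s f ⬝ᵥ g := by
  unfold trOp
  simp only [Module.End.mul_apply]
  rw [dotProduct_verOp]
  unfold horAll
  rw [dotProduct_horOp, dotProduct_verOp]

theorem dotProduct_trOp_pos (hs : 0 < s) (hs1 : s < 1) (f : Wall h → ℝ) (hf : f ≠ 0) :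
    0 < f ⬝ᵥ trOp h s f := by
  unfold trOp
  simp only [Module.End.mul_apply]
  rw [dotProduct_verOp]
  have hs2 : s ^ 2 < 1 := pow_lt_one₀ hs.le hs1 two_ne_zero
  refine lt_of_lt_of_le (mul_pos (pow_pos (sub_pos.2 hs2) _) ?_)
    (dotProduct_horOp_ge (sq_nonneg s) hs2.le _ _)
  obtain ⟨S, hS⟩ := Function.ne_iff.1 hf
  refine Finset.sum_pos' (fun S _ => mul_self_nonneg _) ⟨S, Finset.mem_univ S, ?_⟩
  have : verOp h s f S ≠ 0 := mul_ne_zero (pow_ne_zero _ hs.ne') hS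
  exact mul_self_pos.2 this

theorem horOp_ge (ht0 : 0 ≤ t) (L : List (Fin h)) {f : Wall h → ℝ} (hf : 0 ≤ f) :
    f ≤ horOp t L f := by
  induction L with
  | nil => simp [horOp]
  | cons i L ih =>
    have e : horOp t (i :: L) = bondOp t i * horOp t L := by simp [horOp]
    rw [e]
    intro S
    rw [Module.End.mul_apply, bondOp_apply]
    have h1 := ih S
    have h2 : 0 ≤ horOp t L f (flip i.succ (flip i.castSucc S)) := (hf.trans ih) (flip i.succ (flip i.castSucc S))
    have h3 := mul_nonneg ht0 h2
    linarith

theorem trOp_nonneg (hs : 0 < s) {f : Wall h → ℝ} (hf : 0 ≤ f) : 0 ≤ trOp h s f := by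
  have hv : ∀ g : Wall h → ℝ, 0 ≤ g → 0 ≤ verOp h s g := fun g hg S =>
    mul_nonneg (pow_nonneg hs.le _) (hg S)
  unfold trOp
  simp only [Module.End.mul_apply]
  exact hv _ ((hv _ hf).trans (horOp_ge (sq_nonneg s) _ (hv _ hf)))

/-- Functions with nonnegative Walsh coefficients. -/
def WalshPos (f : Wall h → ℝ) : Prop := ∀ T, 0 ≤ walsh T ⬝ᵥ f

theorem WalshPos.bondOp {f : Wall h → ℝ} (hf : WalshPos f) (ht0 : 0 ≤ t) (ht1 : t ≤ 1)
    (i : Fin h) : WalshPos (bondOp t i f) := by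
  intro T
  have hw : pairOp i (walsh T) = (fun S => (if i.succ ∈ T then -1 else 1)
      * ((if i.castSucc ∈ T then -1 else 1) * walsh T S)) := by
    funext S
    rw [pairOp_apply, walsh_flip, walsh_flip]
  rw [dotProduct_bondOp]
  have : PlusPath.bondOp t i (walsh T)
      = (1 + t * ((if i.succ ∈ T then -1 else 1) * (if i.castSucc ∈ T then -1 else 1)))
        • walsh T := by
    funext S
    rw [bondOp_apply, walsh_flip, walsh_flip]
    simp only [Pi.smul_apply, smul_eq_mul]
    ring
  rw [this, smul_dotProduct]
  refine smul_nonneg ?_ (hf T)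
  split_ifs <;> nlinarith

theorem WalshPos.verOp {f : Wall h → ℝ} (hf : WalshPos f) (hs0 : 0 ≤ s) (hs1 : s ≤ 1) :
    WalshPos (verOp h s f) := by
  have key : ∀ U : Finset (Fin (h + 1)),
      WalshPos fun S => (∏ i ∈ U, ((1 + s) / 2 + (1 - s) / 2 * sgn i S)) * f S := by
    intro U
    induction U using Finset.induction_on with
    | empty => simpa using hf
    | insert i U hi ih =>
      intro T
      have hT : ∃ T', ∀ S, walsh T S * sgn i S = walsh T' S := by
        by_cases hiT : i ∈ T
        · refine ⟨T.erase i, fun S => ?_⟩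
          unfold walsh
          rw [← Finset.mul_prod_erase _ _ hiT, mul_comm, ← mul_assoc, sgn_mul_self, one_mul]
        · refine ⟨insert i T, fun S => ?_⟩
          unfold walsh
          rw [Finset.prod_insert hiT, mul_comm]
      obtain ⟨T', hT'⟩ := hT
      have h1 := mul_nonneg (show (0 : ℝ) ≤ (1 + s) / 2 by linarith) (ih T)
      have h2 := mul_nonneg (show (0 : ℝ) ≤ (1 - s) / 2 by linarith) (ih T')
      refine (add_nonneg h1 h2).trans (le_of_eq ?_)
      unfold dotProduct
      rw [Finset.mul_sum, Finset.mul_sum, ← Finset.sum_add_distrib]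
      refine Finset.sum_congr rfl fun S _ => ?_
      simp only [Finset.prod_insert hi, ← hT']
      ring
  convert key Finset.univ using 2 with S
  rw [verOp_apply]
  congr 1
  unfold walls
  rw [← Finset.prod_pow_eq_pow_sum]
  refine Finset.prod_congr rfl fun i _ => ?_
  unfold sgn
  split_ifs <;> ring

theorem WalshPos.trOp {f : Wall h → ℝ} (hf : WalshPos f) (hs0 : 0 ≤ s) (hs1 : s ≤ 1) :
    WalshPos (trOp h s f) := by
  have hB : ∀ (L : List (Fin h)) (g : Wall h → ℝ), WalshPos g → WalshPos (horOp (s ^ 2) L g) := by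
    intro L g hg
    induction L with
    | nil => simpa [horOp] using hg
    | cons i L ih =>
      have e : horOp (s ^ 2) (i :: L) = PlusPath.bondOp (s ^ 2) i * horOp (s ^ 2) L := by
        simp [horOp]
      rw [e]
      exact ih.bondOp (sq_nonneg s) (pow_le_one₀ hs0 hs1) i
  exact (hB _ _ (hf.verOp hs0 hs1)).verOp hs0 hs1

/-- Quadratic form estimate behind the spectral gap. -/
theorem gap_of_mode_equations {t q μ : ℝ} (ht : 0 < t) (hq : 0 < q) (hq1 : q ≤ 1)
    (hμ1 : μ * t < q) (hμ2 : t < μ * q) {C S : ℝ} (hC : C - S = q) (hC' : C + S = q⁻¹)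
    (hS : 0 ≤ S) {a b a' b' : Fin (h + 1) → ℝ}
    (h1 : a 0 = μ * a' 0) (h2 : ∀ i : Fin h, C * a i.succ - S * b i.castSucc = μ * a' i.succ)
    (h3 : ∀ i : Fin h, C * b i.castSucc - S * a i.succ = μ * b' i.castSucc)
    (h4 : b (Fin.last h) = μ * b' (Fin.last h))
    (h5 : ∀ i, a i + b i = t⁻¹ * (a' i + b' i)) (h6 : ∀ i, a i - b i = t * (a' i - b' i)) :
    a = 0 := by
  obtain ⟨x, hx⟩ : ∃ x : Fin (h + 1) → ℝ, ∀ i, x i = (a i + b i) / 2 := ⟨_, fun _ => rfl⟩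
  obtain ⟨y, hy⟩ : ∃ y : Fin (h + 1) → ℝ, ∀ i, y i = (a i - b i) / 2 := ⟨_, fun _ => rfl⟩
  have ha : ∀ i, a i = x i + y i := fun i => by rw [hx, hy]; ring
  have hb : ∀ i, b i = x i - y i := fun i => by rw [hx, hy]; ring
  have hxy : ∀ i, a' i * b i + b' i * a i = 2 * (t * x i ^ 2 - t⁻¹ * y i ^ 2) := by
    intro i
    have e1 : a' i + b' i = 2 * t * x i := by
      rw [hx, h5]; field_simp
    have e2 : a' i - b' i = 2 * t⁻¹ * y i := by
      rw [hy, h6]; field_simp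
    rw [ha, hb, show a' i = t * x i + t⁻¹ * y i by linarith,
      show b' i = t * x i - t⁻¹ * y i by linarith]
    ring
  have hsum : ∀ f : Fin (h + 1) → ℝ,
      f 0 + f (Fin.last h) + ∑ i : Fin h, (f i.castSucc + f i.succ) = 2 * ∑ i, f i := by
    intro f
    rw [Finset.sum_add_distrib, two_mul]
    nth_rewrite 1 [Fin.sum_univ_castSucc f]
    rw [Fin.sum_univ_succ f]
    ring
  have htot : ∑ i, (a' i * b i + b' i * a i)
      = a' 0 * b 0 + ∑ i : Fin h, a' i.succ * b i.succ
        + (∑ i : Fin h, b' i.castSucc * a i.castSucc + b' (Fin.last h) * a (Fin.last h)) := by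
    rw [Finset.sum_add_distrib, Fin.sum_univ_succ, Fin.sum_univ_castSucc (fun i => b' i * a i)]
  have hLHS : μ * ∑ i, (a' i * b i + b' i * a i)
      = x 0 ^ 2 - y 0 ^ 2 + (x (Fin.last h) ^ 2 - y (Fin.last h) ^ 2)
        + ∑ i : Fin h, (C * (x i.castSucc ^ 2 + x i.succ ^ 2) - 2 * S * (x i.castSucc * x i.succ)
          - (C * (y i.castSucc ^ 2 + y i.succ ^ 2) + 2 * S * (y i.castSucc * y i.succ))) := by
    rw [htot, mul_add, mul_add, mul_add, Finset.mul_sum, Finset.mul_sum, ← mul_assoc, ← mul_assoc,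
      ← h1, ← h4]
    have : ∀ i : Fin h, μ * (a' i.succ * b i.succ) + μ * (b' i.castSucc * a i.castSucc)
        = C * (x i.castSucc ^ 2 + x i.succ ^ 2) - 2 * S * (x i.castSucc * x i.succ)
          - (C * (y i.castSucc ^ 2 + y i.succ ^ 2) + 2 * S * (y i.castSucc * y i.succ)) := by
      intro i
      rw [← mul_assoc, ← mul_assoc, ← h2, ← h3]
      simp only [ha, hb]
      ring
    rw [← Finset.sum_congr rfl fun i _ => this i, Finset.sum_add_distrib]
    simp only [ha, hb]
    ring
  have hq1' : 1 ≤ q⁻¹ := (one_le_inv₀ hq).2 hq1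
  have hlow : q * (x 0 ^ 2 + x (Fin.last h) ^ 2 + ∑ i : Fin h, (x i.castSucc ^ 2 + x i.succ ^ 2))
      - q⁻¹ * (y 0 ^ 2 + y (Fin.last h) ^ 2 + ∑ i : Fin h, (y i.castSucc ^ 2 + y i.succ ^ 2))
      ≤ μ * ∑ i, (a' i * b i + b' i * a i) := by
    rw [hLHS, mul_add, mul_add, mul_add, mul_add, Finset.mul_sum, Finset.mul_sum]
    have : ∑ i : Fin h, q * (x i.castSucc ^ 2 + x i.succ ^ 2)
        - ∑ i : Fin h, q⁻¹ * (y i.castSucc ^ 2 + y i.succ ^ 2) ≤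
        ∑ i : Fin h, (C * (x i.castSucc ^ 2 + x i.succ ^ 2) - 2 * S * (x i.castSucc * x i.succ)
          - (C * (y i.castSucc ^ 2 + y i.succ ^ 2) + 2 * S * (y i.castSucc * y i.succ))) := by
      rw [← Finset.sum_sub_distrib]
      refine Finset.sum_le_sum fun i _ => ?_
      rw [← hC', ← hC]
      nlinarith [mul_nonneg hS (sq_nonneg (x i.castSucc - x i.succ)),
        mul_nonneg hS (sq_nonneg (y i.castSucc - y i.succ))]
    nlinarith [mul_nonneg (sub_nonneg.2 hq1) (sq_nonneg (x 0)),
      mul_nonneg (sub_nonneg.2 hq1) (sq_nonneg (x (Fin.last h))),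
      mul_nonneg (sub_nonneg.2 hq1') (sq_nonneg (y 0)),
      mul_nonneg (sub_nonneg.2 hq1') (sq_nonneg (y (Fin.last h)))]
  rw [hsum fun i => x i ^ 2, hsum fun i => y i ^ 2, Finset.sum_congr rfl fun i _ => hxy i,
    ← Finset.mul_sum, Finset.sum_sub_distrib, ← Finset.mul_sum, ← Finset.mul_sum] at hlow
  have hX : 0 ≤ ∑ i, x i ^ 2 := Finset.sum_nonneg fun i _ => sq_nonneg _
  have hY : 0 ≤ ∑ i, y i ^ 2 := Finset.sum_nonneg fun i _ => sq_nonneg _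
  have hc : q⁻¹ < μ * t⁻¹ := by
    rw [inv_eq_one_div, ← div_eq_mul_inv, div_lt_div_iff₀ hq ht]; linarith
  have hX0 : ∑ i, x i ^ 2 = 0 := by
    nlinarith [mul_nonneg (sub_pos.2 hμ1).le hX, mul_nonneg (sub_pos.2 hc).le hY,
      mul_pos (sub_pos.2 hμ1) ht]
  have hY0 : ∑ i, y i ^ 2 = 0 := by
    nlinarith [mul_nonneg (sub_pos.2 hμ1).le hX, mul_nonneg (sub_pos.2 hc).le hY]
  rw [Finset.sum_eq_zero_iff_of_nonneg fun i _ => sq_nonneg _] at hX0 hY0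
  funext i
  have e1 := pow_eq_zero_iff two_ne_zero |>.1 (hX0 i (Finset.mem_univ i))
  have e2 := pow_eq_zero_iff two_ne_zero |>.1 (hY0 i (Finset.mem_univ i))
  rw [ha, e1, e2, add_zero, Pi.zero_apply]

theorem trOp_eigen (hs : 0 < s) {l : ℝ} {φ : Wall h → ℝ} (hφ : trOp h s φ = l • φ) :
    horAll h (s ^ 2) (verOp h s φ) = l • verOp h s⁻¹ φ := by
  funext S
  have := congrFun hφ S
  unfold trOp at this
  simp only [Module.End.mul_apply, verOp_apply, Pi.smul_apply, smul_eq_mul] at this ⊢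
  have h0 : s ^ walls S ≠ 0 := pow_ne_zero _ hs.ne'
  rw [inv_pow]
  field_simp
  linarith

theorem verOp_verOp_inv (hs : 0 < s) (φ : Wall h → ℝ) : verOp h s (verOp h s⁻¹ φ) = φ := by
  funext S
  simp only [verOp_apply]
  rw [← mul_assoc, ← mul_pow, mul_inv_cancel₀ hs.ne', one_pow, one_mul]

theorem mode_horizontal (hs : 0 < s) {l l' : ℝ} {φ ψ : Wall h → ℝ} (hφ : trOp h s φ = l • φ)
    (hψ : trOp h s ψ = l' • ψ) {Γ Γ' : Op h}
    (hΓ : horAll h (s ^ 2) * Γ = Γ' * horAll h (s ^ 2)) :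
    l' * (verOp h s φ ⬝ᵥ Γ' (verOp h s⁻¹ ψ)) = l * (verOp h s⁻¹ φ ⬝ᵥ Γ (verOp h s ψ)) := by
  have e1 : verOp h s φ ⬝ᵥ horAll h (s ^ 2) (Γ (verOp h s ψ))
      = l * (verOp h s⁻¹ φ ⬝ᵥ Γ (verOp h s ψ)) := by
    have := trOp_eigen hs hφ
    unfold horAll at this ⊢
    rw [dotProduct_horOp, this, smul_dotProduct, smul_eq_mul]
  have e2 : verOp h s φ ⬝ᵥ horAll h (s ^ 2) (Γ (verOp h s ψ))
      = l' * (verOp h s φ ⬝ᵥ Γ' (verOp h s⁻¹ ψ)) := by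
    rw [← Module.End.mul_apply, hΓ, Module.End.mul_apply, trOp_eigen hs hψ, map_smul,
      dotProduct_smul, smul_eq_mul]
  rw [← e1, e2]

theorem mode_vertical (hs : 0 < s) (φ ψ : Wall h → ℝ) {Γ₀ Γ₁ Γ₂ : Op h}
    (h1 : verOp h s * Γ₀ = Γ₁ * verOp h s) (h2 : verOp h s * Γ₁ = Γ₂ * verOp h s) :
    verOp h s φ ⬝ᵥ Γ₀ (verOp h s⁻¹ ψ) = verOp h s⁻¹ φ ⬝ᵥ Γ₂ (verOp h s ψ) := by
  rw [← Module.End.mul_apply Γ₂, ← h2, Module.End.mul_apply, dotProduct_verOp,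
    verOp_verOp_inv hs, ← dotProduct_verOp, ← Module.End.mul_apply, h1, Module.End.mul_apply,
    verOp_verOp_inv hs]

theorem gap_bound (hs : 0 < s) (ht : s ^ 2 < 1) {l l' : ℝ} (hl' : 0 < l')
    (hll : l ≤ l') (hq : s ^ 2 < (1 - s ^ 2) / (1 + s ^ 2))
    {φ ψ : Wall h → ℝ} (hφ : trOp h s φ = l • φ)
    (hψ : trOp h s ψ = l' • ψ)
    (hκ : verOp h s φ ⬝ᵥ fermE 0 (verOp h s⁻¹ ψ) ≠ 0) :
    l / l' ≤ s ^ 2 / ((1 - s ^ 2) / (1 + s ^ 2)) := by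
  by_contra hcon
  push Not at hcon
  obtain ⟨t, htt⟩ : ∃ t, t = s ^ 2 := ⟨_, rfl⟩
  have ht0 : 0 < t := htt ▸ pow_pos hs 2
  rw [← htt] at ht hq hcon
  have htne : t ^ 2 ≠ 1 := by nlinarith
  have hq0 : 0 < (1 - t) / (1 + t) := div_pos (by linarith) (by linarith)
  have hμ : l / l' ≤ 1 := (div_le_one hl').2 hll
  have ne1 : (1 - t : ℝ) ≠ 0 := by linarith
  have ne2 : (1 + t : ℝ) ≠ 0 := by linarith
  have ne3 : (1 - t ^ 2 : ℝ) ≠ 0 := sub_ne_zero.2 htne.symm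
  have key : ∀ A B : ℝ, l' * A = l * B → A = l / l' * B := fun A B hAB => by
    rw [div_mul_eq_mul_div, eq_div_iff hl'.ne', ← hAB, mul_comm]
  refine hκ (congrFun (gap_of_mode_equations (h := h) (t := t) (q := (1 - t) / (1 + t))
    (μ := l / l') (C := (1 + t ^ 2) / (1 - t ^ 2)) (S := 2 * t / (1 - t ^ 2))
    (a := fun i => verOp h s φ ⬝ᵥ fermE i (verOp h s⁻¹ ψ))
    (b := fun i => verOp h s φ ⬝ᵥ fermO i (verOp h s⁻¹ ψ))
    (a' := fun i => verOp h s⁻¹ φ ⬝ᵥ fermE i (verOp h s ψ))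
    (b' := fun i => verOp h s⁻¹ φ ⬝ᵥ fermO i (verOp h s ψ))
    ht0 hq0 ?_ ?_ ?_ ?_ ?_ ?_ ?_ ?_ ?_ ?_ ?_ ?_) 0)
  · rw [div_le_one (by linarith)]; linarith
  · nlinarith
  · rwa [div_lt_iff₀ hq0] at hcon
  · field_simp; ring
  · field_simp; ring
  · exact div_nonneg (by linarith) (by nlinarith)
  · have := mode_horizontal hs hφ hψ (horAll_fermE_zero (t := s ^ 2))
    exact key _ _ this
  · intro i
    have := mode_horizontal hs hφ hψ (horAll_fermE (htt ▸ htne) i)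
    simp only [LinearMap.sub_apply, LinearMap.smul_apply, dotProduct_sub, dotProduct_smul,
      smul_eq_mul, ← htt] at this
    exact key _ _ this
  · intro i
    have := mode_horizontal hs hφ hψ (horAll_fermO (htt ▸ htne) i)
    simp only [LinearMap.sub_apply, LinearMap.smul_apply, dotProduct_sub, dotProduct_smul,
      smul_eq_mul, ← htt] at this
    exact key _ _ this
  · have := mode_horizontal hs hφ hψ (horAll_fermO_last (t := s ^ 2))
    exact key _ _ this
  · intro i
    have c1 : verOp h s * (fermE i + fermO i) = (s⁻¹ • (fermE i + fermO i)) * verOp h s := by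
      rw [mul_add, verOp_fermE hs, verOp_fermO hs, ← add_mul]
      congr 1
      module
    have c2 : verOp h s * (s⁻¹ • (fermE i + fermO i))
        = (t⁻¹ • (fermE i + fermO i)) * verOp h s := by
      rw [mul_smul_comm, c1, smul_mul_assoc, smul_mul_assoc, smul_smul, htt]
      congr 1
      field_simp
    have := mode_vertical hs φ ψ c1 c2
    simpa only [LinearMap.add_apply, LinearMap.smul_apply, dotProduct_add, dotProduct_smul,
      smul_eq_mul] using this
  · intro i
    have c1 : verOp h s * (fermE i - fermO i) = (s • (fermE i - fermO i)) * verOp h s := by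
      rw [mul_sub, verOp_fermE hs, verOp_fermO hs, ← sub_mul]
      congr 1
      module
    have c2 : verOp h s * (s • (fermE i - fermO i))
        = (t • (fermE i - fermO i)) * verOp h s := by
      rw [mul_smul_comm, c1, smul_mul_assoc, smul_mul_assoc, smul_smul, htt]
      congr 1
      ring
    have := mode_vertical hs φ ψ c1 c2
    simpa only [LinearMap.sub_apply, LinearMap.smul_apply, dotProduct_sub, dotProduct_smul,
      smul_eq_mul] using this

/-- The wall configuration of an all-plus column. -/
def noWall (h : ℕ) : Wall h := fun _ => false

/-- The wall configuration of a column with a minus spin at the bottom and plus spins above. -/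
def botWall (h : ℕ) : Wall h := flip 0 (noWall h)

noncomputable def delta (S : Wall h) : Wall h → ℝ := Pi.single S 1

theorem delta_dotProduct (S : Wall h) (f : Wall h → ℝ) : delta S ⬝ᵥ f = f S := by
  unfold delta
  rw [single_dotProduct, one_mul]

theorem delta_nonneg (S : Wall h) : 0 ≤ delta S := Pi.single_nonneg.2 zero_le_one

theorem delta_ne_zero (S : Wall h) : delta S ≠ 0 := fun hc => by
  have := congrFun hc S
  simp [delta] at this

theorem pow_trOp_nonneg (hs : 0 < s) {f : Wall h → ℝ} (hf : 0 ≤ f) (n : ℕ) :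
    0 ≤ (trOp h s ^ n) f := by
  induction n with
  | zero => simpa using hf
  | succ n ih =>
    rw [pow_succ', Module.End.mul_apply]
    exact trOp_nonneg hs ih

theorem sum_pow_trOp_le (hs : 0 ≤ s) (hs1 : s ≤ 1) (n : ℕ) :
    ∑ S, (trOp h s ^ n) (delta (botWall h)) S ≤ ∑ S, (trOp h s ^ n) (delta (noWall h)) S := by
  have h0 : WalshPos (delta (noWall h) - delta (botWall h)) := by
    intro T
    rw [dotProduct_sub, dotProduct_comm, delta_dotProduct, dotProduct_comm, delta_dotProduct,
      botWall, walsh_flip]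
    have : walsh T (noWall h) = 1 := by
      unfold walsh
      exact Finset.prod_eq_one fun i _ => by simp [sgn, noWall]
    rw [this]
    split_ifs <;> norm_num
  have h1 : WalshPos ((trOp h s ^ n) (delta (noWall h) - delta (botWall h))) := by
    induction n with
    | zero => simpa using h0
    | succ n ih =>
      rw [pow_succ', Module.End.mul_apply]
      exact ih.trOp hs hs1
  have h2 := h1 ∅
  rw [map_sub, dotProduct_sub, sub_nonneg] at h2
  simpa [dotProduct, walsh] using h2

/-- Transfer across a column boundary at which the bottom spin changes sign. -/
noncomputable def jumpOp (h : ℕ) (s : ℝ) : Op h :=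
  verOp h s * horAll h (s ^ 2) * flipOp 0 * verOp h s

/-- Partition function with `p` columns whose bottom spin is minus, then `q` with plus. -/
noncomputable def stepZ (h : ℕ) (s : ℝ) (p q : ℕ) : ℝ :=
  (trOp h s ^ p) (delta (botWall h)) ⬝ᵥ jumpOp h s ((trOp h s ^ q) (delta (noWall h)))

theorem fermE_zero : (fermE 0 : Op h) = flipOp 0 := by
  refine LinearMap.ext fun f => funext fun S => ?_
  simp [walsh]

theorem exists_stepZ_ratio (hs : 0 < s) (ht : s ^ 2 < 1) (hq : s ^ 2 < (1 - s ^ 2) / (1 + s ^ 2)) :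
    ∃ ρ : ℝ, 0 < ρ ∧ ρ ≤ s ^ 2 / ((1 - s ^ 2) / (1 + s ^ 2)) ∧
      ∀ n, Tendsto (fun a => stepZ h s (a + n) a / stepZ h s a (a + n)) atTop (𝓝 (ρ ^ n)) := by
  have hs1 : s < 1 := by nlinarith
  obtain ⟨l, hl, φ, hφ, hφ0, hlim⟩ := power_iteration (trOp h s) dotProduct_trOp
    (dotProduct_trOp_pos hs hs1) (delta_ne_zero (botWall h))
  obtain ⟨l', hl', ψ, hψ, hψ0, hlim'⟩ := power_iteration (trOp h s) dotProduct_trOp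
    (dotProduct_trOp_pos hs hs1) (delta_ne_zero (noWall h))
  rw [delta_dotProduct] at hφ0 hψ0
  have hφn : 0 ≤ φ := ge_of_tendsto' hlim fun n =>
    smul_nonneg (inv_nonneg.2 (pow_nonneg hl.le _)) (pow_trOp_nonneg hs (delta_nonneg _) n)
  have hψn : 0 ≤ ψ := ge_of_tendsto' hlim' fun n =>
    smul_nonneg (inv_nonneg.2 (pow_nonneg hl'.le _)) (pow_trOp_nonneg hs (delta_nonneg _) n)
  have hll : l ≤ l' := by
    by_contra hcon
    push Not at hcon
    have c : ∀ φ : Wall h → ℝ, 0 ≤ φ → ∀ S, 0 < φ S → 0 < ∑ S, φ S := fun φ hφ S hS =>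
      Finset.sum_pos' (fun S _ => hφ S) ⟨S, Finset.mem_univ S, hS⟩
    have t1 : Tendsto (fun n : ℕ => (l ^ n)⁻¹ * ∑ S, (trOp h s ^ n) (delta (botWall h)) S)
        atTop (𝓝 (∑ S, φ S)) := by
      have := tendsto_finsetSum Finset.univ fun S _ => (tendsto_pi_nhds.1 hlim) S
      simpa [Finset.mul_sum] using this
    have t2 : Tendsto (fun n : ℕ => (l' ^ n)⁻¹ * ∑ S, (trOp h s ^ n) (delta (noWall h)) S)
        atTop (𝓝 (∑ S, ψ S)) := by
      have := tendsto_finsetSum Finset.univ fun S _ => (tendsto_pi_nhds.1 hlim') S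
      simpa [Finset.mul_sum] using this
    have t3 := (tendsto_pow_atTop_nhds_zero_of_lt_one (div_nonneg hl'.le hl.le)
      ((div_lt_one hl).2 hcon)).mul t2
    rw [zero_mul] at t3
    refine absurd (le_of_tendsto_of_tendsto' t1 t3 fun n => ?_) (not_le.2 (c φ hφn _ hφ0))
    rw [div_pow, ← mul_assoc, div_mul_eq_mul_div, mul_inv_cancel₀ (pow_pos hl' n).ne', one_div]
    exact mul_le_mul_of_nonneg_left (sum_pow_trOp_le hs.le hs1.le n)
      (inv_nonneg.2 (pow_nonneg hl.le _))
  have hv : ∀ g : Wall h → ℝ, 0 ≤ g → 0 ≤ verOp h s g := fun g hg S =>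
    mul_nonneg (pow_nonneg hs.le _) (hg S)
  have hκ : 0 < φ ⬝ᵥ jumpOp h s ψ := by
    unfold jumpOp
    simp only [Module.End.mul_apply]
    rw [dotProduct_verOp]
    have hn : 0 ≤ flipOp 0 (verOp h s ψ) := fun S => hv ψ hψn (flip 0 S)
    have hge := horOp_ge (sq_nonneg s) (List.finRange h) hn
    refine lt_of_lt_of_le ?_ (dotProduct_le_dotProduct_of_nonneg_left hge (hv _ hφn))
    refine Finset.sum_pos' (fun S _ => mul_nonneg (hv _ hφn S) (hn S))
      ⟨botWall h, Finset.mem_univ _, mul_pos (mul_pos (pow_pos hs _) hφ0) ?_⟩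
    rw [flipOp_apply, botWall, flip_flip]
    exact mul_pos (pow_pos hs _) hψ0
  have hlimit : Tendsto (fun p : ℕ × ℕ => (l ^ p.1)⁻¹ * (l' ^ p.2)⁻¹ * stepZ h s p.1 p.2)
      (atTop ×ˢ atTop) (𝓝 (φ ⬝ᵥ jumpOp h s ψ)) := by
    have c : Continuous fun x : (Wall h → ℝ) × (Wall h → ℝ) => x.1 ⬝ᵥ jumpOp h s x.2 :=
      continuous_fst.dotProduct
        ((LinearMap.continuous_of_finiteDimensional (jumpOp h s)).comp continuous_snd)
    have := (c.tendsto (φ, ψ)).comp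
      ((hlim.comp tendsto_fst).prodMk_nhds (hlim'.comp (tendsto_snd (f := (atTop : Filter ℕ)))))
    refine this.congr fun p => ?_
    simp only [Function.comp, map_smul, smul_dotProduct, dotProduct_smul, smul_eq_mul, stepZ]
    ring
  refine ⟨l / l', div_pos hl hl', gap_bound hs ht hl' hll hq hφ hψ ?_, fun n => ?_⟩
  · have e := mode_horizontal hs hφ hψ (horAll_fermE_zero (h := h) (t := s ^ 2))
    have e2 : φ ⬝ᵥ jumpOp h s ψ
        = l' * (verOp h s φ ⬝ᵥ fermE 0 (verOp h s⁻¹ ψ)) := by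
      unfold jumpOp
      rw [← fermE_zero, mul_assoc (verOp h s), horAll_fermE_zero]
      simp only [Module.End.mul_apply]
      rw [dotProduct_verOp, trOp_eigen hs hψ, map_smul, dotProduct_smul, smul_eq_mul]
    intro h0
    rw [e2, h0, mul_zero] at hκ
    exact lt_irrefl _ hκ
  · have hn : Tendsto (fun a : ℕ => a + n) atTop atTop := 
      tendsto_atTop_mono (fun a => Nat.le_add_right a n) tendsto_id
    have t1 := hlimit.comp (hn.prodMk tendsto_id)
    have t2 := hlimit.comp (tendsto_id.prodMk hn)
    have t3 := (t1.div t2 hκ.ne').const_mul ((l / l') ^ n)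
    rw [div_self hκ.ne', mul_one] at t3
    refine t3.congr fun a => ?_
    have h1 := (pow_pos hl a).ne'
    have h2 := (pow_pos hl' a).ne'
    have h3 := (pow_pos hl n).ne'
    have h4 := (pow_pos hl' n).ne'
    simp only [Pi.div_apply, Function.comp, id, pow_add, div_pow]
    by_cases h5 : stepZ h s a (a + n) = 0
    · simp [h5]
    · field_simp

end Gap

section Columns

open Matrix

variable {h : ℕ} {s t : ℝ}

theorem sum_powerset_union {V : Type*} [DecidableEq V] {F G : Finset V} (hd : Disjoint F G)
    (g : Finset V → ℝ) :
    ∑ f ∈ (F ∪ G).powerset, g f = ∑ f ∈ F.powerset, ∑ c ∈ G.powerset, g (f ∪ c) := by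
  rw [← Finset.sum_product']
  refine (Finset.sum_bij' (fun p _ => p.1 ∪ p.2) (fun f _ => (f ∩ F, f ∩ G)) ?_ ?_ ?_ ?_ ?_).symm
  · intro p hp
    rw [Finset.mem_product, Finset.mem_powerset, Finset.mem_powerset] at hp
    exact Finset.mem_powerset.2 (Finset.union_subset_union hp.1 hp.2)
  · intro f _
    simp
  · intro p hp
    rw [Finset.mem_product, Finset.mem_powerset, Finset.mem_powerset] at hp
    have h1 : p.2 ∩ F = ∅ := Finset.disjoint_iff_inter_eq_empty.1
      (hd.symm.mono_left hp.2)
    have h2 : p.1 ∩ G = ∅ := Finset.disjoint_iff_inter_eq_empty.1 (hd.mono_left hp.1)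
    ext1
    · simp only [Finset.union_inter_distrib_right, h1, Finset.union_empty]
      exact Finset.inter_eq_left.2 hp.1
    · simp only [Finset.union_inter_distrib_right, h2, Finset.empty_union]
      exact Finset.inter_eq_left.2 hp.2
  · intro f hf
    rw [← Finset.inter_union_distrib_left]
    exact Finset.inter_eq_left.2 (Finset.mem_powerset.1 hf)
  · intro p _
    rfl

open Classical in
/-- Domain walls of a column whose set of minus rows is `P`. -/
noncomputable def wallOf (h : ℕ) (P : Set ℤ) : Wall h :=
  fun j => decide (¬ (((j : ℕ) : ℤ) ∈ P ↔ ((j : ℕ) : ℤ) + 1 ∈ P))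

theorem wallOf_eq_true (P : Set ℤ) (j : Fin (h + 1)) :
    wallOf h P j = true ↔ ¬ (((j : ℕ) : ℤ) ∈ P ↔ ((j : ℕ) : ℤ) + 1 ∈ P) := by
  simp [wallOf]

theorem flip_eq_true (i j : Fin (h + 1)) (S : Wall h) :
    flip i S j = true ↔ (if j = i then ¬ S j = true else S j = true) := by
  unfold flip
  by_cases hj : j = i
  · subst hj; simp
  · simp [hj]

theorem wallOf_symmDiff (i : Fin h) (P : Set ℤ) :
    flip i.succ (flip i.castSucc (wallOf h P)) = wallOf h (symmDiff P {((i : ℕ) : ℤ) + 1}) := by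
  funext j
  rw [Bool.eq_iff_iff, flip_eq_true, flip_eq_true, wallOf_eq_true, wallOf_eq_true,
    Set.mem_symmDiff, Set.mem_symmDiff, Set.mem_singleton_iff, Set.mem_singleton_iff]
  have e1 : j = i.succ ↔ ((j : ℕ) : ℤ) = (i : ℕ) + 1 := by
    rw [Fin.ext_iff]; simp; omega
  have e2 : j = i.castSucc ↔ ((j : ℕ) : ℤ) + 1 = (i : ℕ) + 1 := by
    rw [Fin.ext_iff]; simp
  simp only [e1, e2]
  have e3 : ¬ (((j : ℕ) : ℤ) = (i : ℕ) + 1 ∧ ((j : ℕ) : ℤ) + 1 = (i : ℕ) + 1) := by omega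
  split_ifs <;> tauto

theorem wallOf_flip_zero (P : Set ℤ) :
    flip 0 (wallOf h P) = wallOf h (symmDiff P {0}) := by
  funext j
  rw [Bool.eq_iff_iff, flip_eq_true, wallOf_eq_true, wallOf_eq_true,
    Set.mem_symmDiff, Set.mem_symmDiff, Set.mem_singleton_iff, Set.mem_singleton_iff]
  have e1 : j = 0 ↔ ((j : ℕ) : ℤ) = 0 := by
    rw [Fin.ext_iff]; simp
  have e3 : ¬ ((j : ℕ) : ℤ) + 1 = 0 := by omega
  simp only [e1]
  split_ifs <;> tauto

theorem horOp_wallOf (L : List (Fin h)) (hL : L.Nodup) (f : Wall h → ℝ) (P : Set ℤ) :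
    horOp t L f (wallOf h P)
      = ∑ c ∈ ((L.map fun i : Fin h => ((i : ℕ) : ℤ) + 1).toFinset).powerset,
        t ^ c.card * f (wallOf h (symmDiff P ↑c)) := by
  induction L generalizing P with
  | nil =>
    have : symmDiff P ∅ = P := symmDiff_bot P
    simp [horOp, this]
  | cons i L ih =>
    have e : horOp t (i :: L) = bondOp t i * horOp t L := by simp [horOp]
    rw [List.nodup_cons] at hL
    have hi : ((i : ℕ) : ℤ) + 1 ∉ (L.map fun i : Fin h => ((i : ℕ) : ℤ) + 1).toFinset := by
      rw [List.mem_toFinset, List.mem_map]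
      rintro ⟨j, hj, hji⟩
      exact hL.1 ((Fin.ext (by omega) : j = i) ▸ hj)
    rw [e, Module.End.mul_apply, bondOp_apply, wallOf_symmDiff, ih hL.2, ih hL.2, List.map_cons,
      List.toFinset_cons, Finset.sum_powerset_insert hi, Finset.mul_sum]
    congr 1
    refine Finset.sum_congr rfl fun c hc => ?_
    have hic : ((i : ℕ) : ℤ) + 1 ∉ c := fun hcon => hi (Finset.mem_powerset.1 hc hcon)
    rw [Finset.card_insert_of_notMem hic, pow_succ, symmDiff_assoc]
    have : symmDiff {((i : ℕ) : ℤ) + 1} (c : Set ℤ) = ↑(insert (((i : ℕ) : ℤ) + 1) c) := by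
      ext x
      simp only [Set.mem_symmDiff, Set.mem_singleton_iff, Finset.mem_coe, Finset.coe_insert,
        Set.mem_insert_iff]
      by_cases hx : x = ((i : ℕ) : ℤ) + 1
      · subst hx; simp [hic]
      · simp [hx]
    rw [this]
    ring

theorem horAll_wallOf (f : Wall h → ℝ) (P : Set ℤ) :
    horAll h t f (wallOf h P)
      = ∑ c ∈ (Finset.Icc (1 : ℤ) h).powerset, t ^ c.card * f (wallOf h (symmDiff P ↑c)) := by
  unfold horAll
  rw [horOp_wallOf _ (List.nodup_finRange h)]
  congr 2
  ext x
  simp only [List.mem_toFinset, List.mem_map, List.mem_finRange, true_and, Finset.mem_Icc]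
  constructor
  · rintro ⟨i, rfl⟩
    have := i.2
    omega
  · rintro ⟨h1, h2⟩
    exact ⟨⟨(x - 1).toNat, by omega⟩, by simp; omega⟩

/-- Sum over the configurations of a column, weighted by disagreement with the next one. -/
theorem horAll_wallOf_column (f : Wall h → ℝ) {A : Set ℤ} (hA : ∀ j ∈ A, j < 1)
    {c' : Finset ℤ} (hc' : c' ⊆ Finset.Icc (1 : ℤ) h) :
    horAll h t f (wallOf h (A ∪ ↑c'))
      = ∑ c ∈ (Finset.Icc (1 : ℤ) h).powerset,
        t ^ (symmDiff c c').card * f (wallOf h (A ∪ ↑c)) := by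
  rw [horAll_wallOf]
  have hsub : ∀ c ⊆ Finset.Icc (1 : ℤ) h, symmDiff c c' ⊆ Finset.Icc (1 : ℤ) h := by
    intro c hc x hx
    rw [Finset.mem_symmDiff] at hx
    exact hx.elim (fun hx => hc hx.1) fun hx => hc' hx.1
  refine Finset.sum_bij' (fun c _ => symmDiff c c') (fun c _ => symmDiff c c')
    (fun c hc => Finset.mem_powerset.2 (hsub c (Finset.mem_powerset.1 hc)))
    (fun c hc => Finset.mem_powerset.2 (hsub c (Finset.mem_powerset.1 hc)))
    (fun c _ => symmDiff_symmDiff_cancel_right _ _) (fun c _ => symmDiff_symmDiff_cancel_right _ _) ?_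
  intro c hc
  rw [symmDiff_symmDiff_cancel_right]
  congr 3
  ext x
  have h1 : x ∈ A → x ∉ c ∧ x ∉ c' := fun hx => by
    have := hA x hx
    exact ⟨fun hxc => by have := Finset.mem_Icc.1 (Finset.mem_powerset.1 hc hxc); omega,
      fun hxc => by have := Finset.mem_Icc.1 (hc' hxc); omega⟩
  simp only [Set.mem_symmDiff, Set.mem_union, Finset.mem_coe, Finset.mem_symmDiff]
  tauto

theorem wallOf_injective {P Q : Set ℤ} (hPQ : wallOf h P = wallOf h Q) (hP : (h : ℤ) + 1 ∉ P)
    (hQ : (h : ℤ) + 1 ∉ Q) (j : ℕ) (hj : j ≤ h) : ((j : ℤ) ∈ P ↔ (j : ℤ) ∈ Q) := by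
  have key : ∀ k : ℕ, k ≤ h + 1 → (((h + 1 - k : ℕ) : ℤ) ∈ P ↔ ((h + 1 - k : ℕ) : ℤ) ∈ Q) := by
    intro k
    induction k with
    | zero => intro _; simp [hP, hQ]
    | succ k ih =>
      intro hk
      have := congrFun hPQ ⟨h + 1 - (k + 1), by omega⟩
      have e : ((h + 1 - (k + 1) : ℕ) : ℤ) + 1 = ((h + 1 - k : ℕ) : ℤ) := by omega
      simp only [wallOf, e, decide_eq_decide] at this
      have := ih (by omega)
      tauto
  have := key (h + 1 - j) (by omega)
  rwa [show h + 1 - (h + 1 - j) = j by omega] at this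

theorem horAll_delta {A : Set ℤ} (hA : ∀ j ∈ A, j < 1) {c : Finset ℤ}
    (hc : c ⊆ Finset.Icc (1 : ℤ) h) :
    horAll h t (delta (wallOf h A)) (wallOf h (A ∪ ↑c)) = t ^ c.card := by
  have hout : ∀ c ⊆ Finset.Icc (1 : ℤ) h, (h : ℤ) + 1 ∉ A ∪ ↑c := by
    rintro c hc (hx | hx)
    · have := hA _ hx; omega
    · have := Finset.mem_Icc.1 (hc hx); omega
  rw [horAll_wallOf_column _ hA hc, Finset.sum_eq_single ∅]
  · have : symmDiff ∅ c = c := bot_symmDiff c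
    simp [delta, this]
  · intro c' hc' hne
    rw [Finset.mem_powerset] at hc'
    have : wallOf h (A ∪ ↑c') ≠ wallOf h A := by
      intro hcon
      refine hne (Finset.eq_empty_of_forall_notMem fun j hj => ?_)
      have hj1 := Finset.mem_Icc.1 (hc' hj)
      have := wallOf_injective hcon (hout c' hc') (by simpa using hout ∅ (by simp)) j.toNat
        (by omega)
      rw [Int.toNat_of_nonneg (by omega)] at this
      have h3 : j ∈ A := this.1 (Or.inr hj)
      have := hA j h3
      omega
    simp [delta, this]
  · simp

end Columns

section Rectangle

open Matrix

variable {h : ℕ} {s t : ℝ}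

theorem line_energy (l : ℤ) {n : ℤ} (hn : 1 ≤ n) (g : ℤ → ℕ) :
    ∑ j ∈ Finset.Ioc l (l + n), ((if j + 1 ∈ Finset.Ioc l (l + n) then 1 else 2) * g j
      + (if j - 1 ∈ Finset.Ioc l (l + n) then 1 else 2) * g (j - 1))
      = 2 * ∑ j ∈ Finset.Icc l (l + n), g j := by
  have e : ∀ j ∈ Finset.Ioc l (l + n), ((if j + 1 ∈ Finset.Ioc l (l + n) then 1 else 2) * g j
      + (if j - 1 ∈ Finset.Ioc l (l + n) then 1 else 2) * g (j - 1))
      = (g j + (if j = l + 1 then g l else 0))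
        + (g (j - 1) + (if j = l + n then g (l + n) else 0)) := by
    intro j hj
    rw [Finset.mem_Ioc] at hj
    have h1 : j + 1 ∈ Finset.Ioc l (l + n) ↔ ¬ j = l + n := by rw [Finset.mem_Ioc]; omega
    have h2 : j - 1 ∈ Finset.Ioc l (l + n) ↔ ¬ j = l + 1 := by rw [Finset.mem_Ioc]; omega
    simp only [h1, h2]
    have a1 : (if ¬ j = l + n then 1 else 2) * g j = g j + (if j = l + n then g (l + n) else 0) := by
      by_cases h3 : j = l + n
      · rw [if_neg (not_not.2 h3), if_pos h3, h3]; ring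
      · rw [if_pos h3, if_neg h3]; ring
    have a2 : (if ¬ j = l + 1 then 1 else 2) * g (j - 1)
        = g (j - 1) + (if j = l + 1 then g l else 0) := by
      by_cases h3 : j = l + 1
      · rw [if_neg (not_not.2 h3), if_pos h3, h3, show l + 1 - 1 = l by ring]; ring
      · rw [if_pos h3, if_neg h3]; ring
    rw [a1, a2]; ring
  rw [Finset.sum_congr rfl e, Finset.sum_add_distrib, Finset.sum_add_distrib,
    Finset.sum_add_distrib, Finset.sum_ite_eq', Finset.sum_ite_eq',
    if_pos (Finset.mem_Ioc.2 (by omega)), if_pos (Finset.mem_Ioc.2 (by omega)), two_mul]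
  congr 1
  · rw [← Finset.Ioc_insert_left (by omega : l ≤ l + n), Finset.sum_insert (by simp),
      add_comm]
  · rw [← Finset.Ico_insert_right (by omega : l ≤ l + n), Finset.sum_insert (by simp),
      add_comm]
    congr 1
    refine Finset.sum_bij' (fun j _ => j - 1) (fun j _ => j + 1) ?_ ?_ ?_ ?_ ?_
    · intro j hj; rw [Finset.mem_Ioc] at hj; rw [Finset.mem_Ico]; omega
    · intro j hj; rw [Finset.mem_Ico] at hj; rw [Finset.mem_Ioc]; omega
    · intro j _; ring
    · intro j _; ring
    · intro j _; rfl

theorem sum_nbrs {M : Type*} [AddCommMonoid M] (x : Site) (g : Site → M) :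
    ∑ y ∈ nbrs x, g y = g (x.1 + 1, x.2) + (g (x.1 - 1, x.2)
      + (g (x.1, x.2 + 1) + g (x.1, x.2 - 1))) := by
  unfold nbrs
  rw [Finset.sum_insert (by simp; omega), Finset.sum_insert (by simp),
    Finset.sum_insert (by simp; omega), Finset.sum_singleton]

/-- The rectangle of `n` columns to the right of `l`, rows `1` to `h`. -/
noncomputable def cols (l : ℤ) (n h : ℕ) : Finset Site := Finset.Ioc l (l + n) ×ˢ Finset.Icc (1 : ℤ) h

def column (σ : Set Site) (x : ℤ) : Set ℤ := {j | (x, j) ∈ σ}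

open Classical in
/-- Number of rows in which two columns differ. -/
noncomputable def hdiff (h : ℕ) (P Q : Set ℤ) : ℕ :=
  ∑ j ∈ Finset.Icc (1 : ℤ) h, if (j ∈ P ↔ j ∈ Q) then 0 else 1

open Classical in
theorem walls_wallOf (P : Set ℤ) : walls (wallOf h P)
    = ∑ j ∈ Finset.Icc (0 : ℤ) h, if (j ∈ P ↔ j + 1 ∈ P) then 0 else 1 := by
  unfold walls
  refine Finset.sum_bij (fun j _ => ((j : ℕ) : ℤ)) ?_ ?_ ?_ ?_
  · intro j _
    have := j.2
    rw [Finset.mem_Icc]; omega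
  · intro i _ j _ hij
    exact Fin.ext (by omega)
  · intro j hj
    rw [Finset.mem_Icc] at hj
    exact ⟨⟨j.toNat, by omega⟩, Finset.mem_univ _, by simp; omega⟩
  · intro j _
    simp only [wallOf_eq_true]
    split_ifs <;> tauto

theorem energy_cols (l : ℤ) {n : ℕ} (hn : 1 ≤ n) (hh : 1 ≤ h) (σ : Set Site) :
    energy nbrs (cols l n h) σ
      = 2 * (∑ x ∈ Finset.Ioc l (l + n), walls (wallOf h (column σ x))
        + ∑ x ∈ Finset.Icc l (l + n), hdiff h (column σ x) (column σ (x + 1))) := by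
  classical
  have hI : Finset.Icc (1 : ℤ) h = Finset.Ioc 0 (0 + (h : ℤ)) := by
    ext j; rw [Finset.mem_Icc, Finset.mem_Ioc]; omega
  have hn' : (1 : ℤ) ≤ n := by omega
  have hh' : (1 : ℤ) ≤ h := by omega
  unfold energy cols
  simp only [sum_nbrs]
  rw [Finset.sum_product]
  have key : ∀ x ∈ Finset.Ioc l (l + n), ∀ j ∈ Finset.Icc (1 : ℤ) h,
      (((if (x + 1, j) ∈ Finset.Ioc l (l + n) ×ˢ Finset.Icc (1 : ℤ) h then 1 else 2) *
          if ((x, j) ∈ σ ↔ (x + 1, j) ∈ σ) then 0 else 1) +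
        (((if (x - 1, j) ∈ Finset.Ioc l (l + n) ×ˢ Finset.Icc (1 : ℤ) h then 1 else 2) *
            if ((x, j) ∈ σ ↔ (x - 1, j) ∈ σ) then 0 else 1) +
          (((if (x, j + 1) ∈ Finset.Ioc l (l + n) ×ˢ Finset.Icc (1 : ℤ) h then 1 else 2) *
              if ((x, j) ∈ σ ↔ (x, j + 1) ∈ σ) then 0 else 1) +
            (if (x, j - 1) ∈ Finset.Ioc l (l + n) ×ˢ Finset.Icc (1 : ℤ) h then 1 else 2) *
              if ((x, j) ∈ σ ↔ (x, j - 1) ∈ σ) then 0 else 1)))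
      = (((if x + 1 ∈ Finset.Ioc l (l + n) then 1 else 2)
          * (fun x => if (j ∈ column σ x ↔ j ∈ column σ (x + 1)) then 0 else 1) x)
        + ((if x - 1 ∈ Finset.Ioc l (l + n) then 1 else 2)
          * (fun x => if (j ∈ column σ x ↔ j ∈ column σ (x + 1)) then 0 else 1) (x - 1)))
        + (((if j + 1 ∈ Finset.Ioc 0 (0 + (h : ℤ)) then 1 else 2)
          * (fun j => if (j ∈ column σ x ↔ j + 1 ∈ column σ x) then 0 else 1) j)
        + ((if j - 1 ∈ Finset.Ioc 0 (0 + (h : ℤ)) then 1 else 2)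
          * (fun j => if (j ∈ column σ x ↔ j + 1 ∈ column σ x) then 0 else 1) (j - 1))) := by
    intro x hx j hj
    simp only [Finset.mem_product, hx, hj, and_true, true_and, ← hI, column, Set.mem_ofPred_eq,
      sub_add_cancel]
    have c1 : ((x - 1, j) ∈ σ ↔ (x, j) ∈ σ) ↔ ((x, j) ∈ σ ↔ (x - 1, j) ∈ σ) := iff_comm
    have c2 : ((x, j - 1) ∈ σ ↔ (x, j) ∈ σ) ↔ ((x, j) ∈ σ ↔ (x, j - 1) ∈ σ) := iff_comm
    simp only [c1, c2]
    ring_nf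
  rw [Finset.sum_congr rfl fun x hx => Finset.sum_congr rfl fun j hj => key x hx j hj]
  rw [Finset.sum_congr rfl fun x _ => Finset.sum_add_distrib, Finset.sum_add_distrib,
    Finset.sum_comm]
  rw [Finset.sum_congr rfl fun j _ => line_energy l hn'
      (fun x => if (j ∈ column σ x ↔ j ∈ column σ (x + 1)) then 0 else 1)]
  rw [Finset.sum_congr (s₁ := Finset.Ioc l (l + n)) (g := fun x => 2 * walls (wallOf h (column σ x)))
      rfl fun x _ => ?_]
  · rw [← Finset.mul_sum, ← Finset.mul_sum, mul_add, add_comm, Finset.sum_comm]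
    rfl
  · rw [hI, line_energy 0 hh' (fun j => if (j ∈ column σ x ↔ j + 1 ∈ column σ x) then 0 else 1),
      walls_wallOf, zero_add]

end Rectangle

section TransferMatrix

open Matrix

variable {h : ℕ} {s t : ℝ}

/-- The partition function of `F` with the sites of `A` frozen to minus, in terms of energies. -/
noncomputable def ypart (s : ℝ) (F A : Finset Site) : ℝ :=
  ∑ f ∈ F.powerset, s ^ energy nbrs F (↑(A ∪ f) : Set Site)

theorem hdiff_congr {P P' Q Q' : Set ℤ} (hP : ∀ j ∈ Finset.Icc (1 : ℤ) h, (j ∈ P ↔ j ∈ P'))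
    (hQ : ∀ j ∈ Finset.Icc (1 : ℤ) h, (j ∈ Q ↔ j ∈ Q')) : hdiff h P Q = hdiff h P' Q' := by
  classical
  unfold hdiff
  refine Finset.sum_congr rfl fun j hj => ?_
  simp only [hP j hj, hQ j hj]

theorem hdiff_coe {c c' : Finset ℤ} (hc : c ⊆ Finset.Icc (1 : ℤ) h)
    (hc' : c' ⊆ Finset.Icc (1 : ℤ) h) : hdiff h ↑c ↑c' = (symmDiff c c').card := by
  classical
  unfold hdiff
  rw [Finset.card_eq_sum_ones, ← Finset.sum_subset (s₁ := symmDiff c c')]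
  · refine Finset.sum_congr rfl fun j hj => ?_
    rw [Finset.mem_symmDiff] at hj
    rw [if_neg]
    simp only [Finset.mem_coe]
    tauto
  · intro x hx
    rw [Finset.mem_symmDiff] at hx
    exact hx.elim (fun hx => hc hx.1) fun hx => hc' hx.1
  · intro j _ hj
    rw [Finset.mem_symmDiff] at hj
    rw [if_pos]
    simp only [Finset.mem_coe]
    tauto

/-- The first `p` sites of the axis to the right of `l`. -/
noncomputable def axis (l : ℤ) (p : ℕ) : Finset Site := Finset.Ioc l (l + p) ×ˢ {0}

/-- The part of `axis l p` in its `i`-th column. -/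
def axisCol (p i : ℕ) : Set ℤ := {j | j = 0 ∧ i ≤ p}

theorem column_axis (l : ℤ) (p i : ℕ) (hi : 1 ≤ i) (f : Finset Site) :
    column (↑(axis l p ∪ f) : Set Site) (l + i) = axisCol p i ∪ column ↑f (l + i) := by
  ext j
  simp only [column, axisCol, axis, Finset.coe_union, Set.mem_union, Finset.mem_coe,
    Finset.mem_product, Finset.mem_Ioc, Finset.mem_singleton, Set.mem_ofPred_eq]
  have : (l < l + (i : ℤ) ∧ l + (i : ℤ) ≤ l + p) ↔ i ≤ p := by omega
  rw [this]
  tauto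

noncomputable def partEnergy (l : ℤ) (h p m : ℕ) (f : Finset Site) (c : Set ℤ) : ℕ :=
  ∑ x ∈ Finset.Ioc l (l + m), walls (wallOf h (column (↑(axis l p ∪ f)) x))
    + ∑ x ∈ Finset.Ico l (l + m), hdiff h (column (↑(axis l p ∪ f)) x)
        (column (↑(axis l p ∪ f)) (x + 1))
    + hdiff h (column (↑(axis l p ∪ f)) (l + m)) c

theorem partEnergy_succ (l : ℤ) (p m : ℕ) {f : Finset Site} (hf : f ⊆ cols l m h) (c : Set ℤ)
    (c' : Finset ℤ) :
    partEnergy l h p (m + 1) (f ∪ {l + m + 1} ×ˢ c') c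
      = hdiff h (axisCol p (m + 1) ∪ ↑c') c + walls (wallOf h (axisCol p (m + 1) ∪ ↑c'))
        + partEnergy l h p m f (axisCol p (m + 1) ∪ ↑c') := by
  have hne : ∀ x ≤ l + m, column (↑(axis l p ∪ (f ∪ {l + m + 1} ×ˢ c')) : Set Site) x
      = column (↑(axis l p ∪ f)) x := by
    intro x hx
    ext j
    simp only [column, Finset.coe_union, Set.mem_union, Finset.mem_coe, Finset.mem_product,
      Finset.mem_singleton, Set.mem_ofPred_eq]
    have : ¬ x = l + m + 1 := by omega
    tauto
  have heq : column (↑(axis l p ∪ (f ∪ {l + m + 1} ×ˢ c')) : Set Site) (l + m + 1)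
      = axisCol p (m + 1) ∪ ↑c' := by
    have := column_axis l p (m + 1) (by omega) (f ∪ {l + m + 1} ×ˢ c')
    push_cast at this
    rw [← add_assoc] at this
    push_cast
    rw [this]
    congr 1
    ext j
    simp only [column, Set.mem_union, Finset.mem_coe, Set.mem_prod,
      Set.mem_singleton_iff, Set.mem_ofPred_eq]
    have : (l + m + 1, j) ∉ f := fun hcon => by
      have := hf hcon
      rw [cols, Finset.mem_product, Finset.mem_Ioc] at this
      have := this.1.2
      simp only at this
      omega
    tauto
  unfold partEnergy
  push_cast
  rw [← add_assoc]
  rw [← Finset.insert_Ioc_right_eq_Ioc_add_one (by omega : l ≤ l + m),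
    ← Finset.insert_Ico_right_eq_Ico_add_one (by omega : l ≤ l + m),
    Finset.sum_insert (by simp), Finset.sum_insert (by simp)]
  push_cast at hne heq
  rw [heq, hne _ le_rfl]
  rw [Finset.sum_congr rfl fun x hx => by
      rw [hne x (by rw [Finset.mem_Ioc] at hx; omega)],
    Finset.sum_congr (s₁ := Finset.Ico l (l + m)) rfl fun x hx => by
      rw [hne x (by rw [Finset.mem_Ico] at hx; omega),
        hne (x + 1) (by rw [Finset.mem_Ico] at hx; omega)]]
  ring

noncomputable def transferVec (h : ℕ) (s : ℝ) (p : ℕ) : ℕ → (Wall h → ℝ)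
  | 0 => horAll h (s ^ 2) (delta (botWall h))
  | m + 1 => if m + 1 = p then flipOp 0 (horAll h (s ^ 2) (verOp h s (verOp h s (transferVec h s p m))))
      else horAll h (s ^ 2) (verOp h s (verOp h s (transferVec h s p m)))

theorem noWall_eq : noWall h = wallOf h ∅ := by
  funext j
  simp [noWall, wallOf]

theorem botWall_eq : botWall h = wallOf h {0} := by
  rw [botWall, noWall_eq, wallOf_flip_zero]
  congr 1
  exact bot_symmDiff _

theorem cols_succ (l : ℤ) (m h : ℕ) :
    cols l (m + 1) h = cols l m h ∪ {l + m + 1} ×ˢ Finset.Icc (1 : ℤ) h := by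
  unfold cols
  push_cast
  rw [← add_assoc, ← Finset.insert_Ioc_right_eq_Ioc_add_one (by omega : l ≤ l + m),
    Finset.insert_eq, Finset.union_product, Finset.union_comm]

theorem sum_partEnergy (l : ℤ) {p : ℕ} (hp : 1 ≤ p) (m : ℕ) {c : Finset ℤ}
    (hc : c ⊆ Finset.Icc (1 : ℤ) h) :
    ∑ f ∈ (cols l m h).powerset, (s ^ 2) ^ partEnergy l h p m f ↑c
      = transferVec h s p m (wallOf h (axisCol p (m + 1) ∪ ↑c)) := by
  have hlt : ∀ i, ∀ j ∈ axisCol p i, j < 1 := fun i j hj => by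
    have := hj.1; omega
  induction m generalizing c with
  | zero =>
    have e : axisCol p (0 + 1) = {0} := by
      ext j; simp [axisCol]; omega
    have hlt' := hlt (0 + 1)
    rw [e] at hlt' ⊢
    rw [transferVec, botWall_eq, horAll_delta hlt' hc]
    simp only [cols, Nat.cast_zero, add_zero, Finset.Ioc_self, Finset.empty_product,
      Finset.powerset_empty, Finset.sum_singleton, partEnergy, Finset.Ico_self, Finset.sum_empty,
      zero_add]
    congr 1
    have h1 := hdiff_coe (h := h) (c := ∅) (c' := c) (by simp) hc
    rw [show symmDiff ∅ c = c from bot_symmDiff c] at h1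
    rw [← h1]
    refine hdiff_congr (fun j hj => ?_) fun j _ => Iff.rfl
    simp [column, axis]
  | succ m ih =>
    have main : ∑ f ∈ (cols l (m + 1) h).powerset, (s ^ 2) ^ partEnergy l h p (m + 1) f ↑c
        = horAll h (s ^ 2) (verOp h s (verOp h s (transferVec h s p m)))
          (wallOf h (axisCol p (m + 1) ∪ ↑c)) := by
      have hd : Disjoint (cols l m h) ({l + m + 1} ×ˢ Finset.Icc (1 : ℤ) h) := by
        rw [Finset.disjoint_left]
        intro x hx hx'
        rw [cols, Finset.mem_product, Finset.mem_Ioc] at hx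
        rw [Finset.mem_product, Finset.mem_singleton] at hx'
        omega
      rw [cols_succ, sum_powerset_union hd, Finset.sum_comm,
        horAll_wallOf_column _ (hlt _) hc]
      have hsum : ∀ g : Finset Site → ℝ,
          ∑ y ∈ ({l + (m : ℤ) + 1} ×ˢ Finset.Icc (1 : ℤ) h).powerset, g y
            = ∑ c' ∈ (Finset.Icc (1 : ℤ) h).powerset, g ({l + (m : ℤ) + 1} ×ˢ c') := by
        intro g
        refine (Finset.sum_bij' (fun c' _ => ({l + (m : ℤ) + 1} : Finset ℤ) ×ˢ c') (fun y _ => y.image Prod.snd)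
          ?_ ?_ ?_ ?_ ?_).symm
        · intro c' hc'
          exact Finset.mem_powerset.2
            (Finset.product_subset_product_right (Finset.mem_powerset.1 hc'))
        · intro y hy
          refine Finset.mem_powerset.2 fun j hj => ?_
          obtain ⟨x, hx, rfl⟩ := Finset.mem_image.1 hj
          exact (Finset.mem_product.1 (Finset.mem_powerset.1 hy hx)).2
        · intro c' _
          ext j; simp
        · intro y hy
          ext x
          simp only [Finset.mem_product, Finset.mem_singleton, Finset.mem_image]
          constructor
          · rintro ⟨h1, z, hz, h2⟩
            have := (Finset.mem_product.1 (Finset.mem_powerset.1 hy hz)).1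
            rw [Finset.mem_singleton] at this
            rwa [show x = z from Prod.ext (h1.trans this.symm) h2.symm]
          · intro hx
            have := (Finset.mem_product.1 (Finset.mem_powerset.1 hy hx)).1
            exact ⟨Finset.mem_singleton.1 this, x, hx, rfl⟩
        · intro c' _; rfl
      rw [hsum]
      refine Finset.sum_congr rfl fun c' hc' => ?_
      rw [Finset.mem_powerset] at hc'
      rw [verOp_apply, verOp_apply, ← ih hc', ← mul_assoc (s ^ _), ← pow_add, ← two_mul, pow_mul,
        ← mul_assoc, ← pow_add, Finset.mul_sum]
      refine Finset.sum_congr rfl fun f hf => ?_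
      have hax : ∀ j ∈ Finset.Icc (1 : ℤ) h, (j ∈ axisCol p (m + 1) ∪ ↑c' ↔ j ∈ (c' : Set ℤ)) := by
        intro j hj
        have : j ∉ axisCol p (m + 1) := fun hcon => by
          have := hcon.1
          rw [Finset.mem_Icc] at hj
          omega
        simp [this]
      rw [partEnergy_succ l p m (Finset.mem_powerset.1 hf), ← pow_add,
        hdiff_congr hax fun j _ => Iff.rfl, hdiff_coe hc' hc]
      congr 2
      unfold partEnergy
      rw [hdiff_congr (fun j _ => Iff.rfl) hax]
    rw [main, transferVec]
    split_ifs with hmp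
    · rw [flipOp_apply, wallOf_flip_zero]
      refine congrArg _ (congrArg _ ?_)
      ext j
      have h0 : (0 : ℤ) ∉ c := fun hcon => by
        have := Finset.mem_Icc.1 (hc hcon); omega
      simp only [axisCol, Set.mem_union, Set.mem_ofPred_eq, Finset.mem_coe, Set.mem_symmDiff,
        Set.mem_singleton_iff]
      have h1 : m + 1 ≤ p := by omega
      have h2 : ¬ m + 1 + 1 ≤ p := by omega
      have h3 : j = 0 → j ∉ c := fun hj => hj ▸ h0
      tauto
    · refine congrArg _ (congrArg _ ?_)
      ext j
      simp only [axisCol, Set.mem_union, Set.mem_ofPred_eq]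
      have : m + 1 ≤ p ↔ m + 1 + 1 ≤ p := by omega
      rw [this]

theorem dotProduct_jumpOp (f g : Wall h → ℝ) : f ⬝ᵥ jumpOp h s g = jumpOp h s f ⬝ᵥ g := by
  have hc : ∀ f, flipOp 0 (horAll h (s ^ 2) f) = horAll h (s ^ 2) (flipOp 0 f) := fun f => by
    have := horAll_fermE_zero (h := h) (t := s ^ 2)
    rw [fermE_zero] at this
    exact (LinearMap.congr_fun this f).symm
  have hh : ∀ f g : Wall h → ℝ, f ⬝ᵥ horAll h (s ^ 2) g = horAll h (s ^ 2) f ⬝ᵥ g :=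
    dotProduct_horOp _
  simp only [jumpOp, Module.End.mul_apply]
  rw [dotProduct_verOp, hh, dotProduct_flipOp, dotProduct_verOp, hc]

theorem dotProduct_trOp_pow (n : ℕ) (f g : Wall h → ℝ) :
    f ⬝ᵥ (trOp h s ^ n) g = (trOp h s ^ n) f ⬝ᵥ g := by
  induction n generalizing f with
  | zero => rfl
  | succ n ih =>
    rw [pow_succ', Module.End.mul_apply, dotProduct_trOp, ih, ← Module.End.mul_apply, ← pow_succ,
      pow_succ']

theorem verOp_delta_botWall : verOp h s (delta (botWall h)) = s • delta (botWall h) := by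
  funext S
  rw [verOp_apply, Pi.smul_apply, smul_eq_mul]
  by_cases hS : S = botWall h
  · subst hS
    congr 1
    have : walls (botWall h) = 1 := by
      unfold walls
      rw [Finset.sum_eq_single 0]
      · simp [botWall, flip, noWall]
      · intro j _ hj; simp [botWall, flip, noWall, hj]
      · simp
    rw [this, pow_one]
  · simp [delta, hS]

theorem transferVec_noWall (hs : s ≠ 0) {p : ℕ} (hp : 1 ≤ p) (q : ℕ) :
    transferVec h s p (p + q) (noWall h) = s⁻¹ * stepZ h s p q := by
  have hc : ∀ f, flipOp 0 (horAll h (s ^ 2) f) = horAll h (s ^ 2) (flipOp 0 f) := fun f => by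
    have := horAll_fermE_zero (h := h) (t := s ^ 2)
    rw [fermE_zero] at this
    exact (LinearMap.congr_fun this f).symm
  have h1 : ∀ m < p, verOp h s (transferVec h s p m)
      = s⁻¹ • (trOp h s ^ (m + 1)) (delta (botWall h)) := by
    intro m
    induction m with
    | zero =>
      intro _
      rw [transferVec, pow_one, trOp, Module.End.mul_apply, Module.End.mul_apply,
        verOp_delta_botWall, map_smul, map_smul, smul_smul, inv_mul_cancel₀ hs, one_smul]
    | succ m ih =>
      intro hm
      rw [transferVec, if_neg (by omega), ih (by omega), pow_succ' _ (m + 1), Module.End.mul_apply]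
      simp only [map_smul, trOp, Module.End.mul_apply]
  have h2 : verOp h s (transferVec h s p p)
      = s⁻¹ • jumpOp h s ((trOp h s ^ p) (delta (botWall h))) := by
    obtain ⟨k, rfl⟩ : ∃ k, p = k + 1 := ⟨p - 1, by omega⟩
    rw [transferVec, if_pos rfl, h1 k (by omega)]
    simp only [map_smul, jumpOp, Module.End.mul_apply, hc]
  have h3 : ∀ q, verOp h s (transferVec h s p (p + q))
      = s⁻¹ • (trOp h s ^ q) (jumpOp h s ((trOp h s ^ p) (delta (botWall h)))) := by
    intro q
    induction q with
    | zero => simpa using h2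
    | succ q ih =>
      rw [← add_assoc, transferVec, if_neg (by omega), ih, pow_succ' _ q, Module.End.mul_apply]
      simp only [map_smul, trOp, Module.End.mul_apply]
  have h4 : transferVec h s p (p + q) (noWall h)
      = verOp h s (transferVec h s p (p + q)) (noWall h) := by
    rw [verOp_apply]
    simp [walls, noWall]
  rw [h4, h3, Pi.smul_apply, smul_eq_mul, stepZ, ← dotProduct_comm (jumpOp h s _),
    ← dotProduct_jumpOp, ← dotProduct_trOp_pow, delta_dotProduct]

theorem ypart_cols (hs : s ≠ 0) (hh : 1 ≤ h) (l : ℤ) {p : ℕ} (hp : 1 ≤ p) (q : ℕ) :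
    ypart s (cols l (p + q) h) (axis l p) = s⁻¹ * stepZ h s p q := by
  rw [← transferVec_noWall hs hp q]
  have e := sum_partEnergy (s := s) l hp (p + q) (h := h) (c := ∅) (by simp)
  have e0 : axisCol p (p + q + 1) = ∅ := by
    ext j; simp [axisCol]
  rw [e0, Finset.coe_empty, Set.union_empty, ← noWall_eq] at e
  rw [← e, ypart]
  refine Finset.sum_congr rfl fun f hf => ?_
  rw [Finset.mem_powerset] at hf
  rw [energy_cols l (by omega) hh, pow_mul]
  congr 1
  unfold partEnergy
  rw [add_assoc, ← Finset.Ico_insert_right (by omega : l ≤ l + ((p + q : ℕ) : ℤ)),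
    Finset.sum_insert (by simp), add_comm (hdiff _ _ _)]
  congr 2
  refine hdiff_congr (fun j _ => Iff.rfl) fun j hj => ?_
  rw [Finset.mem_Icc] at hj
  simp only [column, Set.mem_ofPred_eq, Finset.mem_coe, Finset.mem_union, axis,
    Finset.mem_product, Finset.mem_Ioc, Finset.mem_singleton, Set.mem_empty_iff_false, iff_false]
  rintro (hx | hx)
  · omega
  · have := hf hx
    rw [cols, Finset.mem_product, Finset.mem_Ioc] at this
    have := this.1.2
    simp only at this
    omega

end TransferMatrix

section Layers

open Matrix

theorem energy_union_eq {V : Type*} [DecidableEq V] (nb : V → Finset V)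
    (hs : ∀ x y, y ∈ nb x → x ∈ nb y) {G J : Finset V} (hd : Disjoint G J) (σ : Set V) :
    energy nb (G ∪ J) σ = energy nb G σ + energy (fun x => nb x \ G) J σ := by
  classical
  have hs' : ∀ x y, y ∈ nb x ↔ x ∈ nb y := fun x y => ⟨hs x y, hs y x⟩
  obtain ⟨d, hd'⟩ : ∃ d : V → V → ℕ, ∀ x y, d x y = if (x ∈ σ ↔ y ∈ σ) then 0 else 1 :=
    ⟨_, fun _ _ => rfl⟩
  have dsymm : ∀ x y, d x y = d y x := fun x y => by
    rw [hd', hd']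
    have : (x ∈ σ ↔ y ∈ σ) ↔ (y ∈ σ ↔ x ∈ σ) := iff_comm
    simp only [this]
  unfold energy
  simp only [← hd']
  have h1 : ∀ x ∈ G, ∑ y ∈ nb x, (if y ∈ G then 1 else 2) * d x y
      = ∑ y ∈ nb x, (if y ∈ G ∪ J then 1 else 2) * d x y
        + ∑ y ∈ J, if y ∈ nb x then d x y else 0 := by
    intro x _
    have e : ∑ y ∈ J, (if y ∈ nb x then d x y else 0) = ∑ y ∈ nb x, if y ∈ J then d x y else 0 := by
      rw [← Finset.sum_filter, ← Finset.sum_filter]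
      refine Finset.sum_congr ?_ fun _ _ => rfl
      ext y; simp [and_comm]
    rw [e, ← Finset.sum_add_distrib]
    refine Finset.sum_congr rfl fun y _ => ?_
    by_cases hy : y ∈ G
    · have : y ∉ J := Finset.disjoint_left.1 hd hy
      simp [hy, this]
    · by_cases hy' : y ∈ J
      · simp [hy, hy']; ring
      · simp [hy, hy']
  have h2 : ∀ x ∈ J, ∑ y ∈ nb x, (if y ∈ G ∪ J then 1 else 2) * d x y
      = ∑ y ∈ nb x \ G, (if y ∈ J then 1 else 2) * d x y
        + ∑ y ∈ G, if y ∈ nb x then d x y else 0 := by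
    intro x _
    have e : ∑ y ∈ G, (if y ∈ nb x then d x y else 0) = ∑ y ∈ nb x, if y ∈ G then d x y else 0 := by
      rw [← Finset.sum_filter, ← Finset.sum_filter]
      refine Finset.sum_congr ?_ fun _ _ => rfl
      ext y; simp [and_comm]
    have e' : ∑ y ∈ nb x \ G, (if y ∈ J then 1 else 2) * d x y
        = ∑ y ∈ nb x, if y ∉ G then (if y ∈ J then 1 else 2) * d x y else 0 := by
      rw [← Finset.sum_filter]
      refine Finset.sum_congr ?_ fun _ _ => rfl
      ext y; simp
    rw [e, e', ← Finset.sum_add_distrib]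
    refine Finset.sum_congr rfl fun y _ => ?_
    by_cases hy : y ∈ G <;> simp [hy]
  rw [Finset.sum_union hd, Finset.sum_congr rfl h1, Finset.sum_congr rfl h2,
    Finset.sum_add_distrib, Finset.sum_add_distrib, Finset.sum_comm (s := J) (t := G)]
  have : ∀ x y, (if y ∈ nb x then d x y else 0) = if x ∈ nb y then d y x else 0 := fun x y => by
    rw [dsymm x y]; simp only [hs' x y]
  simp only [this]
  ring

variable {s : ℝ}

theorem ypart_pos (hs : 0 < s) (F A : Finset Site) : 0 < ypart s F A :=
  Finset.sum_pos (fun _ _ => pow_pos hs _) ⟨∅, by simp⟩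

theorem ypart_congr {F A A' : Finset Site} (hA : Disjoint A F) (hA' : Disjoint A' F)
    (h : ∀ x ∈ F, ∀ y ∈ nbrs x, y ∉ F → (y ∈ A ↔ y ∈ A')) : ypart s F A = ypart s F A' := by
  refine Finset.sum_congr rfl fun f hf => ?_
  rw [Finset.mem_powerset] at hf
  rw [energy_congr]
  · intro x hx
    have h1 : x ∉ A := fun hxA => Finset.disjoint_left.1 hA hxA hx
    have h2 : x ∉ A' := fun hxA => Finset.disjoint_left.1 hA' hxA hx
    simp [h1, h2]
  · intro x hx y hy hyF
    have := h x hx y hy hyF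
    simp [this]

/-- Exchanging the two spins in the boundary condition. -/
theorem ypart_flip {F A A' : Finset Site} (hA : Disjoint A F) (hA' : Disjoint A' F)
    (h : ∀ x ∈ F, ∀ y ∈ nbrs x, y ∉ F → (y ∈ A ↔ y ∉ A')) : ypart s F A = ypart s F A' := by
  unfold ypart
  refine Finset.sum_bij' (fun f _ => F \ f) (fun f _ => F \ f) (fun f _ => by simp)
    (fun f _ => by simp) (fun f hf => ?_) (fun f hf => ?_) fun f hf => ?_
  · exact Finset.sdiff_sdiff_eq_self (Finset.mem_powerset.1 hf)
  · exact Finset.sdiff_sdiff_eq_self (Finset.mem_powerset.1 hf)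
  · rw [Finset.mem_powerset] at hf
    rw [← energy_compl]
    rw [energy_congr]
    · intro x hx
      have h1 : x ∉ A := fun hxA => Finset.disjoint_left.1 hA hxA hx
      have h2 : x ∉ A' := fun hxA => Finset.disjoint_left.1 hA' hxA hx
      simp [h1, h2, hx]
    · intro x hx y hy hyF
      have h1 := h x hx y hy hyF
      have h2 : y ∉ f := fun hyf => hyF (hf hyf)
      simp [h1, h2, hyF]

theorem ypart_map (e : Site ≃ Site) (he : ∀ x, nbrs (e x) = (nbrs x).map e.toEmbedding)
    (F A : Finset Site) :
    ypart s (F.map e.toEmbedding) (A.map e.toEmbedding) = ypart s F A := by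
  unfold ypart
  symm
  refine Finset.sum_bij' (fun f _ => f.map e.toEmbedding) (fun f _ => f.map e.symm.toEmbedding)
    (fun f hf => ?_) (fun f hf => ?_) (fun f hf => ?_) (fun f hf => ?_) fun f hf => ?_
  · exact Finset.mem_powerset.2 (Finset.map_subset_map.2 (Finset.mem_powerset.1 hf))
  · refine Finset.mem_powerset.2 fun x hx => ?_
    obtain ⟨y, hy, rfl⟩ := Finset.mem_map.1 hx
    obtain ⟨z, hz, rfl⟩ := Finset.mem_map.1 (Finset.mem_powerset.1 hf hy)
    simpa using hz
  · ext x; simp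
  · ext x; simp
  · rw [energy_image nbrs e he]
    congr 2
    ext x
    simp

noncomputable def lineWeight (s : ℝ) (G J A : Finset Site) : ℝ :=
  s ^ energy (fun x => nbrs x \ G) J (↑A : Set Site)

/-- Factorization over the configurations of a separating layer. -/
theorem sum_layers {U D J A : Finset Site} (hUD : Disjoint U D) (hJ : Disjoint (U ∪ D) J)
    (hadj : ∀ x ∈ U, ∀ y ∈ nbrs x, y ∉ D)
    (φ : Finset Site → ℝ) :
    ∑ f ∈ ((U ∪ D) ∪ J).powerset, φ (f ∩ J) * s ^ energy nbrs ((U ∪ D) ∪ J) (↑(A ∪ f) : Set Site)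
      = ∑ ξ ∈ J.powerset, φ ξ * lineWeight s (U ∪ D) J (A ∪ ξ) * ypart s U (A ∪ ξ)
        * ypart s D (A ∪ ξ) := by
  rw [sum_powerset_union hJ, Finset.sum_comm]
  refine Finset.sum_congr rfl fun ξ hξ => ?_
  rw [Finset.mem_powerset] at hξ
  rw [sum_powerset_union hUD, ypart, ypart, mul_assoc (φ ξ * _), Finset.sum_mul_sum, Finset.mul_sum]
  refine Finset.sum_congr rfl fun u hu => ?_
  rw [Finset.mul_sum]
  refine Finset.sum_congr rfl fun d hd => ?_
  rw [Finset.mem_powerset] at hu hd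
  have hUJ : ∀ x ∈ U, x ∉ J := fun x hx => Finset.disjoint_left.1 hJ (Finset.mem_union_left _ hx)
  have hDJ : ∀ x ∈ D, x ∉ J := fun x hx => Finset.disjoint_left.1 hJ (Finset.mem_union_right _ hx)
  have hUD' : ∀ x ∈ U, x ∉ D := fun x hx => Finset.disjoint_left.1 hUD hx
  have e1 : (u ∪ d ∪ ξ) ∩ J = ξ := by
    ext x
    simp only [Finset.mem_inter, Finset.mem_union]
    have := @hu x; have := @hd x; have := @hξ x; have := hUJ x; have := hDJ x
    tauto
  rw [e1, energy_union_eq nbrs nbrs_symm hJ, energy_union nbrs nbrs_symm hUD hadj, pow_add, pow_add,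
    lineWeight, mul_assoc (φ ξ), mul_comm (s ^ energy (fun x => nbrs x \ (U ∪ D)) J _)]
  congr 2
  · congr 2
    · refine energy_congr _ (fun x hx => ?_) fun x hx y hy hyU => ?_
      · have := hUD' x hx
        have := @hd x
        simp only [Finset.mem_coe, Finset.mem_union]; tauto
      · have := hadj x hx y hy
        have := @hd y; have := @hu y
        simp only [Finset.mem_coe, Finset.mem_union]; tauto
    · refine energy_congr _ (fun x hx => ?_) fun x hx y hy hyU => ?_
      · have := hUD' x
        have := @hu x
        simp only [Finset.mem_coe, Finset.mem_union]; tauto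
      · have := hadj y
        have : y ∉ U := fun h => hadj y h x (nbrs_symm _ _ hy) hx
        have := @hd y; have := @hu y
        simp only [Finset.mem_coe, Finset.mem_union]; tauto
  · refine congrArg _ (energy_congr _ (fun x hx => ?_) fun x hx y hy hyU => ?_)
    · have := hUJ x; have := hDJ x
      have := @hd x; have := @hu x
      simp only [Finset.mem_coe, Finset.mem_union]; tauto
    · rw [Finset.mem_sdiff, Finset.mem_union] at hy
      have := @hd y; have := @hu y
      simp only [Finset.mem_coe, Finset.mem_union]; tauto

theorem Pr_layers (hs : 0 < s) {U D J A : Finset Site} (hUD : Disjoint U D)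
    (hJ : Disjoint (U ∪ D) J) (hadj : ∀ x ∈ U, ∀ y ∈ nbrs x, y ∉ D)
    (hA : Disjoint A ((U ∪ D) ∪ J)) :
    Pr s A (A ∪ ((U ∪ D) ∪ J)) (fun M => J ⊆ M)
      = lineWeight s (U ∪ D) J (A ∪ J) * ypart s U (A ∪ J) * ypart s D (A ∪ J)
        / ∑ ξ ∈ J.powerset, lineWeight s (U ∪ D) J (A ∪ ξ) * ypart s U (A ∪ ξ)
          * ypart s D (A ∪ ξ) := by
  classical
  have hF : (A ∪ ((U ∪ D) ∪ J)) \ A = (U ∪ D) ∪ J := by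
    rw [Finset.union_sdiff_left]; exact Finset.sdiff_eq_self_of_disjoint hA.symm
  have hc : 0 < s ^ (2 * outerCut nbrs ((U ∪ D) ∪ J) A) := pow_pos hs _
  have hZ : Zp s A (A ∪ ((U ∪ D) ∪ J)) = (∑ ξ ∈ J.powerset, lineWeight s (U ∪ D) J (A ∪ ξ)
      * ypart s U (A ∪ ξ) * ypart s D (A ∪ ξ)) * s ^ (2 * outerCut nbrs ((U ∪ D) ∪ J) A) := by
    have := sum_layers (s := s) (A := A) hUD hJ hadj fun _ => 1
    simp only [one_mul] at this
    rw [← this, Finset.sum_mul, Zp, sum_Icc_eq Finset.subset_union_left, hF]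
    exact Finset.sum_congr rfl fun f hf => wt_union hA (Finset.mem_powerset.1 hf)
  have hW : Wev s A (A ∪ ((U ∪ D) ∪ J)) (fun M => J ⊆ M) = (lineWeight s (U ∪ D) J (A ∪ J)
      * ypart s U (A ∪ J) * ypart s D (A ∪ J)) * s ^ (2 * outerCut nbrs ((U ∪ D) ∪ J) A) := by
    have := sum_layers (s := s) (A := A) hUD hJ hadj fun ξ => if ξ = J then 1 else 0
    rw [Finset.sum_eq_single (a := J) (s := J.powerset), if_pos rfl, one_mul] at this
    · rw [← this, Finset.sum_mul, Wev, sum_Icc_eq Finset.subset_union_left, hF]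
      refine Finset.sum_congr rfl fun f hf => ?_
      have hiff : J ⊆ A ∪ f ↔ f ∩ J = J := by
        rw [Finset.inter_eq_right]
        constructor
        · intro h x hx
          rcases Finset.mem_union.1 (h hx) with hx' | hx'
          · exact (Finset.disjoint_left.1 hA hx' (Finset.mem_union_right _ hx)).elim
          · exact hx'
        · exact fun h => h.trans Finset.subset_union_right
      simp only [hiff]
      split_ifs
      · rw [wt_union hA (Finset.mem_powerset.1 hf), one_mul]
      · ring
    · intro ξ _ hξ; rw [if_neg hξ]; ring
    · intro hJ; simp at hJ
  rw [Pr, hZ, hW, mul_div_mul_right _ _ hc.ne']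

end Layers

section Reflection

open Matrix

/-- Reflection in the horizontal axis. -/
def vref : Site ≃ Site := (Equiv.refl ℤ).prodCongr (Equiv.neg ℤ)

/-- Reflection exchanging the columns `0` and `k`. -/
def href (k : ℤ) : Site ≃ Site := (Equiv.subLeft k).prodCongr (Equiv.refl ℤ)

/-- Horizontal translation. -/
def trans (k : ℤ) : Site ≃ Site := (Equiv.addRight k).prodCongr (Equiv.refl ℤ)

@[simp] theorem vref_apply (x : Site) : vref x = (x.1, -x.2) := rfl
@[simp] theorem vref_symm_apply (x : Site) : vref.symm x = (x.1, -x.2) := rfl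
@[simp] theorem href_apply (k : ℤ) (x : Site) : href k x = (k - x.1, x.2) := rfl
@[simp] theorem href_symm_apply (k : ℤ) (x : Site) : (href k).symm x = (k - x.1, x.2) := by
  rw [Equiv.symm_apply_eq]; simp
@[simp] theorem trans_apply (k : ℤ) (x : Site) : trans k x = (x.1 + k, x.2) := rfl
@[simp] theorem trans_symm_apply (k : ℤ) (x : Site) : (trans k).symm x = (x.1 - k, x.2) := by
  rw [Equiv.symm_apply_eq]; simp

theorem nbrs_vref (x : Site) : nbrs (vref x) = (nbrs x).map vref.toEmbedding := by
  ext ⟨u, v⟩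
  simp only [Finset.mem_map_equiv, mem_nbrs, Prod.ext_iff, vref_apply, vref_symm_apply]
  omega

theorem nbrs_href (k : ℤ) (x : Site) : nbrs (href k x) = (nbrs x).map (href k).toEmbedding := by
  ext ⟨u, v⟩
  simp only [Finset.mem_map_equiv, mem_nbrs, Prod.ext_iff, href_apply, href_symm_apply]
  omega

theorem nbrs_trans (k : ℤ) (x : Site) : nbrs (trans k x) = (nbrs x).map (trans k).toEmbedding := by
  ext ⟨u, v⟩
  simp only [Finset.mem_map_equiv, mem_nbrs, Prod.ext_iff, trans_apply, trans_symm_apply]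
  omega

/-- The sites of the axis in columns `x ≤ i < y`. -/
noncomputable def seg (x y : ℤ) : Finset Site := Finset.Ico x y ×ˢ {0}

theorem mem_seg {x y : ℤ} {u : Site} : u ∈ seg x y ↔ (x ≤ u.1 ∧ u.1 < y) ∧ u.2 = 0 := by
  rw [seg, Finset.mem_product, Finset.mem_Ico, Finset.mem_singleton]

/-- The sites with columns `x ≤ i < y` and rows in `[-h, h]`. -/
noncomputable def rect (x y : ℤ) (h : ℕ) : Finset Site := Finset.Ico x y ×ˢ Finset.Icc (-(h : ℤ)) h

theorem mem_rect {x y : ℤ} {h : ℕ} {u : Site} :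
    u ∈ rect x y h ↔ (x ≤ u.1 ∧ u.1 < y) ∧ -(h : ℤ) ≤ u.2 ∧ u.2 ≤ h := by
  rw [rect, Finset.mem_product, Finset.mem_Ico, Finset.mem_Icc]

/-- The outer boundary of the upper half of `rect x y h`, without the axis. -/
noncomputable def cap (x y : ℤ) (h : ℕ) : Finset Site :=
  {x - 1, y} ×ˢ Finset.Icc (1 : ℤ) h ∪ Finset.Ico x y ×ˢ {(h : ℤ) + 1}

theorem mem_cap {x y : ℤ} {h : ℕ} {u : Site} : u ∈ cap x y h ↔
    ((u.1 = x - 1 ∨ u.1 = y) ∧ 1 ≤ u.2 ∧ u.2 ≤ h) ∨ ((x ≤ u.1 ∧ u.1 < y) ∧ u.2 = h + 1) := by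
  rw [cap, Finset.mem_union, Finset.mem_product, Finset.mem_product, Finset.mem_insert,
    Finset.mem_singleton, Finset.mem_singleton, Finset.mem_Icc, Finset.mem_Ico]

theorem mem_cols {l : ℤ} {n h : ℕ} {u : Site} :
    u ∈ cols l n h ↔ (l < u.1 ∧ u.1 ≤ l + n) ∧ 1 ≤ u.2 ∧ u.2 ≤ h := by
  rw [cols, Finset.mem_product, Finset.mem_Ioc, Finset.mem_Icc]

theorem mem_axis {l : ℤ} {p : ℕ} {u : Site} : u ∈ axis l p ↔ (l < u.1 ∧ u.1 ≤ l + p) ∧ u.2 = 0 := by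
  rw [axis, Finset.mem_product, Finset.mem_Ioc, Finset.mem_singleton]

variable {s : ℝ}

/-- Replacing plus by minus on the boundary of the upper half of the rectangle costs at most a ratio
of two partition functions. -/
theorem Pr_cap_ge (hs : 0 < s) {a n h : ℕ} (ha : 1 ≤ a) (hh : 1 ≤ h) :
    Pr s (seg (-a) 0) (rect (-a) (a + n) h \ seg n (a + n)) (fun M => seg 0 n ⊆ M)
        * (stepZ h s a (a + n) / stepZ h s (a + n) a)
      ≤ Pr s (seg (-a) 0 ∪ cap (-a) (a + n) h)
          ((rect (-a) (a + n) h ∪ cap (-a) (a + n) h) \ seg n (a + n)) (fun M => seg 0 n ⊆ M) := by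
  classical
  set S := seg (-a) 0 with hS
  set J := seg 0 n with hJ
  set T := cap (-a) (a + n) h with hT
  obtain ⟨U, hU⟩ : ∃ U, U = cols (-a - 1) (a + (a + n)) h := ⟨_, rfl⟩
  obtain ⟨D, hD⟩ : ∃ D, D = U.map vref.toEmbedding := ⟨_, rfl⟩
  have mU : ∀ u : Site, u ∈ U ↔ (-(a : ℤ) ≤ u.1 ∧ u.1 < a + n) ∧ 1 ≤ u.2 ∧ u.2 ≤ h := by
    intro u; rw [hU, mem_cols]; push_cast; omega
  have mD : ∀ u : Site, u ∈ D ↔ (-(a : ℤ) ≤ u.1 ∧ u.1 < a + n) ∧ -(h : ℤ) ≤ u.2 ∧ u.2 ≤ -1 := by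
    intro u; rw [hD, Finset.mem_map_equiv, mU]; simp only [vref_symm_apply]; omega
  have mS : ∀ u : Site, u ∈ S ↔ (-(a : ℤ) ≤ u.1 ∧ u.1 < 0) ∧ u.2 = 0 := fun u => mem_seg
  have mJ : ∀ u : Site, u ∈ J ↔ (0 ≤ u.1 ∧ u.1 < n) ∧ u.2 = 0 := fun u => mem_seg
  have mT : ∀ u : Site, u ∈ T ↔ ((u.1 = -a - 1 ∨ u.1 = a + n) ∧ 1 ≤ u.2 ∧ u.2 ≤ h)
      ∨ ((-(a : ℤ) ≤ u.1 ∧ u.1 < a + n) ∧ u.2 = h + 1) := fun u => mem_cap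
  have hUD : Disjoint U D := Finset.disjoint_left.2 fun u h1 h2 => by rw [mU] at h1; rw [mD] at h2; omega
  have hUDJ : Disjoint (U ∪ D) J := Finset.disjoint_left.2 fun u h1 h2 => by
    rw [Finset.mem_union, mU, mD] at h1; rw [mJ] at h2; omega
  have hadj : ∀ x ∈ U, ∀ y ∈ nbrs x, y ∉ D := by
    intro x hx y hy hyD
    rw [mU] at hx; rw [mD] at hyD; rw [mem_nbrs, Prod.ext_iff, Prod.ext_iff, Prod.ext_iff,
      Prod.ext_iff] at hy
    simp only at hy
    omega
  have hSd : Disjoint S ((U ∪ D) ∪ J) := Finset.disjoint_left.2 fun u h1 h2 => by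
    rw [Finset.mem_union, Finset.mem_union, mU, mD, mJ] at h2; rw [mS] at h1; omega
  have hSTd : Disjoint (S ∪ T) ((U ∪ D) ∪ J) := Finset.disjoint_left.2 fun u h1 h2 => by
    rw [Finset.mem_union, Finset.mem_union, mU, mD, mJ] at h2
    rw [Finset.mem_union, mS, mT] at h1; omega
  have e1 : rect (-a) (a + n) h \ seg n (a + n) = S ∪ ((U ∪ D) ∪ J) := by
    ext u
    rw [Finset.mem_sdiff, mem_rect, mem_seg, Finset.mem_union, Finset.mem_union, Finset.mem_union,
      mU, mD, mJ, mS]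
    omega
  have e2 : (rect (-a) (a + n) h ∪ T) \ seg n (a + n) = (S ∪ T) ∪ ((U ∪ D) ∪ J) := by
    ext u
    rw [Finset.mem_sdiff, Finset.mem_union, mem_rect, mem_seg, Finset.mem_union, Finset.mem_union,
      Finset.mem_union, Finset.mem_union, mU, mD, mJ, mS, mT]
    omega
  rw [e1, e2, Pr_layers hs hUD hUDJ hadj hSd, Pr_layers hs hUD hUDJ hadj hSTd]
  -- the configuration of the layer after exchanging signs and reflecting
  obtain ⟨star, hstar⟩ : ∃ star : Finset Site → Finset Site,
    ∀ ξ, star ξ = (J \ ξ).map (href (n - 1)).toEmbedding := ⟨_, fun _ => rfl⟩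
  have mstar : ∀ ξ u, u ∈ star ξ ↔ (((0 : ℤ) ≤ u.1 ∧ u.1 < n) ∧ u.2 = 0) ∧ href (n - 1) u ∉ ξ := by
    intro ξ u
    rw [hstar, Finset.mem_map_equiv, Finset.mem_sdiff, mJ, href_symm_apply, href_apply]
    refine and_congr_left fun _ => ?_
    simp only
    omega
  have star_star : ∀ ξ ⊆ J, star (star ξ) = ξ := by
    intro ξ hξ
    ext u
    have h3 := fun h => (mJ u).1 (hξ h)
    rw [mstar, mstar]
    simp only [href_apply, not_and, not_not]
    rw [show (n : ℤ) - 1 - (n - 1 - u.1) = u.1 by ring]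
    constructor
    · rintro ⟨h1, h2⟩; exact h2 ⟨by omega, h1.2⟩
    · intro h; exact ⟨h3 h, fun _ => h⟩
  have star_sub : ∀ ξ, star ξ ⊆ J := fun ξ u hu => (mJ u).2 ((mstar ξ u).1 hu).1
  have star_J : star J = ∅ := by rw [hstar]; simp
  have hyD : ∀ ξ ⊆ J, ypart s D (S ∪ ξ) = ypart s U (S ∪ ξ) := by
    intro ξ hξ
    have : (S ∪ ξ) = (S ∪ ξ).map vref.toEmbedding := by
      ext u
      have h2 : ∀ u ∈ S ∪ ξ, u.2 = 0 := fun u hu => by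
        rcases Finset.mem_union.1 hu with h | h
        · exact ((mS u).1 h).2
        · exact ((mJ u).1 (hξ h)).2
      rw [Finset.mem_map_equiv, vref_symm_apply]
      constructor
      · intro hu
        have := h2 u hu
        rwa [show ((u.1, -u.2) : Site) = u from Prod.ext rfl (by simp only; omega)]
      · intro hu
        have := h2 _ hu
        rwa [show ((u.1, -u.2) : Site) = u from Prod.ext rfl (by simp only at this ⊢; omega)] at hu
    rw [this, hD, ypart_map _ nbrs_vref, ← this]
  have disj : ∀ ξ ⊆ J, Disjoint (S ∪ ξ) (U ∪ D) := fun ξ hξ => Finset.disjoint_left.2 fun u h1 h2 => by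
    have h3 : (-(a : ℤ) ≤ u.1 ∧ u.1 < n) ∧ u.2 = 0 := by
      rcases Finset.mem_union.1 h1 with h | h
      · rw [mS] at h; omega
      · have := (mJ u).1 (hξ h); omega
    rw [Finset.mem_union, mU, mD] at h2; omega
  have disj' : ∀ ξ ⊆ J, Disjoint (S ∪ T ∪ ξ) (U ∪ D) := fun ξ hξ =>
    Finset.disjoint_left.2 fun u h1 h2 => by
    rw [Finset.mem_union, mU, mD] at h2
    rcases Finset.mem_union.1 h1 with h | h
    · rw [Finset.mem_union, mS, mT] at h; omega
    · have := (mJ u).1 (hξ h); omega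
  have hyDT : ∀ ξ ⊆ J, ypart s D (S ∪ T ∪ ξ) = ypart s U (S ∪ ξ) := by
    intro ξ hξ
    rw [← hyD ξ hξ]
    refine ypart_congr ((disj' ξ hξ).mono_right Finset.subset_union_right)
      ((disj ξ hξ).mono_right Finset.subset_union_right) fun x hx y hy _ => ?_
    have : y ∉ T := by
      rw [mT]; rw [mD] at hx
      rw [mem_nbrs, Prod.ext_iff, Prod.ext_iff, Prod.ext_iff, Prod.ext_iff] at hy
      simp only at hy
      omega
    simp [this]
  have hyUT : ∀ ξ ⊆ J, ypart s U (S ∪ T ∪ ξ) = ypart s U (S ∪ star ξ) := by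
    intro ξ hξ
    have hUU : U = U.map (href (n - 1)).toEmbedding := by
      ext u; rw [Finset.mem_map_equiv, mU, mU, href_symm_apply]; simp only; omega
    have hm := ypart_map (s := s) (href (n - 1)) (nbrs_href _) U
      ((S ∪ star ξ).map (href (n - 1)).symm.toEmbedding)
    rw [← hUU] at hm
    have hmm : ((S ∪ star ξ).map (href (n - 1)).symm.toEmbedding).map (href (n - 1)).toEmbedding
        = S ∪ star ξ := by
      ext u; simp
    rw [hmm] at hm
    rw [hm]
    have mm : ∀ u : Site, u ∈ (S ∪ star ξ).map (href (n - 1)).symm.toEmbedding ↔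
        (((n : ℤ) ≤ u.1 ∧ u.1 < n + a) ∧ u.2 = 0) ∨ ((((0 : ℤ) ≤ u.1 ∧ u.1 < n) ∧ u.2 = 0) ∧ u ∉ ξ) := by
      intro u
      rw [Finset.mem_map_equiv, Equiv.symm_symm, Finset.mem_union, mS, mstar]
      simp only [href_apply]
      rw [show ((n : ℤ) - 1 - (n - 1 - u.1), u.2) = u from Prod.ext (by simp) rfl]
      refine or_congr (by omega) (and_congr_left fun _ => by omega)
    refine ypart_flip ((disj' ξ hξ).mono_right Finset.subset_union_left) ?_ fun x hx y hy hyU => ?_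
    · refine Finset.disjoint_left.2 fun u h1 h2 => ?_
      rw [mm] at h1; rw [mU] at h2; omega
    · have := fun h => (mJ y).1 (hξ h)
      rw [mm, Finset.mem_union, Finset.mem_union, mS, mT]
      rw [mU] at hx hyU
      rw [mem_nbrs, Prod.ext_iff, Prod.ext_iff, Prod.ext_iff, Prod.ext_iff] at hy
      simp only at hy
      by_cases hyξ : y ∈ ξ
      · have := this hyξ
        simp only [hyξ, not_true_eq_false, or_true, and_false, or_false, true_iff]
        omega
      · simp only [hyξ, not_false_eq_true, or_false, and_true]
        omega
  have hnb : ∀ x ∈ J, nbrs x \ (U ∪ D) = {(x.1 + 1, x.2), (x.1 - 1, x.2)} := by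
    intro x hx
    rw [mJ] at hx
    ext u
    rw [Finset.mem_sdiff, Finset.mem_union, mU, mD, mem_nbrs, Finset.mem_insert,
      Finset.mem_singleton, Prod.ext_iff, Prod.ext_iff, Prod.ext_iff, Prod.ext_iff]
    simp only
    omega
  have hw : ∀ A, lineWeight s (U ∪ D) J A
      = s ^ energy (fun x : Site => {(x.1 + 1, x.2), (x.1 - 1, x.2)}) J (↑A : Set Site) := by
    intro A
    unfold lineWeight energy
    refine congrArg _ (Finset.sum_congr rfl fun x hx => ?_)
    simp only [hnb x hx]
  have hwT : ∀ ξ ⊆ J, lineWeight s (U ∪ D) J (S ∪ T ∪ ξ) = lineWeight s (U ∪ D) J (S ∪ ξ) := by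
    intro ξ hξ
    rw [hw, hw]
    refine congrArg _ (energy_congr _ (fun x hx => ?_) fun x hx y hy _ => ?_)
    · have : x ∉ T := by rw [mT]; rw [mJ] at hx; omega
      simp [this]
    · have : y ∉ T := by
        rw [mT]; rw [mJ] at hx
        rw [Finset.mem_insert, Finset.mem_singleton, Prod.ext_iff, Prod.ext_iff] at hy
        simp only at hy
        omega
      simp [this]
  have hwstar : ∀ ξ ⊆ J, lineWeight s (U ∪ D) J (S ∪ star ξ) = lineWeight s (U ∪ D) J (S ∪ ξ) := by
    intro ξ hξ
    rw [hw, hw]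
    have hJJ : J = J.map (href (n - 1)).toEmbedding := by
      ext u; rw [Finset.mem_map_equiv, mJ, mJ, href_symm_apply]; simp only; omega
    rw [← energy_compl _ _ (↑(S ∪ star ξ) : Set Site)]
    nth_rewrite 1 [hJJ]
    rw [energy_image (fun x : Site => {(x.1 + 1, x.2), (x.1 - 1, x.2)}) (href (n - 1))]
    · refine congrArg _ (energy_congr _ (fun x hx => ?_) fun x hx y hy hyJ => ?_)
      · rw [mJ] at hx
        simp only [Set.mem_preimage, Set.mem_compl_iff, Finset.mem_coe, Finset.mem_union, mS, mstar]
        simp only [href_apply]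
        rw [show ((n : ℤ) - 1 - (n - 1 - x.1), x.2) = x from Prod.ext (by simp) rfl]
        by_cases hyξ : x ∈ ξ
        · simp only [hyξ, not_true_eq_false, or_true, and_false, or_false, iff_true]; omega
        · simp only [hyξ, not_false_eq_true, or_false, and_true]; omega
      · have hyξ : y ∉ ξ := fun h => hyJ (hξ h)
        simp only [Set.mem_preimage, Set.mem_compl_iff, Finset.mem_coe, Finset.mem_union, mS, mstar]
        simp only [href_apply]
        rw [show ((n : ℤ) - 1 - (n - 1 - y.1), y.2) = y from Prod.ext (by simp) rfl]
        rw [Finset.mem_insert, Finset.mem_singleton, Prod.ext_iff, Prod.ext_iff] at hy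
        simp only at hy
        rw [mJ] at hyJ hx
        simp only [hyξ, not_false_eq_true, or_false, and_true]
        omega
    · intro x
      ext u
      simp only [Finset.mem_map_equiv, Finset.mem_insert, Finset.mem_singleton, Prod.ext_iff,
        href_apply, href_symm_apply]
      omega
  obtain ⟨w, hwd⟩ : ∃ w : Finset Site → ℝ, ∀ ξ, w ξ = lineWeight s (U ∪ D) J (S ∪ ξ) :=
    ⟨_, fun _ => rfl⟩
  obtain ⟨y, hyd⟩ : ∃ y : Finset Site → ℝ, ∀ ξ, y ξ = ypart s U (S ∪ ξ) := ⟨_, fun _ => rfl⟩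
  have wpos : ∀ ξ, 0 < w ξ := fun ξ => by rw [hwd]; exact pow_pos hs _
  have ypos : ∀ ξ, 0 < y ξ := fun ξ => by rw [hyd]; exact ypart_pos hs _ _
  have hsumA : ∑ ξ ∈ J.powerset, lineWeight s (U ∪ D) J (S ∪ ξ) * ypart s U (S ∪ ξ)
      * ypart s D (S ∪ ξ) = ∑ ξ ∈ J.powerset, w ξ * y ξ * y ξ :=
    Finset.sum_congr rfl fun ξ hξ => by rw [hyD ξ (Finset.mem_powerset.1 hξ), ← hwd, ← hyd]
  have hsumB : ∑ ξ ∈ J.powerset, lineWeight s (U ∪ D) J (S ∪ T ∪ ξ) * ypart s U (S ∪ T ∪ ξ)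
      * ypart s D (S ∪ T ∪ ξ) = ∑ ξ ∈ J.powerset, w ξ * y (star ξ) * y ξ :=
    Finset.sum_congr rfl fun ξ hξ => by
      rw [hyDT ξ (Finset.mem_powerset.1 hξ), hwT ξ (Finset.mem_powerset.1 hξ),
        hyUT ξ (Finset.mem_powerset.1 hξ), ← hwd, ← hyd, ← hyd]
  rw [hsumA, hsumB]
  rw [hyD J subset_rfl, hyDT J subset_rfl, hwT J subset_rfl, hyUT J subset_rfl, star_J, ← hwd, ← hyd,
    ← hyd]
  have y0 : y ∅ = s⁻¹ * stepZ h s a (a + n) := by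
    rw [hyd, ← ypart_cols hs.ne' hh (-a - 1) ha (a + n), hU]
    congr 1
    ext u
    rw [Finset.union_empty, mS, mem_axis]; omega
  have yn : y J = s⁻¹ * stepZ h s (a + n) a := by
    rw [hyd, ← ypart_cols hs.ne' hh (-a - 1) (by omega : 1 ≤ a + n) a, hU, add_comm (a + n) a]
    congr 1
    ext u
    rw [Finset.mem_union, mS, mJ, mem_axis]; push_cast; omega
  have hratio : stepZ h s a (a + n) / stepZ h s (a + n) a = y ∅ / y J := by
    rw [y0, yn, mul_div_mul_left _ _ (inv_ne_zero hs.ne')]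
  have hsum : ∑ ξ ∈ J.powerset, w ξ * y (star ξ) * y ξ ≤ ∑ ξ ∈ J.powerset, w ξ * y ξ * y ξ := by
    have hinv : ∑ ξ ∈ J.powerset, w ξ * y (star ξ) * y (star ξ)
        = ∑ ξ ∈ J.powerset, w ξ * y ξ * y ξ := by
      refine Finset.sum_bij' (fun ξ _ => star ξ) (fun ξ _ => star ξ)
        (fun ξ _ => Finset.mem_powerset.2 (star_sub ξ))
        (fun ξ _ => Finset.mem_powerset.2 (star_sub ξ))
        (fun ξ hξ => star_star ξ (Finset.mem_powerset.1 hξ))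
        (fun ξ hξ => star_star ξ (Finset.mem_powerset.1 hξ)) fun ξ hξ => ?_
      rw [hwd (star ξ), hwstar ξ (Finset.mem_powerset.1 hξ), ← hwd]
    have h2 : 2 * ∑ ξ ∈ J.powerset, w ξ * y (star ξ) * y ξ
        ≤ ∑ ξ ∈ J.powerset, w ξ * y (star ξ) * y (star ξ)
          + ∑ ξ ∈ J.powerset, w ξ * y ξ * y ξ := by
      rw [Finset.mul_sum, ← Finset.sum_add_distrib]
      refine Finset.sum_le_sum fun ξ _ => ?_
      nlinarith [mul_nonneg (wpos ξ).le (sq_nonneg (y (star ξ) - y ξ))]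
    linarith
  rw [hratio]
  have hpos : 0 < ∑ ξ ∈ J.powerset, w ξ * y (star ξ) * y ξ :=
    Finset.sum_pos (fun ξ _ => mul_pos (mul_pos (wpos _) (ypos _)) (ypos _)) ⟨∅, by simp⟩
  calc w J * y J * y J / (∑ ξ ∈ J.powerset, w ξ * y ξ * y ξ) * (y ∅ / y J)
      = w J * y ∅ * y J / ∑ ξ ∈ J.powerset, w ξ * y ξ * y ξ := by
        field_simp [(ypos J).ne']
    _ ≤ _ := by
        refine div_le_div_of_nonneg_left ?_ hpos hsum
        exact mul_nonneg (mul_nonneg (wpos _).le (ypos _).le) (ypos _).le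

end Reflection

section Constants

variable {s : ℝ}

theorem Pr_insert_superset (hs : 0 < s) {A J Λ : Finset Site} (h : A ∪ J ⊆ Λ) (x : Site) :
    Pr s A Λ (fun M => insert x J ⊆ M)
      = Pr s A Λ (fun M => J ⊆ M) * Pr s (A ∪ J) Λ (fun M => {x} ⊆ M) := by
  rw [Pr_superset, Pr_superset, Pr_superset, Finset.union_assoc, Finset.union_comm J {x},
    ← Finset.insert_eq]
  have h1 := (Zp_pos hs (Finset.subset_union_left.trans h : A ⊆ Λ)).ne'
  have h2 := (Zp_pos hs h).ne'
  field_simp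

/-- The probability that the site following a segment of minuses is minus. -/
noncomputable def nextMinus (s : ℝ) (a b h : ℕ) : ℝ :=
  Pr s (seg (-a) 0) (rect (-a) (b + 1) h) (fun M => {((0 : ℤ), (0 : ℤ))} ⊆ M)

theorem seg_trans (x y k : ℤ) : (seg x y).map (trans k).toEmbedding = seg (x + k) (y + k) := by
  ext u
  rw [Finset.mem_map_equiv, mem_seg, mem_seg]; simp only [trans_symm_apply]; omega

theorem rect_trans (x y k : ℤ) (h : ℕ) :
    (rect x y h).map (trans k).toEmbedding = rect (x + k) (y + k) h := by
  ext u
  rw [Finset.mem_map_equiv, mem_rect, mem_rect]; simp only [trans_symm_apply]; omega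

theorem seg_succ {x y : ℤ} (h : x ≤ y) : seg x (y + 1) = insert (y, 0) (seg x y) := by
  ext u
  rw [Finset.mem_insert, mem_seg, mem_seg, Prod.ext_iff]; simp only; omega

theorem seg_union {x y z : ℤ} (h : x ≤ y) (h' : y ≤ z) : seg x y ∪ seg y z = seg x z := by
  ext u
  rw [Finset.mem_union, mem_seg, mem_seg, mem_seg]; omega

theorem nextMinus_pos (hs : 0 < s) (a b h : ℕ) : 0 < nextMinus s a b h := by
  unfold nextMinus
  rw [Pr_superset]
  refine div_pos (Zp_pos hs ?_) (Zp_pos hs ?_)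
  · intro u hu
    rw [Finset.mem_union, Finset.mem_singleton, mem_seg, Prod.ext_iff] at hu
    rw [mem_rect]; simp only at hu; omega
  · intro u hu
    rw [mem_seg] at hu
    rw [mem_rect]; omega

theorem nextMinus_le_one (hs : 0 < s) (a b h : ℕ) : nextMinus s a b h ≤ 1 := Pr_le_one hs _ _ _

theorem Pr_seg_le (hs : 0 < s) {p : ℝ} (hp0 : 0 ≤ p) (hp : ∀ a b h, nextMinus s a b h ≤ p)
    (a N h : ℕ) (n : ℕ) (hn : n ≤ N) :
    Pr s (seg (-a) 0) (rect (-a) N h) (fun M => seg 0 n ⊆ M) ≤ p ^ n := by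
  induction n with
  | zero => rw [pow_zero]; exact Pr_le_one hs _ _ _
  | succ n ih =>
    have hn' := ih (by omega)
    push_cast
    rw [seg_succ (by omega)]
    rw [Pr_insert_superset hs, pow_succ]
    · refine mul_le_mul hn' ?_ (Pr_nonneg hs _ _ _) (pow_nonneg hp0 _)
      rw [seg_union (by omega) (by omega)]
      refine le_of_eq_of_le ?_ (hp (a + n) (N - n - 1) h)
      unfold nextMinus
      have e1 : seg (-a) n = (seg (-(a + n : ℕ)) 0).map (trans n).toEmbedding := by
        rw [seg_trans]; congr 1 <;> push_cast <;> ring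
      have e2 : rect (-a) N h
          = (rect (-(a + n : ℕ)) ((N - n - 1 : ℕ) + 1) h).map (trans n).toEmbedding := by
        rw [rect_trans]; congr 1 <;> omega
      rw [e1, e2, Pr_map _ (nbrs_trans _)]
      refine Pr_congr fun M _ _ => ?_
      rw [Finset.singleton_subset_iff, Finset.singleton_subset_iff, Finset.mem_map_equiv]
      simp
    · intro u hu
      rw [Finset.mem_union, mem_seg, mem_seg] at hu
      rw [mem_rect]; omega

theorem Pr_singleton_ge (hs : 0 < s) (hs1 : s ≤ 1) {A Λ : Finset Site} {x : Site} (hx : x ∈ Λ)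
    (hA : A ⊆ Λ) : (1 + (s ^ 8)⁻¹)⁻¹ ≤ Pr s A Λ (fun M => {x} ⊆ M) := by
  have h8 : 0 < 1 + (s ^ 8)⁻¹ := by positivity
  rw [Pr_superset, Finset.union_comm, ← Finset.insert_eq, le_div_iff₀ (Zp_pos hs hA),
    inv_mul_le_iff₀ h8]
  exact Zp_insert_ge hs hs1 hx

theorem Pr_seg_ge (hs : 0 < s) (hs1 : s ≤ 1) {a₀ b₀ h₀ a h N : ℕ} (ha : a₀ ≤ a) (hh : h₀ ≤ h)
    (n : ℕ) (hn : n ≤ N) :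
    nextMinus s a₀ b₀ h₀ ^ n * ((1 + (s ^ 8)⁻¹)⁻¹) ^ (n + b₀ + 1 - N)
      ≤ Pr s (seg (-a) 0) (rect (-a) (a + N) h \ seg N (a + N)) (fun M => seg 0 n ⊆ M) := by
  have hk0 : 0 < (1 + (s ^ 8)⁻¹)⁻¹ := by positivity
  have hk1 : (1 + (s ^ 8)⁻¹)⁻¹ ≤ 1 := inv_le_one_of_one_le₀ (by
    have : 0 < (s ^ 8)⁻¹ := by positivity
    linarith)
  have hsub : ∀ n : ℕ, n ≤ N →
      seg (-a) 0 ∪ seg 0 n ⊆ rect (-a) (a + N) h \ seg N (a + N) := by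
    intro n hn u hu
    rw [Finset.mem_union, mem_seg, mem_seg] at hu
    rw [Finset.mem_sdiff, mem_rect, mem_seg]; omega
  induction n with
  | zero =>
    have : Pr s (seg (-a) 0) (rect (-a) (a + N) h \ seg N (a + N)) (fun M => seg 0 (0 : ℕ) ⊆ M)
        = 1 := by
      have h0 : seg 0 ((0 : ℕ) : ℤ) = ∅ := by
        ext u; rw [mem_seg]; simp
      rw [h0, Pr_superset, Finset.union_empty]
      exact div_self (Zp_pos hs (Finset.subset_union_left.trans (hsub 0 (by omega)))).ne'
    rw [this, pow_zero, one_mul]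
    exact pow_le_one₀ hk0.le hk1
  | succ n ih =>
    have ih' := ih (by omega)
    have hr0 := nextMinus_pos hs a₀ b₀ h₀
    have hr1 := nextMinus_le_one hs a₀ b₀ h₀
    push_cast
    rw [seg_succ (by omega), Pr_insert_superset hs (hsub n (by omega))]
    rw [seg_union (by omega) (by omega)]
    have hA := hsub n (by omega)
    rw [seg_union (by omega) (by omega)] at hA
    have hmem : ((n : ℤ), (0 : ℤ)) ∈ rect (-a) (a + N) h \ seg N (a + N) := by
      rw [Finset.mem_sdiff, mem_rect, mem_seg]; simp only; omega
    have hfac := Pr_singleton_ge hs hs1 hmem hA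
    by_cases hcase : n + b₀ + 1 ≤ N
    · have hle : nextMinus s a₀ b₀ h₀ ≤ Pr s (seg (-a) n) (rect (-a) (a + N) h \ seg N (a + N))
          (fun M => {((n : ℤ), (0 : ℤ))} ⊆ M) := by
        have e0 : nextMinus s a₀ b₀ h₀ = Pr s (seg (-a₀ + n) (0 + n))
            (rect (-a₀ + n) (b₀ + 1 + n) h₀) (fun M => {((n : ℤ), (0 : ℤ))} ⊆ M) := by
          rw [← seg_trans, ← rect_trans, Pr_map _ (nbrs_trans _)]
          refine Pr_congr fun M _ _ => ?_
          rw [Finset.singleton_subset_iff, Finset.singleton_subset_iff, Finset.mem_map_equiv]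
          simp
        rw [e0]
        refine Pr_mono hs hs1 ?_ ?_ hA ?_ fun M N h1 h2 => h2.trans h1
        · intro u hu; rw [mem_seg] at hu; rw [mem_rect]; omega
        · intro u hu; rw [mem_seg] at hu ⊢; omega
        · intro u hu; rw [mem_rect] at hu; rw [Finset.mem_sdiff, mem_rect, mem_seg]; omega
      have e1 : n + b₀ + 1 - N = 0 := by omega
      rw [e1, pow_zero, mul_one] at ih'
      calc _ ≤ nextMinus s a₀ b₀ h₀ ^ (n + 1) * 1 :=
            mul_le_mul_of_nonneg_left (pow_le_one₀ hk0.le hk1) (pow_nonneg hr0.le _)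
        _ = nextMinus s a₀ b₀ h₀ ^ n * nextMinus s a₀ b₀ h₀ := by rw [mul_one, pow_succ]
        _ ≤ _ := mul_le_mul ih' hle hr0.le (Pr_nonneg hs _ _ _)
    · have e1 : n + 1 + b₀ + 1 - N = (n + b₀ + 1 - N) + 1 := by omega
      rw [e1]
      calc _ = nextMinus s a₀ b₀ h₀ * (nextMinus s a₀ b₀ h₀ ^ n *
              ((1 + (s ^ 8)⁻¹)⁻¹) ^ (n + b₀ + 1 - N) * (1 + (s ^ 8)⁻¹)⁻¹) := by ring
        _ ≤ 1 * (nextMinus s a₀ b₀ h₀ ^ n *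
              ((1 + (s ^ 8)⁻¹)⁻¹) ^ (n + b₀ + 1 - N) * (1 + (s ^ 8)⁻¹)⁻¹) :=
            mul_le_mul_of_nonneg_right hr1 (by positivity)
        _ ≤ _ := by
            rw [one_mul]
            exact mul_le_mul ih' hfac hk0.le (Pr_nonneg hs _ _ _)

/-- Up to an exponentially small factor, a minus boundary condition on the upper half of a rectangle
with a large plus segment is at least as favourable to minuses as a plus boundary condition. -/
theorem exists_key_bound (hs : 0 < s) (ht : s ^ 2 < 1)
    (hq : s ^ 2 < (1 - s ^ 2) / (1 + s ^ 2)) :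
    ∃ (C θ : ℝ) (h₀ : ℕ), 0 < C ∧ 0 < θ ∧ θ < 1 ∧ 1 ≤ h₀ ∧ ∀ n h : ℕ, h₀ ≤ h → ∀ᶠ a : ℕ in atTop,
      Pr s (seg (-a) 0) (rect (-a) (a + n) h) (fun M => seg 0 n ⊆ M)
        ≤ C * θ ^ n * Pr s (seg (-a) 0 ∪ cap (-a) (a + n) h)
          ((rect (-a) (a + n) h ∪ cap (-a) (a + n) h) \ seg n (a + n)) (fun M => seg 0 n ⊆ M) := by
  have hs1 : s ≤ 1 := by nlinarith
  set q := s ^ 2 / ((1 - s ^ 2) / (1 + s ^ 2)) with hqd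
  have hs2 : 0 < s ^ 2 := by positivity
  have hq0 : 0 < q := div_pos hs2 (hs2.trans hq)
  have hq1 : q < 1 := (div_lt_one (hs2.trans hq)).2 hq
  have hsq0 : 0 < Real.sqrt q := Real.sqrt_pos.2 hq0
  have hsq1 : Real.sqrt q < 1 := by
    rw [Real.sqrt_lt' one_pos]; simpa using hq1
  obtain ⟨p, hp⟩ : ∃ p, IsLUB (Set.range fun x : ℕ × ℕ × ℕ => nextMinus s x.1 x.2.1 x.2.2) p :=
    Real.exists_isLUB ⟨_, Set.mem_range_self (0, 0, 0)⟩ ⟨1, by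
      rintro _ ⟨x, rfl⟩; exact nextMinus_le_one hs _ _ _⟩
  have hple : ∀ a b h, nextMinus s a b h ≤ p := fun a b h => hp.1 (Set.mem_range_self (a, b, h))
  have hp0 : 0 < p := (nextMinus_pos hs 0 0 0).trans_le (hple 0 0 0)
  obtain ⟨_, ⟨⟨a₀, b₀, h₀⟩, rfl⟩, hlt, -⟩ :=
    hp.exists_between (show p * Real.sqrt q < p by nlinarith)
  simp only at hlt
  set r := nextMinus s a₀ b₀ h₀ with hr
  have hr0 : 0 < r := nextMinus_pos hs _ _ _
  set κ := (1 + (s ^ 8)⁻¹)⁻¹ with hκ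
  have hκ0 : 0 < κ := by positivity
  choose ρ hρ0 hρq hρ using fun h => exists_stepZ_ratio (h := h) hs ht hq
  refine ⟨2 / κ ^ (b₀ + 1), Real.sqrt q, max h₀ 1, by positivity, hsq0, hsq1, le_max_right _ _,
    fun n h hh => ?_⟩
  have hlim := hρ h n
  have hlt2 : ρ h ^ n < 2 * q ^ n := by
    have : ρ h ^ n ≤ q ^ n := pow_le_pow_left₀ (hρ0 h).le (hρq h) n
    have : 0 < q ^ n := by positivity
    linarith
  filter_upwards [hlim.eventually_lt_const hlt2, eventually_ge_atTop (max a₀ 1)] with a hy ha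
  have ha0 : a₀ ≤ a := (le_max_left _ _).trans ha
  have ha1 : 1 ≤ a := (le_max_right _ _).trans ha
  have hh0 : h₀ ≤ h := (le_max_left _ _).trans hh
  have hh1 : 1 ≤ h := (le_max_right _ _).trans hh
  have hcap := Pr_cap_ge (n := n) hs ha1 hh1
  have hge := Pr_seg_ge (b₀ := b₀) (N := n) hs hs1 ha0 hh0 n le_rfl
  have hle := Pr_seg_le hs hp0.le hple a (a + n) h n (by omega)
  push_cast at hle
  refine hle.trans ?_
  set B := Pr s (seg (-a) 0 ∪ cap (-a) (a + n) h)
    ((rect (-a) (a + n) h ∪ cap (-a) (a + n) h) \ seg n (a + n)) (fun M => seg 0 n ⊆ M)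
  have hexp : n + b₀ + 1 - n = b₀ + 1 := by omega
  rw [hexp, ← hr, ← hκ] at hge
  have hx : 0 < stepZ h s a (a + n) := by
    have h1 := ypart_pos hs (cols 0 (a + (a + n)) h) (axis 0 a)
    rw [ypart_cols hs.ne' hh1 0 ha1 (a + n)] at h1
    exact (pos_iff_pos_of_mul_pos h1).1 (by positivity)
  have hy0 : 0 < stepZ h s (a + n) a := by
    have h1 := ypart_pos hs (cols 0 (a + n + a) h) (axis 0 (a + n))
    rw [ypart_cols hs.ne' hh1 0 (by omega : 1 ≤ a + n) a] at h1
    exact (pos_iff_pos_of_mul_pos h1).1 (by positivity)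
  have hB : 0 ≤ B := Pr_nonneg hs _ _ _
  rw [div_lt_iff₀ hx] at hy
  rw [mul_div_assoc', div_le_iff₀ hy0] at hcap
  set b := Pr s (seg (-a) 0) (rect (-a) (a + n) h \ seg n (a + n)) (fun M => seg 0 n ⊆ M)
  have h1 : b ≤ 2 * q ^ n * B := by
    refine le_of_mul_le_mul_right ?_ hx
    calc b * stepZ h s a (a + n) ≤ B * stepZ h s (a + n) a := hcap
      _ ≤ B * (2 * q ^ n * stepZ h s a (a + n)) := mul_le_mul_of_nonneg_left hy.le hB
      _ = _ := by ring
  have h2 : (p * Real.sqrt q) ^ n ≤ r ^ n := pow_le_pow_left₀ (by positivity) hlt.le n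
  have h3 : q ^ n = Real.sqrt q ^ n * Real.sqrt q ^ n := by
    rw [← mul_pow, Real.mul_self_sqrt hq0.le]
  rw [h3] at h1
  rw [mul_pow] at h2
  have hsn : 0 < Real.sqrt q ^ n := by positivity
  have hK : 0 < κ ^ (b₀ + 1) := by positivity
  rw [div_mul_eq_mul_div, div_mul_eq_mul_div, le_div_iff₀ hK]
  refine le_of_mul_le_mul_right ?_ hsn
  nlinarith [mul_le_mul_of_nonneg_right h2 hK.le]

end Constants

section Exploration

/-- `Conn H R M x`: there is a path in `H` from `x` to a site outside `R`, all of whose sites but the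
last avoid the set `M` of minuses. -/
inductive Conn (H : Set Site) (R M : Finset Site) : Site → Prop
  | out {x : Site} (hx : x ∈ H) (hR : x ∉ R) : Conn H R M x
  | step {x y : Site} (hx : x ∈ H) (hM : x ∉ M) (hy : y ∈ nbrs x) (h : Conn H R M y) : Conn H R M x

variable {H H' : Set Site} {R R' M M' A : Finset Site} {s : ℝ}

theorem Conn.mono (hH : H ⊆ H') (hR : R' ⊆ R) (hM : M' ⊆ M) {x : Site} (h : Conn H R M x) :
    Conn H' R' M' x := by
  induction h with
  | out hx hR' => exact .out (hH hx) fun h => hR' (hR h)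
  | step hx hM' hy _ ih => exact .step (hH hx) (fun h => hM' (hM h)) hy ih

theorem Conn.mem {x : Site} (h : Conn H R M x) : x ∈ H := by
  cases h <;> assumption

theorem Conn.notMem {x : Site} (h : Conn H R M x) (hMR : M ⊆ R) : x ∉ M := by
  cases h with
  | out _ h => exact fun hx => h (hMR hx)
  | step _ h _ _ => exact h

open Classical in
/-- The sites of `R` connected in `H` by pluses to the outside of `R`. -/
noncomputable def cluster (H : Set Site) (R M : Finset Site) : Finset Site :=
  R.filter (Conn H R M)

theorem mem_cluster {x : Site} : x ∈ cluster H R M ↔ x ∈ R ∧ Conn H R M x := by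
  classical
  simp [cluster]

open Classical in
/-- The sites of `R` in `H` outside `C` and adjacent to `C` or, inside `H`, to the outside of `R`. -/
noncomputable def bdry (H : Set Site) (R C : Finset Site) : Finset Site :=
  R.filter fun x => x ∈ H ∧ x ∉ C ∧ ∃ y ∈ nbrs x, y ∈ C ∨ (y ∈ H ∧ y ∉ R)

theorem mem_bdry {C : Finset Site} {x : Site} : x ∈ bdry H R C ↔
    x ∈ R ∧ x ∈ H ∧ x ∉ C ∧ ∃ y ∈ nbrs x, y ∈ C ∨ (y ∈ H ∧ y ∉ R) := by
  classical
  simp [bdry]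

theorem bdry_cluster_subset : bdry H R (cluster H R M) ⊆ M := by
  intro x hx
  rw [mem_bdry] at hx
  obtain ⟨hR, hH, hC, y, hy, h⟩ := hx
  by_contra hM
  refine hC (mem_cluster.2 ⟨hR, ?_⟩)
  rcases h with h | h
  · exact .step hH hM hy (mem_cluster.1 h).2
  · exact .step hH hM hy (.out h.1 h.2)

theorem disjoint_cluster (hM : M ⊆ R) : Disjoint M (cluster H R M) :=
  Finset.disjoint_left.2 fun _ h1 h2 => (mem_cluster.1 h2).2.notMem hM h1

theorem cluster_eq_iff {M₀ : Finset Site} (hM : M ⊆ R) :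
    cluster H R M = cluster H R M₀ ↔
      bdry H R (cluster H R M₀) ⊆ M ∧ M ⊆ R \ cluster H R M₀ := by
  constructor
  · intro h
    rw [← h]
    exact ⟨bdry_cluster_subset, fun x hx => Finset.mem_sdiff.2
      ⟨hM hx, Finset.disjoint_left.1 (disjoint_cluster hM) hx⟩⟩
  · rintro ⟨h1, h2⟩
    ext x
    constructor
    · intro hx
      rw [mem_cluster] at hx
      obtain ⟨hR, hx⟩ := hx
      revert hR
      induction hx with
      | out _ h => exact fun h' => absurd h' h
      | @step x y hH hxM hy hc ih =>
        intro hR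
        by_contra hC
        refine hxM (h1 (mem_bdry.2 ⟨hR, hH, hC, y, hy, ?_⟩))
        by_cases hyR : y ∈ R
        · exact .inl (ih hyR)
        · exact .inr ⟨hc.mem, hyR⟩
    · intro hx
      have hR := (mem_cluster.1 hx).1
      refine mem_cluster.2 ⟨hR, ?_⟩
      have key : ∀ x, Conn H R M₀ x → Conn H R M x := by
        intro x hx
        induction hx with
        | out h h' => exact .out h h'
        | @step x y hH hxM hy hc ih =>
          by_cases hxR : x ∈ R
          · refine .step hH (fun hxM' => ?_) hy ih
            exact (Finset.mem_sdiff.1 (h2 hxM')).2 (mem_cluster.2 ⟨hxR, .step hH hxM hy hc⟩)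
          · exact .out hH hxR
      exact key x (mem_cluster.1 hx).2

/-- A lower bound for the probability of an event given the explored cluster. -/
theorem Pr_explore_ge (hs : 0 < s) (hA : A ⊆ R) (Q F : Finset Site → Prop) {B : ℝ}
    (h : ∀ M₀, A ⊆ M₀ → M₀ ⊆ R → Q (cluster H R M₀) →
      B ≤ Pr s (A ∪ bdry H R (cluster H R M₀)) (R \ cluster H R M₀) F) :
    B * Pr s A R (fun M => Q (cluster H R M)) ≤ Pr s A R F := by
  classical
  have hZ := Zp_pos hs hA
  unfold Pr
  rw [mul_div_assoc', div_le_div_iff_of_pos_right hZ]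
  trans Wev s A R (fun M => Q (cluster H R M) ∧ F M)
  swap
  · exact Wev_mono_event hs fun _ _ _ h => h.2
  unfold Wev
  have hmaps : ∀ M ∈ Finset.Icc A R, cluster H R M ∈ R.powerset := fun M _ =>
    Finset.mem_powerset.2 fun x hx => (mem_cluster.1 hx).1
  rw [← Finset.sum_fiberwise_of_maps_to hmaps,
    ← Finset.sum_fiberwise_of_maps_to (t := R.powerset) hmaps, Finset.mul_sum]
  refine Finset.sum_le_sum fun C _ => ?_
  by_cases hne : ∃ M₀ ∈ Finset.Icc A R, cluster H R M₀ = C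
  swap
  · have : (Finset.Icc A R).filter (fun M => cluster H R M = C) = ∅ :=
      Finset.filter_eq_empty_iff.2 fun M hM h => hne ⟨M, hM, h⟩
    rw [this]; simp
  obtain ⟨M₀, hM₀, rfl⟩ := hne
  rw [Finset.mem_Icc] at hM₀
  by_cases hQ : Q (cluster H R M₀)
  swap
  · rw [Finset.sum_eq_zero, Finset.sum_eq_zero, mul_zero]
    · intro M hM; rw [Finset.mem_filter] at hM; exact if_neg fun h => hQ (hM.2 ▸ h.1)
    · intro M hM; rw [Finset.mem_filter] at hM; exact if_neg fun h => hQ (hM.2 ▸ h)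
  have hfil : (Finset.Icc A R).filter (fun M => cluster H R M = cluster H R M₀)
      = Finset.Icc (A ∪ bdry H R (cluster H R M₀)) (R \ cluster H R M₀) := by
    ext M
    rw [Finset.mem_filter, Finset.mem_Icc, Finset.mem_Icc]
    constructor
    · rintro ⟨⟨h1, h2⟩, h3⟩
      rw [cluster_eq_iff h2] at h3
      exact ⟨Finset.union_subset h1 h3.1, h3.2⟩
    · rintro ⟨h1, h2⟩
      have hMR : M ⊆ R := h2.trans Finset.sdiff_subset
      exact ⟨⟨Finset.subset_union_left.trans h1, hMR⟩,
        (cluster_eq_iff hMR).2 ⟨Finset.subset_union_right.trans h1, h2⟩⟩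
  have hsub : A ∪ bdry H R (cluster H R M₀) ⊆ R \ cluster H R M₀ := by
    have := (Finset.mem_Icc.1 (hfil ▸ Finset.mem_filter.2 ⟨Finset.mem_Icc.2 hM₀, rfl⟩ :
      M₀ ∈ Finset.Icc (A ∪ bdry H R (cluster H R M₀)) (R \ cluster H R M₀)))
    exact this.1.trans this.2
  have hB := h M₀ hM₀.1 hM₀.2 hQ
  unfold Pr at hB
  rw [le_div_iff₀ (Zp_pos hs hsub)] at hB
  calc _ = B * Zp s (A ∪ bdry H R (cluster H R M₀)) (R \ cluster H R M₀) := by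
        unfold Zp
        rw [← hfil]
        congr 1
        refine Finset.sum_congr rfl fun M hM => ?_
        rw [Finset.mem_filter] at hM
        exact if_pos (show Q (cluster H R M) by rw [hM.2]; exact hQ)
    _ ≤ _ := hB
    _ = _ := by
        unfold Wev
        rw [← hfil]
        refine Finset.sum_congr rfl fun M hM => ?_
        rw [Finset.mem_filter] at hM
        by_cases hF : F M
        · rw [if_pos hF, if_pos ⟨hM.2 ▸ hQ, hF⟩]
        · rw [if_neg hF, if_neg fun h => hF h.2]

/-- The upper half-plane. -/
def upper : Set Site := {x | 0 ≤ x.2}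

theorem mem_upper {x : Site} : x ∈ upper ↔ 0 ≤ x.2 := Iff.rfl

/-- No site of the segment is connected in `H` by pluses to the outside of `R`. -/
def NoConn (H : Set Site) (R : Finset Site) (x y : ℤ) (M : Finset Site) : Prop :=
  ∀ i, x ≤ i → i < y → ¬ Conn H R M (i, 0)

theorem NoConn.mono {x y : ℤ} (hH : H' ⊆ H) (hR : R ⊆ R') (hM : M ⊆ M') (h : NoConn H R x y M) :
    NoConn H' R' x y M' := fun i h1 h2 h3 => h i h1 h2 (h3.mono hH hR hM)

theorem Pr_noConn_upper_mul_le (hs : 0 < s) (hs1 : s ≤ 1) {a n h : ℕ} :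
    Pr s (seg (-a) 0 ∪ cap (-a) (a + n) h)
        ((rect (-a) (a + n) h ∪ cap (-a) (a + n) h) \ seg n (a + n)) (fun M => seg 0 n ⊆ M)
      * Pr s (seg (-a) 0) (rect (-a) (a + n) h)
        (NoConn upper (rect (-a) (a + n) h) 0 n)
      ≤ Pr s (seg (-a) 0) (rect (-a) (a + n) h) (fun M => seg 0 n ⊆ M) := by
  classical
  obtain ⟨R, hR⟩ : ∃ R, R = rect (-a) (a + n) h := ⟨_, rfl⟩
  obtain ⟨S, hS⟩ : ∃ S, S = seg (-a) 0 := ⟨_, rfl⟩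
  obtain ⟨J, hJ⟩ : ∃ J, J = seg 0 n := ⟨_, rfl⟩
  obtain ⟨N, hN⟩ : ∃ N, N = seg n (a + n) := ⟨_, rfl⟩
  obtain ⟨T, hT⟩ : ∃ T, T = cap (-a) (a + n) h := ⟨_, rfl⟩
  rw [← hR, ← hS, ← hJ, ← hN, ← hT]
  have mR : ∀ u : Site, u ∈ R ↔ (-(a : ℤ) ≤ u.1 ∧ u.1 < a + n) ∧ -(h : ℤ) ≤ u.2 ∧ u.2 ≤ h :=
    fun u => by rw [hR, mem_rect]
  have mS : ∀ u : Site, u ∈ S ↔ (-(a : ℤ) ≤ u.1 ∧ u.1 < 0) ∧ u.2 = 0 := fun u => by rw [hS, mem_seg]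
  have mJ : ∀ u : Site, u ∈ J ↔ (0 ≤ u.1 ∧ u.1 < n) ∧ u.2 = 0 := fun u => by rw [hJ, mem_seg]
  have mN : ∀ u : Site, u ∈ N ↔ ((n : ℤ) ≤ u.1 ∧ u.1 < a + n) ∧ u.2 = 0 := fun u => by
    rw [hN, mem_seg]
  have mT : ∀ u : Site, u ∈ T ↔ ((u.1 = -a - 1 ∨ u.1 = a + n) ∧ 1 ≤ u.2 ∧ u.2 ≤ h)
      ∨ ((-(a : ℤ) ≤ u.1 ∧ u.1 < a + n) ∧ u.2 = h + 1) := fun u => by rw [hT, mem_cap]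
  have hSR : S ⊆ R := fun u hu => by rw [mS] at hu; rw [mR]; omega
  have hTR : ∀ u ∈ T, u ∉ R := fun u hu => by rw [mT] at hu; rw [mR]; omega
  have hJR : J ⊆ R := fun u hu => by rw [mJ] at hu; rw [mR]; omega
  have hQ : Pr s S R (NoConn upper R 0 n) = Pr s S R (fun M => Disjoint J (cluster upper R M)) := by
    refine Pr_congr fun M _ _ => ?_
    rw [Finset.disjoint_left]
    constructor
    · intro hE u hu huc
      refine hE u.1 ((mJ u).1 hu).1.1 ((mJ u).1 hu).1.2 ?_
      rw [show (u.1, (0 : ℤ)) = u from Prod.ext rfl ((mJ u).1 hu).2.symm]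
      exact (mem_cluster.1 huc).2
    · intro hD i h1 h2 hc
      have hiJ : ((i, 0) : Site) ∈ J := (mJ _).2 ⟨⟨h1, h2⟩, rfl⟩
      exact hD hiJ (mem_cluster.2 ⟨hJR hiJ, hc⟩)
  rw [hQ]
  refine Pr_explore_ge hs hSR (fun C => Disjoint J C) _ fun M₀ hSM hMR hJC => ?_
  obtain ⟨C, hC⟩ : ∃ C, C = cluster upper R M₀ := ⟨_, rfl⟩
  rw [← hC] at hJC ⊢
  obtain ⟨K, hK⟩ : ∃ K, K = bdry upper R C := ⟨_, rfl⟩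
  rw [← hK]
  have hCR : ∀ u ∈ C, u ∈ R ∧ 0 ≤ u.2 := fun u hu => by
    rw [hC, mem_cluster] at hu; exact ⟨hu.1, hu.2.mem⟩
  have hCS : ∀ u ∈ C, u ∉ S := fun u hu huS => by
    have := disjoint_cluster (H := upper) hMR
    rw [← hC] at this
    exact Finset.disjoint_left.1 this (hSM huS) hu
  have hCJ : ∀ u ∈ C, u ∉ J := fun u hu huJ => Finset.disjoint_left.1 hJC huJ hu
  have hKC : ∀ u ∈ K, u ∈ R ∧ u ∉ C := fun u hu => by
    rw [hK, mem_bdry] at hu; exact ⟨hu.1, hu.2.2.1⟩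
  obtain ⟨C', hC'⟩ : ∃ C', C' = C.filter (fun u => 1 ≤ u.2) := ⟨_, rfl⟩
  have mC' : ∀ u, u ∈ C' ↔ u ∈ C ∧ 1 ≤ u.2 := fun u => by rw [hC', Finset.mem_filter]
  -- frozen pluses on the axis
  have step1 : Pr s (S ∪ K) ((R \ C) \ (N \ K)) (fun M => J ⊆ M)
      ≤ Pr s (S ∪ K) (R \ C) (fun M => J ⊆ M) := by
    have hsub : S ∪ K ⊆ (R \ C) \ (N \ K) := by
      intro u hu
      rw [Finset.mem_sdiff, Finset.mem_sdiff, Finset.mem_sdiff]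
      rcases Finset.mem_union.1 hu with h | h
      · refine ⟨⟨hSR h, fun h' => hCS u h' h⟩, fun h' => ?_⟩
        have := h'.1
        rw [mN] at this; rw [mS] at h; omega
      · exact ⟨hKC u h, fun h' => h'.2 h⟩
    exact Pr_mono hs hs1 hsub subset_rfl (hsub.trans Finset.sdiff_subset) Finset.sdiff_subset
      fun M M' h1 h2 => h2.trans h1
  refine le_trans ?_ step1
  have hsub : S ∪ K ⊆ (R \ C) \ (N \ K) := by
    intro u hu
    rw [Finset.mem_sdiff, Finset.mem_sdiff, Finset.mem_sdiff]
    rcases Finset.mem_union.1 hu with h | h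
    · refine ⟨⟨hSR h, fun h' => hCS u h' h⟩, fun h' => ?_⟩
      have := h'.1
      rw [mN] at this; rw [mS] at h; omega
    · exact ⟨hKC u h, fun h' => h'.2 h⟩
  have step2 : Pr s (S ∪ K) ((R \ C) \ (N \ K)) (fun M => J ⊆ M)
      = Pr s ((S ∪ K) ∪ (C' ∪ T)) (((R \ C) \ (N \ K)) ∪ (C' ∪ T)) (fun M => J ⊆ M) := by
    refine Pr_eq_of_agree hs hsub (Finset.union_subset_union_left hsub) rfl ?_ ?_ ?_
    · ext u
      have h1 : u ∈ C' → u ∉ R \ C := fun h h' => (Finset.mem_sdiff.1 h').2 ((mC' u).1 h).1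
      have h2 : u ∈ T → u ∉ R \ C := fun h h' => hTR u h (Finset.mem_sdiff.1 h').1
      simp only [Finset.mem_sdiff, Finset.mem_union] at *
      tauto
    · intro x hx y hy _
      rw [Finset.mem_sdiff, Finset.mem_sdiff, Finset.mem_sdiff, Finset.mem_union] at hx
      obtain ⟨⟨⟨hxR, hxC⟩, -⟩, hxSK⟩ := hx
      have hxK : x ∉ K := fun h => hxSK (.inr h)
      rw [Finset.mem_union (s := S ∪ K)]
      refine ⟨.inl, fun h => h.resolve_right fun hyCT => ?_⟩
      by_cases hx0 : 0 ≤ x.2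
      · refine hxK ?_
        rw [hK, mem_bdry]
        refine ⟨hxR, hx0, hxC, y, hy, ?_⟩
        rcases Finset.mem_union.1 hyCT with h | h
        · exact .inl ((mC' y).1 h).1
        · refine .inr ⟨?_, hTR y h⟩
          rw [mT] at h; rw [mem_upper]; omega
      · have hy1 : 1 ≤ y.2 := by
          rcases Finset.mem_union.1 hyCT with h | h
          · exact ((mC' y).1 h).2
          · rw [mT] at h; rw [mR] at hxR; omega
        rw [mem_nbrs, Prod.ext_iff, Prod.ext_iff, Prod.ext_iff, Prod.ext_iff] at hy
        simp only at hy
        omega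
    · intro f _
      have hd : ∀ u ∈ J, u ∉ C' ∪ T := fun u hu hu' => by
        rcases Finset.mem_union.1 hu' with h | h
        · exact hCJ u ((mC' u).1 h).1 hu
        · exact hTR u h (hJR hu)
      refine ⟨fun h u hu => ?_, fun h u hu => ?_⟩
      · have := h hu; simp only [Finset.mem_union] at this ⊢; tauto
      · have h1 := h hu
        have h2 := hd u hu
        simp only [Finset.mem_union] at h1 h2 ⊢; tauto
  rw [step2]
  refine Pr_mono hs hs1 ?_ ?_ (Finset.union_subset_union_left hsub) ?_ fun M M' h1 h2 => h2.trans h1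
  · intro u hu
    rw [Finset.mem_sdiff, Finset.mem_union, mN]
    rcases Finset.mem_union.1 hu with h | h
    · refine ⟨.inl (hSR h), ?_⟩
      rw [mS] at h; omega
    · refine ⟨.inr h, ?_⟩
      rw [mT] at h; omega
  · intro u hu
    simp only [Finset.mem_union] at hu ⊢
    tauto
  · intro u hu
    rw [Finset.mem_sdiff, Finset.mem_union] at hu
    rcases hu with ⟨h | h, h'⟩
    · by_cases huC : u ∈ C
      · refine Finset.mem_union_right _ (Finset.mem_union_left _ ((mC' u).2 ⟨huC, ?_⟩))
        have h1 := hCJ u huC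
        have h2 := hCS u huC
        have h3 := (hCR u huC).2
        rw [mN] at h'; rw [mJ] at h1; rw [mS] at h2; rw [mR] at h
        omega
      · exact Finset.mem_union_left _ (Finset.mem_sdiff.2 ⟨Finset.mem_sdiff.2 ⟨h, huC⟩,
          fun h'' => h' (Finset.mem_sdiff.1 h'').1⟩)
    · exact Finset.mem_union_right _ (Finset.mem_union_right _ h)

theorem exists_noConn_upper_bound (hs : 0 < s) (ht : s ^ 2 < 1)
    (hq : s ^ 2 < (1 - s ^ 2) / (1 + s ^ 2)) :
    ∃ (C θ : ℝ) (h₀ : ℕ), 0 < C ∧ 0 < θ ∧ θ < 1 ∧ ∀ n h : ℕ, h₀ ≤ h → ∀ᶠ a : ℕ in atTop,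
      Pr s (seg (-a) 0) (rect (-a) (a + n) h) (NoConn upper (rect (-a) (a + n) h) 0 n)
        ≤ C * θ ^ n := by
  have hs1 : s ≤ 1 := by nlinarith
  obtain ⟨C, θ, h₀, hC, hθ, hθ1, -, H⟩ := exists_key_bound hs ht hq
  refine ⟨C, θ, h₀, hC, hθ, hθ1, fun n h hh => ?_⟩
  filter_upwards [H n h hh] with a ha
  have h1 := Pr_noConn_upper_mul_le hs hs1 (a := a) (n := n) (h := h)
  have hB : 0 < Pr s (seg (-a) 0 ∪ cap (-a) (a + n) h)
      ((rect (-a) (a + n) h ∪ cap (-a) (a + n) h) \ seg n (a + n)) (fun M => seg 0 n ⊆ M) := by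
    have hsub : seg (-a) 0 ∪ cap (-a) (a + n) h ∪ seg 0 n
        ⊆ (rect (-a) (a + n) h ∪ cap (-a) (a + n) h) \ seg n (a + n) := by
      intro u hu
      rw [Finset.mem_union, Finset.mem_union, mem_seg, mem_cap, mem_seg] at hu
      rw [Finset.mem_sdiff, Finset.mem_union, mem_rect, mem_cap, mem_seg]
      omega
    rw [Pr_superset]
    exact div_pos (Zp_pos hs hsub) (Zp_pos hs (Finset.subset_union_left.trans hsub))
  refine le_of_mul_le_mul_left ?_ hB
  linarith

end Exploration

section Planarity

/-- `Walk P E x`: a nearest-neighbour path from `x` to a site of `E`, all of whose other sites lie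
in `P`. -/
inductive Walk (P E : Set Site) : Site → Prop
  | out {x : Site} (hx : x ∈ E) : Walk P E x
  | step {x y : Site} (hx : x ∈ P) (hy : y ∈ nbrs x) (h : Walk P E y) : Walk P E x

variable {P E : Set Site}

theorem Walk.mem_or {x : Site} (h : Walk P E x) : x ∈ P ∨ x ∈ E := by
  cases h with
  | out h => exact .inr h
  | step h _ _ => exact .inl h

theorem Walk.exists_path {x : Site} (h : Walk P E x) : ∃ (γ : ℕ → Site) (k : ℕ), γ 0 = x ∧
    (∀ j < k, γ j ∈ P ∧ γ (j + 1) ∈ nbrs (γ j)) ∧ γ k ∈ E := by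
  induction h with
  | @out x hx => exact ⟨fun _ => x, 0, rfl, by simp, hx⟩
  | @step x y hx hy _ ih =>
    obtain ⟨γ, k, h0, h1, h2⟩ := ih
    refine ⟨fun j => Nat.casesOn j x γ, k + 1, rfl, fun j hj => ?_, h2⟩
    cases j with
    | zero => exact ⟨hx, by simpa [h0] using hy⟩
    | succ j => exact h1 j (by omega)

theorem Walk.map (e : Site ≃ Site) (he : ∀ x, nbrs (e x) = (nbrs x).map e.toEmbedding) {x : Site}
    (h : Walk P E x) : Walk (e '' P) (e '' E) (e x) := by
  induction h with
  | out hx => exact .out (Set.mem_image_of_mem _ hx)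
  | step hx hy _ ih =>
    refine .step (Set.mem_image_of_mem _ hx) ?_ ih
    rw [he]; exact Finset.mem_map_of_mem _ hy

theorem sum_range_add_succ (g : ℕ → ZMod 2) (k : ℕ) :
    ∑ j ∈ Finset.range k, (g j + g (j + 1)) = g 0 + g k := by
  induction k with
  | zero => rw [Finset.sum_range_zero, CharTwo.add_self_eq_zero]
  | succ k ih =>
    rw [Finset.sum_range_succ, ih]
    have := CharTwo.add_self_eq_zero (g k)
    linear_combination this

/-- Indicator that the step from `x` to `y` crosses the ray going down from `u + (1/2, 0)`. -/
def crossing (u x y : Site) : ZMod 2 :=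
  if (x.2 = y.2 ∧ x.2 < u.2) ∧ ((x.1 = u.1 ∧ y.1 = u.1 + 1) ∨ (y.1 = u.1 ∧ x.1 = u.1 + 1)) then 1
  else 0

theorem crossing_up {u v x y : Site} (hv : v = (u.1, u.2 + 1)) (hx : x ≠ u) (hy : y ≠ u) :
    crossing u x y = crossing v x y := by
  subst hv
  rw [Ne, Prod.ext_iff] at hx hy
  unfold crossing
  simp only
  refine if_congr ?_ rfl rfl
  omega

theorem crossing_right {u v x y : Site} (hv : v = (u.1 + 1, u.2)) (hx : x ≠ v) (hy : y ≠ v)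
    (hxy : y ∈ nbrs x) : crossing u x y + crossing v x y
      = (if x.1 = v.1 ∧ x.2 < v.2 then 1 else 0) + (if y.1 = v.1 ∧ y.2 < v.2 then 1 else 0) := by
  subst hv
  rw [mem_nbrs, Prod.ext_iff, Prod.ext_iff, Prod.ext_iff, Prod.ext_iff] at hxy
  rw [Ne, Prod.ext_iff] at hx hy
  unfold crossing
  simp only at *
  split_ifs <;> first | omega | decide

theorem crossing_full {u x y : Site} (hx : x.2 < u.2) (hxy : y ∈ nbrs x) : crossing u x y
      = (if x.1 ≤ u.1 then 1 else 0) + (if y.1 ≤ u.1 then 1 else 0) := by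
  rw [mem_nbrs, Prod.ext_iff, Prod.ext_iff, Prod.ext_iff, Prod.ext_iff] at hxy
  unfold crossing
  simp only at *
  split_ifs <;> first | omega | decide

/-- Two disjoint paths in the upper half of a rectangle cannot join interlaced pairs of boundary
arcs. -/
theorem not_walk_of_disjoint {a n h : ℕ} {N : Set Site} (hPN : ∀ x ∈ P, x ∉ N)
    (hP : ∀ x ∈ P, x ∈ rect (-a) (2 * n + a) h ∧ 0 ≤ x.2)
    (hN : ∀ x ∈ N, x ∈ rect (-a) (2 * n + a) h ∧ 0 ≤ x.2) {i j : ℤ} (hi : 0 ≤ i ∧ i < n)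
    (hj : (n : ℤ) ≤ j)
    (hw : Walk P {x | 0 ≤ x.2 ∧ x ∉ rect (-a) (2 * n + a) h ∧ (n : ℤ) ≤ x.1} (i, 0)) :
    ¬ Walk N {x | 0 ≤ x.2 ∧ x ∉ rect (-a) (2 * n + a) h ∧ x.1 < n} (j, 0) := by
  obtain ⟨γ, k, h0, hγ, hk⟩ := hw.exists_path
  obtain ⟨hk0, hkR, hkn⟩ := hk
  simp only [mem_rect] at hP hN hkR ⊢
  have hγ' : ∀ m ≤ k, γ m ∈ P ∨ m = k := fun m hm => by
    rcases hm.lt_or_eq with h | h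
    · exact .inl (hγ m h).1
    · exact .inr h
  obtain ⟨f, hf⟩ : ∃ f : Site → ZMod 2, ∀ u, f u = (if i ≤ u.1 then 1 else 0)
      + ∑ m ∈ Finset.range k, crossing u (γ m) (γ (m + 1)) := ⟨_, fun _ => rfl⟩
  have hav : ∀ u, (u ∈ N ∨ (0 ≤ u.2 ∧ ¬((-(a : ℤ) ≤ u.1 ∧ u.1 < 2 * n + a) ∧ -(h : ℤ) ≤ u.2 ∧ u.2 ≤ h)
      ∧ u.1 < n)) → ∀ m ≤ k, γ m ≠ u := by
    rintro u hu m hm rfl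
    rcases hγ' m hm with h1 | rfl
    · rcases hu with h2 | h2
      · exact hPN _ h1 h2
      · exact h2.2.1 (hP _ h1).1
    · rcases hu with h2 | h2
      · exact hkR (hN _ h2).1
      · omega
  have hup : ∀ u v : Site, v = (u.1, u.2 + 1) → (∀ m ≤ k, γ m ≠ u) → f u = f v := by
    intro u v hv hu
    rw [hf, hf, hv]
    refine congrArg _ (Finset.sum_congr rfl fun m hm => ?_)
    rw [Finset.mem_range] at hm
    exact crossing_up rfl (hu m (by omega)) (hu (m + 1) (by omega))
  have hright : ∀ u v : Site, v = (u.1 + 1, u.2) → (∀ m ≤ k, γ m ≠ v) → 0 ≤ v.2 →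
      ¬ ((γ k).1 = v.1 ∧ (γ k).2 < v.2) → f u = f v := by
    intro u v hv hu hv0 hend
    have h1 : ∑ m ∈ Finset.range k, crossing u (γ m) (γ (m + 1))
        + ∑ m ∈ Finset.range k, crossing v (γ m) (γ (m + 1))
        = (if i = v.1 ∧ 0 < v.2 then 1 else 0) := by
      rw [← Finset.sum_add_distrib, Finset.sum_congr rfl fun m hm => crossing_right hv
        (hu m (Finset.mem_range.1 hm).le) (hu (m + 1) (Finset.mem_range.1 hm))
        (hγ m (Finset.mem_range.1 hm)).2]
      rw [sum_range_add_succ (fun m => if (γ m).1 = v.1 ∧ (γ m).2 < v.2 then 1 else 0), h0]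
      simp only [if_neg hend, add_zero]
    have h2 : (if i ≤ u.1 then (1 : ZMod 2) else 0) + (if i ≤ v.1 then 1 else 0)
        = (if i = v.1 ∧ 0 < v.2 then 1 else 0) := by
      have h3 := hu 0 (by omega)
      rw [h0, Ne, Prod.ext_iff] at h3
      rw [hv] at h3 hv0 ⊢
      simp only at *
      split_ifs <;> first | omega | decide
    rw [hf, hf]
    have e1 := CharTwo.add_self_eq_zero (if i = v.1 ∧ 0 < v.2 then (1 : ZMod 2) else 0)
    have e2 := CharTwo.add_self_eq_zero (if i ≤ v.1 then (1 : ZMod 2) else 0)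
    have e3 := CharTwo.add_self_eq_zero (∑ m ∈ Finset.range k, crossing v (γ m) (γ (m + 1)))
    linear_combination h1 + h2 - e2 - e3 + e1
  have hmain : ∀ u, Walk N {x | 0 ≤ x.2 ∧ ¬((-(a : ℤ) ≤ x.1 ∧ x.1 < 2 * n + a) ∧ -(h : ℤ) ≤ x.2
      ∧ x.2 ≤ h) ∧ x.1 < n} u → f u = 0 := by
    intro u hu
    induction hu with
    | @out u hu =>
      obtain ⟨hu0, huR, hun⟩ := hu
      rw [hf]
      by_cases hua : u.1 < -a
      · rw [if_neg (by omega), zero_add]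
        refine Finset.sum_eq_zero fun m hm => ?_
        rw [Finset.mem_range] at hm
        have h1 := hP _ (hγ m hm).1
        have h2 : -(a : ℤ) ≤ (γ (m + 1)).1 := by
          rcases hγ' (m + 1) hm with h2 | h2
          · exact (hP _ h2).1.1.1
          · rw [h2]; omega
        unfold crossing
        rw [if_neg]; omega
      · rw [Finset.sum_congr rfl fun m hm => crossing_full (by
            have h1 := hP _ (hγ m (Finset.mem_range.1 hm)).1
            omega) (hγ m (Finset.mem_range.1 hm)).2]
        rw [sum_range_add_succ (fun m => if (γ m).1 ≤ u.1 then 1 else 0), h0,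
          if_neg (show ¬ (γ k).1 ≤ u.1 by omega), add_zero]
        exact CharTwo.add_self_eq_zero _
    | @step x y hx hy hw ih =>
      rw [← ih]
      have hyy := hw.mem_or
      have hxa := hav x (.inl hx)
      have hya := hav y hyy
      have hxR := hN x hx
      have hy0 : 0 ≤ y.2 := by
        rcases hyy with h | h
        · exact (hN y h).2
        · exact h.1
      rw [mem_nbrs] at hy
      rcases hy with hy | hy | hy | hy
      · refine hright x y hy hya hy0 ?_
        rcases hyy with h | h
        · have := hN y h; omega
        · have := h.2.2; omega
      · refine (hright y x (by rw [hy]; simp) hxa hxR.2 ?_).symm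
        omega
      · exact hup x y hy hxa
      · exact (hup y x (by rw [hy]; simp) hya).symm
  intro hw2
  have h1 := hmain _ hw2
  rw [hf, if_pos (by simp only; omega), Finset.sum_eq_zero, add_zero] at h1
  · exact one_ne_zero h1
  · intro m hm
    have h1 := (hP _ (hγ m (Finset.mem_range.1 hm)).1).2
    unfold crossing
    rw [if_neg]; simp only; omega

end Planarity

section Reflect

variable {s : ℝ}

theorem Walk.mono {P P' E E' : Set Site} (hP : P ⊆ P') (hE : E ⊆ E') {x : Site} (h : Walk P E x) :
    Walk P' E' x := by
  induction h with
  | out hx => exact .out (hE hx)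
  | step hx hy _ ih => exact .step (hP hx) hy ih

/-- An event that occurs for every configuration or for its image under the exchange of signs
composed with a reflection has probability at least one half. -/
theorem half_le_Pr (hs : 0 < s) (e : Site ≃ Site)
    (he : ∀ x, nbrs (e x) = (nbrs x).map e.toEmbedding) (hee : ∀ x, e (e x) = x)
    {K D : Finset Site} (hKD : Disjoint K D) (hD : D.map e.toEmbedding = D)
    (hb : ∀ x ∈ D, ∀ y ∈ nbrs x, y ∉ D → (y ∈ K ↔ e y ∉ K)) {F : Finset Site → Prop}
    (hF : ∀ f ⊆ D, F (K ∪ f) ∨ F (K ∪ (D \ f).map e.toEmbedding)) :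
    1 / 2 ≤ Pr s K (K ∪ D) F := by
  classical
  obtain ⟨φ, hφ⟩ : ∃ φ : Finset Site → Finset Site, ∀ f, φ f = (D \ f).map e.toEmbedding :=
    ⟨_, fun _ => rfl⟩
  have hsymm : ∀ x, e.symm x = e x := fun x => by rw [Equiv.symm_apply_eq, hee]
  have memD : ∀ x, e x ∈ D ↔ x ∈ D := fun x => by
    conv_rhs => rw [← hD, Finset.mem_map_equiv, hsymm]
  have mφ : ∀ f x, x ∈ φ f ↔ x ∈ D ∧ e x ∉ f := fun f x => by
    rw [hφ, Finset.mem_map_equiv, hsymm, Finset.mem_sdiff, memD]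
  have hφD : ∀ f, φ f ⊆ D := fun f x hx => ((mφ f x).1 hx).1
  have hφφ : ∀ f ⊆ D, φ (φ f) = f := fun f hf => by
    ext x
    rw [mφ, mφ, memD, hee]
    have := @hf x
    tauto
  have hwt : ∀ f ⊆ D, wt s (K ∪ φ f) = wt s (K ∪ f) := fun f hf => by
    rw [wt_union hKD hf, wt_union hKD (hφD f)]
    congr 2
    conv_lhs => rw [← energy_compl, ← hD, energy_image nbrs e he]
    refine energy_congr _ (fun x hx => ?_) fun x hx y hy hyD => ?_
    · have h1 : e x ∉ K := fun h => Finset.disjoint_left.1 hKD h ((memD x).2 hx)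
      have h2 : x ∉ K := fun h => Finset.disjoint_left.1 hKD h hx
      simp only [Set.mem_preimage, Set.mem_compl_iff, Finset.mem_coe, Finset.mem_union, mφ, memD, hee,
        h1, h2, hx]
      tauto
    · have h1 := hb x hx y hy hyD
      have h2 : y ∉ f := fun h => hyD (hf h)
      simp only [Set.mem_preimage, Set.mem_compl_iff, Finset.mem_coe, Finset.mem_union, mφ, memD, hee,
        hyD, h2]
      tauto
  have hsd : (K ∪ D) \ K = D := by
    rw [Finset.union_sdiff_left, Finset.sdiff_eq_self_of_disjoint hKD.symm]
  have hZ := Zp_pos hs (Finset.subset_union_left : K ⊆ K ∪ D)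
  unfold Pr
  rw [le_div_iff₀ hZ]
  unfold Wev Zp
  rw [sum_Icc_eq Finset.subset_union_left, sum_Icc_eq Finset.subset_union_left, hsd]
  have hre : ∑ f ∈ D.powerset, (if F (K ∪ f) then wt s (K ∪ f) else 0)
      = ∑ f ∈ D.powerset, (if F (K ∪ φ f) then wt s (K ∪ f) else 0) := by
    refine Finset.sum_bij' (fun f _ => φ f) (fun f _ => φ f) (fun f _ => Finset.mem_powerset.2 (hφD f))
      (fun f _ => Finset.mem_powerset.2 (hφD f)) (fun f hf => hφφ f (Finset.mem_powerset.1 hf))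
      (fun f hf => hφφ f (Finset.mem_powerset.1 hf)) fun f hf => ?_
    rw [hφφ f (Finset.mem_powerset.1 hf), hwt f (Finset.mem_powerset.1 hf)]
  have hle : ∑ f ∈ D.powerset, wt s (K ∪ f)
      ≤ ∑ f ∈ D.powerset, (if F (K ∪ f) then wt s (K ∪ f) else 0)
        + ∑ f ∈ D.powerset, (if F (K ∪ φ f) then wt s (K ∪ f) else 0) := by
    rw [← Finset.sum_add_distrib]
    refine Finset.sum_le_sum fun f hf => ?_
    have := wt_pos hs (K ∪ f)
    rcases hF f (Finset.mem_powerset.1 hf) with h | h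
    · rw [if_pos h]; split_ifs <;> linarith
    · rw [← hφ] at h
      rw [if_pos h]; split_ifs <;> linarith
  rw [← hre] at hle
  refine le_trans ?_ (le_of_eq (Finset.sum_congr rfl fun f _ => ?_) :
    ∑ f ∈ D.powerset, (if F (K ∪ f) then wt s (K ∪ f) else 0) ≤ _)
  · linarith
  · by_cases h : F (K ∪ f)
    · rw [if_pos h]
    · rw [if_neg h]

/-- The half-plane strictly to the left of column `n`. -/
def leftOf (n : ℤ) : Set Site := {x | x.1 < n}

theorem mem_leftOf {n : ℤ} {x : Site} : x ∈ leftOf n ↔ x.1 < n := Iff.rfl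

theorem Pr_noConn_left_le (hs : 0 < s) (hs1 : s ≤ 1) {a n h : ℕ} :
    Pr s (seg (-a) 0) (rect (-a) (2 * n + a) h) (NoConn (leftOf n) (rect (-a) (2 * n + a) h) 0 n)
      ≤ 2 * Pr s (seg (-a) 0) (rect (-a) (2 * n + a) h)
        (NoConn upper (rect (-a) (2 * n + a) h) 0 n) := by
  classical
  obtain ⟨R, hR⟩ : ∃ R, R = rect (-a) (2 * n + a) h := ⟨_, rfl⟩
  obtain ⟨S, hS⟩ : ∃ S, S = seg (-a) 0 := ⟨_, rfl⟩
  obtain ⟨J, hJ⟩ : ∃ J, J = seg 0 n := ⟨_, rfl⟩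
  rw [← hR, ← hS]
  have mR : ∀ u : Site, u ∈ R ↔ (-(a : ℤ) ≤ u.1 ∧ u.1 < 2 * n + a) ∧ -(h : ℤ) ≤ u.2 ∧ u.2 ≤ h :=
    fun u => by rw [hR, mem_rect]
  have mS : ∀ u : Site, u ∈ S ↔ (-(a : ℤ) ≤ u.1 ∧ u.1 < 0) ∧ u.2 = 0 := fun u => by rw [hS, mem_seg]
  have mJ : ∀ u : Site, u ∈ J ↔ (0 ≤ u.1 ∧ u.1 < n) ∧ u.2 = 0 := fun u => by rw [hJ, mem_seg]
  have hSR : S ⊆ R := fun u hu => by rw [mS] at hu; rw [mR]; omega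
  have hJR : J ⊆ R := fun u hu => by rw [mJ] at hu; rw [mR]; omega
  have hQ : Pr s S R (NoConn (leftOf n) R 0 n)
      = Pr s S R (fun M => Disjoint J (cluster (leftOf n) R M)) := by
    refine Pr_congr fun M _ _ => ?_
    rw [Finset.disjoint_left]
    constructor
    · intro hE u hu huc
      refine hE u.1 ((mJ u).1 hu).1.1 ((mJ u).1 hu).1.2 ?_
      rw [show (u.1, (0 : ℤ)) = u from Prod.ext rfl ((mJ u).1 hu).2.symm]
      exact (mem_cluster.1 huc).2
    · intro hD i h1 h2 hc
      have hiJ : ((i, 0) : Site) ∈ J := (mJ _).2 ⟨⟨h1, h2⟩, rfl⟩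
      exact hD hiJ (mem_cluster.2 ⟨hJR hiJ, hc⟩)
  rw [hQ]
  suffices hmain : 1 / 2 * Pr s S R (fun M => Disjoint J (cluster (leftOf n) R M))
      ≤ Pr s S R (NoConn upper R 0 n) by linarith
  refine Pr_explore_ge hs hSR (fun C => Disjoint J C) _ fun M₀ hSM hMR hJC => ?_
  obtain ⟨C, hC⟩ : ∃ C, C = cluster (leftOf n) R M₀ := ⟨_, rfl⟩
  rw [← hC] at hJC ⊢
  obtain ⟨K, hK⟩ : ∃ K, K = S ∪ bdry (leftOf n) R C := ⟨_, rfl⟩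
  rw [← hK]
  obtain ⟨ι, hι⟩ : ∃ ι, ι = href (2 * n - 1) := ⟨_, rfl⟩
  have ιap : ∀ u : Site, ι u = (2 * n - 1 - u.1, u.2) := fun u => by rw [hι, href_apply]
  have ι1 : ∀ u : Site, (ι u).1 = 2 * n - 1 - u.1 := fun u => by rw [ιap]
  have ι2 : ∀ u : Site, (ι u).2 = u.2 := fun u => by rw [ιap]
  have ιι : ∀ u : Site, ι (ι u) = u := fun u => by
    rw [ιap, ι1, ι2]; exact Prod.ext (by simp only; ring) rfl
  have ιsymm : ∀ x, ι.symm x = ι x := fun x => by rw [Equiv.symm_apply_eq, ιι]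
  have ιnb : ∀ x, nbrs (ι x) = (nbrs x).map ι.toEmbedding := hι ▸ nbrs_href _
  have ιR : ∀ u, ι u ∈ R ↔ u ∈ R := fun u => by rw [mR, mR, ι1, ι2]; omega
  have mC : ∀ u, u ∈ C ↔ u ∈ R ∧ Conn (leftOf n) R M₀ u := fun u => by rw [hC, mem_cluster]
  have hCl : ∀ u ∈ C, u.1 < n := fun u hu => ((mC u).1 hu).2.mem
  have hCS : ∀ u ∈ C, u ∉ S := fun u hu huS => by
    have := disjoint_cluster (H := leftOf n) hMR
    rw [← hC] at this
    exact Finset.disjoint_left.1 this (hSM huS) hu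
  have hCJ : ∀ u ∈ C, u ∉ J := fun u hu huJ => Finset.disjoint_left.1 hJC huJ hu
  have hCax : ∀ u ∈ C, u.2 ≠ 0 := fun u hu h0 => by
    have h1 := hCS u hu
    have h2 := hCJ u hu
    have h3 := hCl u hu
    have h4 := ((mC u).1 hu).1
    rw [mS] at h1; rw [mJ] at h2; rw [mR] at h4
    omega
  have hKs : ∀ u ∈ K, u ∈ R ∧ u.1 < n ∧ u ∉ C := fun u hu => by
    rw [hK, Finset.mem_union, mem_bdry, mem_leftOf] at hu
    rcases hu with hu | hu
    · exact ⟨hSR hu, by rw [mS] at hu; omega, fun h => hCS u h hu⟩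
    · exact ⟨hu.1, hu.2.1, hu.2.2.1⟩
  have hKb : ∀ x y, x ∈ R → x.1 < n → x ∉ C → y ∈ nbrs x → (y ∈ C ∨ (y.1 < n ∧ y ∉ R)) → x ∈ K := by
    intro x y hx hxn hxC hy h
    rw [hK, Finset.mem_union, mem_bdry]
    exact .inr ⟨hx, hxn, hxC, y, hy, h⟩
  obtain ⟨D₀, hD₀⟩ : ∃ D₀ : Finset Site, D₀ = (R.filter (fun u : Site => u.1 < (n : ℤ)) \ C) \ K := ⟨_, rfl⟩
  have mD₀ : ∀ u, u ∈ D₀ ↔ (u ∈ R ∧ u.1 < n) ∧ u ∉ C ∧ u ∉ K := fun u => by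
    rw [hD₀, Finset.mem_sdiff, Finset.mem_sdiff, Finset.mem_filter, and_assoc]
  obtain ⟨D, hD⟩ : ∃ D, D = D₀ ∪ D₀.map ι.toEmbedding := ⟨_, rfl⟩
  have mD : ∀ u, u ∈ D ↔ u ∈ D₀ ∨ ι u ∈ D₀ := fun u => by
    rw [hD, Finset.mem_union, Finset.mem_map_equiv, ιsymm]
  have ιD : ∀ u, ι u ∈ D ↔ u ∈ D := fun u => by rw [mD, mD, ιι, or_comm]
  have hDR : ∀ u ∈ D, u ∈ R := fun u hu => by
    rcases (mD u).1 hu with h | h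
    · exact ((mD₀ u).1 h).1.1
    · exact (ιR u).1 ((mD₀ _).1 h).1.1
  have hDleft : ∀ u ∈ D, u.1 < n → u ∈ D₀ := fun u hu hn => by
    rcases (mD u).1 hu with h | h
    · exact h
    · have := ((mD₀ _).1 h).1.2
      rw [ι1] at this; omega
  have hKD : Disjoint K D := Finset.disjoint_left.2 fun u h1 h2 =>
    ((mD₀ u).1 (hDleft u h2 (hKs u h1).2.1)).2.2 h1
  have hCD : ∀ u ∈ C, u ∉ D := fun u h1 h2 => ((mD₀ u).1 (hDleft u h2 (hCl u h1))).2.1 h1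
  -- configurations of the frozen right part become plus
  have hmono : Pr s K (K ∪ D) (NoConn upper R 0 n) ≤ Pr s K (R \ C) (NoConn upper R 0 n) := by
    have hsub : K ∪ D ⊆ R \ C := fun u hu => by
      rw [Finset.mem_sdiff]
      rcases Finset.mem_union.1 hu with h | h
      · exact ⟨(hKs u h).1, (hKs u h).2.2⟩
      · exact ⟨hDR u h, fun h' => hCD u h' h⟩
    exact Pr_mono hs hs1 Finset.subset_union_left subset_rfl (Finset.subset_union_left.trans hsub) hsub
      fun M N h1 h2 => h2.mono subset_rfl subset_rfl h1
  refine le_trans ?_ hmono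
  have hbD₀ : ∀ x ∈ D₀, ∀ y ∈ nbrs x, y ∉ D → y ∈ K ∧ ι y ∉ K := by
    intro x hx y hy hyD
    have hx' := (mD₀ x).1 hx
    have hyn : y.1 < n := by
      by_contra hyn
      refine hyD ((mD y).2 (.inr ?_))
      have : ι y = x := by
        rw [ιap]
        rw [mem_nbrs, Prod.ext_iff, Prod.ext_iff, Prod.ext_iff, Prod.ext_iff] at hy
        rw [Prod.ext_iff]
        simp only at hy ⊢
        omega
      rwa [this]
    have hyR : y ∈ R := by
      by_contra h
      exact hx'.2.2 (hKb x y hx'.1.1 hx'.1.2 hx'.2.1 hy (.inr ⟨hyn, h⟩))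
    have hyC : y ∉ C := fun h => hx'.2.2 (hKb x y hx'.1.1 hx'.1.2 hx'.2.1 hy (.inl h))
    refine ⟨?_, fun h => ?_⟩
    · by_contra hyK
      exact hyD ((mD y).2 (.inl ((mD₀ y).2 ⟨⟨hyR, hyn⟩, hyC, hyK⟩)))
    · have := (hKs _ h).2.1
      rw [ι1] at this; omega
  refine half_le_Pr hs ι ιnb ιι hKD ?_ ?_ fun f hf => ?_
  · ext u; rw [Finset.mem_map_equiv, ιsymm, ιD]
  · intro x hx y hy hyD
    rcases (mD x).1 hx with h | h
    · have := hbD₀ x h y hy hyD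
      exact ⟨fun _ => this.2, fun _ => this.1⟩
    · have hy' : ι y ∈ nbrs (ι x) := by rw [ιnb]; exact Finset.mem_map_of_mem _ hy
      have := hbD₀ _ h _ hy' (fun h' => hyD ((ιD y).1 h'))
      rw [ιι] at this
      exact ⟨fun h' => absurd h' this.2, fun h' => absurd this.1 h'⟩
  by_contra hcon
  rw [not_or] at hcon
  -- the plus paths, with the part in the cluster reflected to the right
  obtain ⟨E, hE⟩ : ∃ E : Set Site, E = {x | 0 ≤ x.2 ∧ x ∉ R ∧ (n : ℤ) ≤ x.1} := ⟨_, rfl⟩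
  obtain ⟨P, hP⟩ : ∃ P : Finset Site → Set Site, ∀ g, P g = {x | 0 ≤ x.2 ∧ ((x ∈ D ∧ x ∉ g) ∨
    (ι x ∈ R ∧ (ι x).1 < n ∧ ι x ∉ D))} := ⟨_, fun _ => rfl⟩
  have hrefl : ∀ g y, Conn (leftOf n) R M₀ y → y ∈ R → 1 ≤ y.2 → Walk (P g) E (ι y) := by
    intro g y hy
    induction hy with
    | out _ h => exact fun h' => absurd h' h
    | @step y z hyl hyM hz hc ih =>
      intro hyR hy1
      have hyC : y ∈ C := (mC y).2 ⟨hyR, .step hyl hyM hz hc⟩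
      have hιz : ι z ∈ nbrs (ι y) := by rw [ιnb]; exact Finset.mem_map_of_mem _ hz
      refine .step ?_ hιz ?_
      · rw [hP]
        refine ⟨by rw [ι2]; omega, .inr ?_⟩
        rw [ιι]
        exact ⟨hyR, hyl, hCD y hyC⟩
      · have hz0 : 0 ≤ z.2 := by
          rw [mem_nbrs, Prod.ext_iff, Prod.ext_iff, Prod.ext_iff, Prod.ext_iff] at hz
          simp only at hz
          omega
        by_cases hzR : z ∈ R
        · have := hCax z ((mC z).2 ⟨hzR, hc⟩)
          exact ih hzR (by omega)
        · refine .out ?_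
          rw [hE]
          have := hc.mem
          rw [mem_leftOf] at this
          exact ⟨by rw [ι2]; exact hz0, fun h => hzR ((ιR z).1 h), by rw [ι1]; omega⟩
  have hwalk : ∀ g x, Conn upper R (K ∪ g) x → x ∈ R → x ∉ C → Walk (P g) E x := by
    intro g x hx
    induction hx with
    | out _ h => exact fun h' => absurd h' h
    | @step x y hxu hxM hy hc ih =>
      intro hxR hxC
      rw [Finset.mem_union, not_or] at hxM
      by_cases hyC : y ∈ C
      · have hxn : ¬ x.1 < n := fun hxn => hxM.1 (hKb x y hxR hxn hxC hy (.inl hyC))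
        have hyn := hCl y hyC
        have hyax := hCax y hyC
        have hxy : ι y = x := by
          rw [ιap]
          rw [mem_nbrs, Prod.ext_iff, Prod.ext_iff, Prod.ext_iff, Prod.ext_iff] at hy
          rw [Prod.ext_iff]
          simp only at hy ⊢
          omega
        have hy0 : 0 ≤ y.2 := hc.mem
        have hwx := hrefl g y ((mC y).1 hyC).2 ((mC y).1 hyC).1 (by omega)
        rw [hxy] at hwx
        exact hwx
      refine .step ?_ hy ?_
      · rw [hP]
        refine ⟨hxu, ?_⟩
        by_cases hxD : x ∈ D
        · exact .inl ⟨hxD, hxM.2⟩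
        · refine .inr ⟨(ιR x).2 hxR, ?_, fun h => hxD ((ιD x).1 h)⟩
          rw [ι1]
          by_contra hxn
          exact hxD ((mD x).2 (.inl ((mD₀ x).2 ⟨⟨hxR, by omega⟩, hxC, hxM.1⟩)))
      · have hy0 : 0 ≤ y.2 := hc.mem
        by_cases hyR : y ∈ R
        · exact ih hyR hyC
        · refine .out ?_
          rw [hE]
          refine ⟨hy0, hyR, ?_⟩
          by_contra hyn
          by_cases hxn : x.1 < n
          · exact hxM.1 (hKb x y hxR hxn hxC hy (.inr ⟨by omega, hyR⟩))
          · refine hyR ?_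
            rw [mR] at hxR ⊢
            rw [mem_nbrs, Prod.ext_iff, Prod.ext_iff, Prod.ext_iff, Prod.ext_iff] at hy
            simp only at hy
            omega
  have hstart : ∀ g, ¬ NoConn upper R 0 n (K ∪ g) → ∃ i : ℤ, (0 ≤ i ∧ i < n) ∧ Walk (P g) E (i, 0) := by
    intro g hg
    unfold NoConn at hg
    push Not at hg
    obtain ⟨i, hi0, hin, hc⟩ := hg
    have hiJ : ((i, 0) : Site) ∈ J := (mJ _).2 ⟨⟨hi0, hin⟩, rfl⟩
    exact ⟨i, ⟨hi0, hin⟩, hwalk g _ hc (hJR hiJ) fun h => hCJ _ h hiJ⟩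
  obtain ⟨i, hi, hwi⟩ := hstart f hcon.1
  obtain ⟨j, hj, hwj⟩ := hstart _ hcon.2
  have hwj' := hwj.map ι ιnb
  rw [hE, hR] at hwi
  have hmN : ∀ x ∈ ι '' P ((D \ f).map ι.toEmbedding),
      0 ≤ x.2 ∧ (x ∈ f ∨ (x ∈ R ∧ x.1 < n ∧ x ∉ D)) := by
    rintro _ ⟨x, hx, rfl⟩
    rw [hP] at hx
    obtain ⟨hx0, hx⟩ := hx
    rw [Finset.mem_map_equiv, ιsymm, Finset.mem_sdiff, ιD] at hx
    rw [ι2]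
    refine ⟨hx0, hx.imp (fun h => ?_) fun h => ⟨h.1, h.2.1, fun h' => h.2.2 ((ιD x).1 h')⟩⟩
    by_contra h'
    exact h.2 ⟨h.1, h'⟩
  refine not_walk_of_disjoint (N := ι '' P ((D \ f).map ι.toEmbedding)) ?_ ?_ ?_ hi
    (j := 2 * n - 1 - j) (by omega) hwi ?_
  · intro x hx hxN
    obtain ⟨-, h1⟩ := hmN x hxN
    rw [hP] at hx
    obtain ⟨-, h2⟩ := hx
    rw [ι1, ιD] at h2
    rcases h2 with h2 | h2 <;> rcases h1 with h1 | h1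
    · exact h2.2 h1
    · exact h1.2.2 h2.1
    · exact h2.2.2 (hf h1)
    · omega
  · intro x hx
    rw [hP] at hx
    rw [← hR]
    refine ⟨?_, hx.1⟩
    rcases hx.2 with h | h
    · exact hDR x h.1
    · exact (ιR x).1 h.1
  · intro x hx
    obtain ⟨h0, h1⟩ := hmN x hx
    rw [← hR]
    refine ⟨?_, h0⟩
    rcases h1 with h | h
    · exact hDR x (hf h)
    · exact h.1
  · rw [ιap] at hwj'
    refine hwj'.mono subset_rfl ?_
    rintro _ ⟨x, hx, rfl⟩
    rw [hE] at hx
    rw [← hR]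
    exact ⟨by rw [ι2]; exact hx.1, fun h => hx.2.1 ((ιR x).1 h), by rw [ι1]; have := hx.2.2; omega⟩

end Reflect

section FirstPath

variable {s : ℝ} {H : Set Site} {R M S : Finset Site}

theorem Conn.of_map (e : Site ≃ Site) (he : ∀ x, nbrs (e x) = (nbrs x).map e.toEmbedding) {y : Site}
    (h : Conn H (R.map e.toEmbedding) (M.map e.toEmbedding) y) : Conn (e ⁻¹' H) R M (e.symm y) := by
  induction h with
  | @out x hx hR =>
    refine .out (by simpa using hx) fun h => hR ?_
    rwa [Finset.mem_map_equiv]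
  | @step x y hx hM hy _ ih =>
    refine .step (by simpa using hx) (fun h => hM ?_) ?_ ih
    · rwa [Finset.mem_map_equiv]
    · rw [← Finset.mem_map_equiv, ← he, Equiv.apply_symm_apply]
      exact hy

theorem exists_subset_rect (R : Finset Site) :
    ∃ k : ℕ, ∀ a h : ℕ, k ≤ a → k ≤ h → ∀ n : ℕ, R ⊆ rect (-a) (2 * n + a) h := by
  refine ⟨R.sup (fun u => u.1.natAbs + u.2.natAbs) + 1, fun a h ha hh n u hu => ?_⟩
  have : u.1.natAbs + u.2.natAbs ≤ R.sup (fun u : Site => u.1.natAbs + u.2.natAbs) :=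
    Finset.le_sup (f := fun u : Site => u.1.natAbs + u.2.natAbs) hu
  rw [mem_rect]
  omega

theorem exists_noConn_left_bound (hs : 0 < s) (ht : s ^ 2 < 1)
    (hq : s ^ 2 < (1 - s ^ 2) / (1 + s ^ 2)) :
    ∃ C θ : ℝ, 0 < C ∧ 0 < θ ∧ θ < 1 ∧ ∀ (n : ℕ) (S R : Finset Site), S ⊆ R →
      (∀ u ∈ S, u.1 < 0 ∧ u.2 = 0) → Pr s S R (NoConn (leftOf n) R 0 n) ≤ C * θ ^ n := by
  have hs1 : s ≤ 1 := by nlinarith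
  obtain ⟨C, θ, h₀, hC, hθ, hθ1, H⟩ := exists_noConn_upper_bound hs ht hq
  refine ⟨2 * C, θ, by positivity, hθ, hθ1, fun n S R hSR hS => ?_⟩
  obtain ⟨k, hk⟩ := exists_subset_rect R
  obtain ⟨h, hh⟩ : ∃ h, h = k + h₀ := ⟨_, rfl⟩
  have hR := hk k h le_rfl (by omega) n
  obtain ⟨a, ha1, ha2⟩ := ((H n h (by omega)).and (eventually_ge_atTop (k + n))).exists
  have h1 : Pr s S R (NoConn (leftOf n) R 0 n)
      ≤ Pr s (seg (-k) 0) (rect (-k) (2 * n + k) h)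
        (NoConn (leftOf n) (rect (-k) (2 * n + k) h) 0 n) := by
    refine (Pr_mono_event hs fun M _ _ hM => hM.mono subset_rfl hR subset_rfl).trans
      (Pr_mono hs hs1 hSR (fun u hu => ?_) (fun u hu => ?_) hR
        fun M N hMN hM => hM.mono subset_rfl subset_rfl hMN)
    · have h1 := mem_rect.1 (hR (hSR hu))
      have h2 := hS u hu
      rw [mem_seg]; omega
    · rw [mem_seg] at hu
      rw [mem_rect]; omega
  have h2 : Pr s (seg (-k) 0) (rect (-k) (2 * n + k) h)
        (NoConn upper (rect (-k) (2 * n + k) h) 0 n)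
      ≤ Pr s (seg (-a) 0) (rect (-a) (a + n) h) (NoConn upper (rect (-a) (a + n) h) 0 n) := by
    have hsub : rect (-k) (2 * n + k) h ⊆ rect (-a) (a + n) h := fun u hu => by
      rw [mem_rect] at *; omega
    refine (Pr_mono_event hs fun M _ _ hM => hM.mono subset_rfl hsub subset_rfl).trans
      (Pr_mono hs hs1 (fun u hu => ?_) (fun u hu => ?_) (fun u hu => ?_) hsub
        fun M N hMN hM => hM.mono subset_rfl subset_rfl hMN)
    · rw [mem_seg] at hu
      rw [mem_rect]; omega
    · rw [mem_seg] at *; omega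
    · rw [mem_seg] at hu
      rw [mem_rect]; omega
  have h3 := Pr_noConn_left_le hs hs1 (a := k) (n := n) (h := h)
  linarith

theorem exists_noConn_left_bound' (hs : 0 < s) (ht : s ^ 2 < 1)
    (hq : s ^ 2 < (1 - s ^ 2) / (1 + s ^ 2)) :
    ∃ C θ : ℝ, 0 < C ∧ 0 < θ ∧ θ < 1 ∧ ∀ (n x : ℕ) (S R : Finset Site), S ⊆ R →
      (∀ u ∈ S, u.1 < 0 ∧ u.2 = 0) → Pr s S R (NoConn (leftOf (x + n)) R x (x + n)) ≤ C * θ ^ n := by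
  obtain ⟨C, θ, hC, hθ, hθ1, H⟩ := exists_noConn_left_bound hs ht hq
  refine ⟨C, θ, hC, hθ, hθ1, fun n x S R hSR hS => ?_⟩
  have h := H n (S.map (trans (-x)).toEmbedding) (R.map (trans (-x)).toEmbedding)
    (Finset.map_subset_map.2 hSR) fun u hu => ?_
  · rw [Pr_map _ (nbrs_trans _)] at h
    refine (Pr_mono_event hs fun M _ _ hM => ?_).trans h
    intro i hi hin hc
    refine hM (i + x) (by omega) (by omega) ?_
    have := hc.of_map _ (nbrs_trans _)
    rw [trans_symm_apply, sub_neg_eq_add] at this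
    refine this.mono (fun u hu => ?_) subset_rfl subset_rfl
    rw [Set.mem_preimage, trans_apply, mem_leftOf] at hu
    rw [mem_leftOf]
    simp only at hu
    omega
  · rw [Finset.mem_map_equiv] at hu
    have := hS _ hu
    rw [trans_symm_apply] at this
    simp only at this
    omega

theorem wt_le_erase (hs : 0 < s) (hs1 : s ≤ 1) (M : Finset Site) (x : Site) :
    wt s M ≤ (s ^ 8)⁻¹ * wt s (M.erase x) := by
  rw [inv_mul_eq_div, le_div_iff₀ (pow_pos hs 8)]
  unfold wt
  rw [← pow_add]
  exact pow_le_pow_of_le_one hs.le hs1 (by have := cut_erase_le M x; omega)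

theorem Wev_erase_le (hs : 0 < s) (hs1 : s ≤ 1) {A Λ : Finset Site} {x : Site} (hx : x ∉ A)
    (E : Finset Site → Prop) :
    Wev s A Λ (fun M => E (M.erase x)) ≤ (1 + (s ^ 8)⁻¹) * Wev s A Λ E := by
  classical
  have h8 : (0 : ℝ) ≤ (s ^ 8)⁻¹ := by positivity
  have hnn : ∀ M, 0 ≤ if E M then wt s M else 0 := fun M => by
    split_ifs <;> [exact (wt_pos hs M).le; exact le_rfl]
  have h1 : ∑ M ∈ (Finset.Icc A Λ).filter (x ∉ ·), (if E (M.erase x) then wt s M else 0)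
      ≤ ∑ M ∈ Finset.Icc A Λ, if E M then wt s M else 0 := by
    rw [Finset.sum_congr rfl (g := fun M => if E M then wt s M else 0)]
    · exact Finset.sum_le_sum_of_subset_of_nonneg (Finset.filter_subset _ _) fun M _ _ => hnn M
    · intro M hM
      rw [Finset.mem_filter] at hM
      rw [Finset.erase_eq_of_notMem hM.2]
  have h2 : ∑ M ∈ (Finset.Icc A Λ).filter (x ∈ ·), (if E (M.erase x) then wt s M else 0)
      ≤ (s ^ 8)⁻¹ * ∑ M ∈ Finset.Icc A Λ, if E M then wt s M else 0 := by
    have hinj : Set.InjOn (fun M : Finset Site => M.erase x) ((Finset.Icc A Λ).filter (x ∈ ·)) := by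
      intro M hM N hN h
      rw [Finset.mem_coe, Finset.mem_filter] at hM hN
      rw [← Finset.insert_erase hM.2, ← Finset.insert_erase hN.2]
      exact congrArg _ h
    calc _ ≤ ∑ M ∈ (Finset.Icc A Λ).filter (x ∈ ·),
          (s ^ 8)⁻¹ * (if E (M.erase x) then wt s (M.erase x) else 0) :=
          Finset.sum_le_sum fun M _ => by
            by_cases h : E (M.erase x)
            · rw [if_pos h, if_pos h]; exact wt_le_erase hs hs1 M x
            · rw [if_neg h, if_neg h, mul_zero]
      _ = (s ^ 8)⁻¹ * ∑ M ∈ ((Finset.Icc A Λ).filter (x ∈ ·)).image (·.erase x),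
          (if E M then wt s M else 0) := by
          rw [← Finset.mul_sum, Finset.sum_image hinj]
      _ ≤ _ := by
          refine mul_le_mul_of_nonneg_left (Finset.sum_le_sum_of_subset_of_nonneg ?_
            fun M _ _ => hnn M) h8
          intro N hN
          obtain ⟨M, hM, rfl⟩ := Finset.mem_image.1 hN
          rw [Finset.mem_filter, Finset.mem_Icc] at hM
          exact Finset.mem_Icc.2 ⟨fun u hu => Finset.mem_erase.2
            ⟨fun h => hx (h ▸ hu), hM.1.1 hu⟩, (Finset.erase_subset _ _).trans hM.1.2⟩
  have h3 : Wev s A Λ (fun M => E (M.erase x))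
      = ∑ M ∈ (Finset.Icc A Λ).filter (x ∈ ·), (if E (M.erase x) then wt s M else 0)
        + ∑ M ∈ (Finset.Icc A Λ).filter (x ∉ ·), (if E (M.erase x) then wt s M else 0) := by
    rw [Finset.sum_filter_add_sum_filter_not]; rfl
  have h4 : Wev s A Λ E = ∑ M ∈ Finset.Icc A Λ, if E M then wt s M else 0 := rfl
  rw [h3, h4]
  linarith

theorem Wev_sdiff_le (hs : 0 < s) (hs1 : s ≤ 1) {A Λ X : Finset Site} (hX : Disjoint X A)
    (E : Finset Site → Prop) :
    Wev s A Λ (fun M => E (M \ X)) ≤ (1 + (s ^ 8)⁻¹) ^ X.card * Wev s A Λ E := by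
  induction X using Finset.induction_on generalizing E with
  | empty => simp
  | insert x X hx ih =>
    rw [Finset.disjoint_insert_left] at hX
    have h := ih hX.2 fun M => E (M.erase x)
    have h' := Wev_erase_le hs hs1 hX.1 E (Λ := Λ)
    have h8 : (0 : ℝ) ≤ (1 + (s ^ 8)⁻¹) ^ X.card := by positivity
    have e : ∀ M : Finset Site, M \ insert x X = (M \ X).erase x := fun M => by
      ext u
      simp only [Finset.mem_sdiff, Finset.mem_insert, Finset.mem_erase]
      tauto
    simp only [e]
    rw [Finset.card_insert_of_notMem hx, pow_succ, mul_assoc]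
    exact h.trans (mul_le_mul_of_nonneg_left h' h8)

theorem Pr_sdiff_le (hs : 0 < s) (hs1 : s ≤ 1) {A Λ X : Finset Site} (hX : Disjoint X A)
    (hAΛ : A ⊆ Λ) (E : Finset Site → Prop) :
    Pr s A Λ (fun M => E (M \ X)) ≤ (1 + (s ^ 8)⁻¹) ^ X.card * Pr s A Λ E := by
  unfold Pr
  rw [← mul_div_assoc]
  exact div_le_div_of_nonneg_right (Wev_sdiff_le hs hs1 hX E) (Zp_pos hs hAΛ).le

theorem Pr_or_le (hs : 0 < s) {A Λ : Finset Site} {E E₁ E₂ : Finset Site → Prop}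
    (hAΛ : A ⊆ Λ) (h : ∀ M, A ⊆ M → M ⊆ Λ → E M → E₁ M ∨ E₂ M) :
    Pr s A Λ E ≤ Pr s A Λ E₁ + Pr s A Λ E₂ := by
  classical
  unfold Pr
  rw [← add_div]
  refine div_le_div_of_nonneg_right ?_ (Zp_pos hs hAΛ).le
  unfold Wev
  rw [← Finset.sum_add_distrib]
  refine Finset.sum_le_sum fun M hM => ?_
  rw [Finset.mem_Icc] at hM
  have := wt_pos hs M
  by_cases hE : E M
  · rcases h M hM.1 hM.2 hE with h | h
    · rw [if_pos hE, if_pos h]; split_ifs <;> linarith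
    · rw [if_pos hE, if_pos h]; split_ifs <;> linarith
  · rw [if_neg hE]
    split_ifs <;> linarith

theorem sum_Pr_le (hs : 0 < s) {A Λ : Finset Site} (hAΛ : A ⊆ Λ) {ι : Type*} (I : Finset ι) (T : ℕ)
    (G : ι → Finset Site → Prop) (h : ∀ M, ∃ J : Finset ι, J.card ≤ T ∧ ∀ i ∈ I, G i M → i ∈ J) :
    ∑ i ∈ I, Pr s A Λ (G i) ≤ T := by
  classical
  unfold Pr
  rw [← Finset.sum_div, div_le_iff₀ (Zp_pos hs hAΛ)]
  unfold Wev Zp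
  rw [Finset.sum_comm, Finset.mul_sum]
  refine Finset.sum_le_sum fun M _ => ?_
  obtain ⟨J, hJ, hIJ⟩ := h M
  calc _ = ∑ i ∈ I.filter (G · M), wt s M := by rw [Finset.sum_filter]
    _ = (I.filter (G · M)).card * wt s M := by rw [Finset.sum_const, nsmul_eq_mul]
    _ ≤ T * wt s M := by
      refine mul_le_mul_of_nonneg_right ?_ (wt_pos hs M).le
      refine Nat.cast_le.2 ((Finset.card_le_card fun i hi => ?_).trans hJ)
      rw [Finset.mem_filter] at hi
      exact hIJ i hi.1 hi.2

theorem card_seg (x y : ℤ) : (seg x y).card = (y - x).toNat := by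
  rw [seg, Finset.card_product, Int.card_Ico, Finset.card_singleton, mul_one]

/-- `(n, 0)` is connected to the outside of `R` by pluses of the half-plane on its left. -/
def LeftConn (R : Finset Site) (n : ℕ) (M : Finset Site) : Prop :=
  Conn (leftOf (n + 1)) R M (n, 0)

/-- The first `p ≥ 1` for which `LeftConn R p` holds is in the window `n < p ≤ n + T`. -/
def FirstLeftConn (R : Finset Site) (n T : ℕ) (M : Finset Site) : Prop :=
  ∃ p, n < p ∧ p ≤ n + T ∧ LeftConn R p M ∧ ∀ j, 1 ≤ j → j < p → ¬ LeftConn R j M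

theorem firstLeftConn_of_not {n T : ℕ} (hT : ∀ j, 1 ≤ j → j ≤ n + T → ¬ LeftConn R j M)
    (h : ¬ NoConn (leftOf ((n + 1 : ℕ) + T)) R (n + 1 : ℕ) ((n + 1 : ℕ) + T) M) :
    FirstLeftConn R n T (M \ seg (n + 1) (n + T + 1)) := by
  classical
  obtain ⟨X, hX⟩ : ∃ X, X = seg (n + 1) (n + T + 1) := ⟨_, rfl⟩
  rw [← hX]
  have mX : ∀ u : Site, u ∈ X ↔ ((n : ℤ) + 1 ≤ u.1 ∧ u.1 < n + T + 1) ∧ u.2 = 0 := fun u => by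
    rw [hX, mem_seg]
  unfold NoConn at h
  push Not at h
  obtain ⟨i, hi, hiT, hc⟩ := h
  rw [Nat.cast_add, Nat.cast_one] at hi hiT hc
  have hc' : Conn (leftOf (n + T + 1)) R (M \ X) (i, 0) :=
    hc.mono (fun u hu => by rw [mem_leftOf] at *; omega) subset_rfl Finset.sdiff_subset
  have hchain : ∀ k : ℕ, i + k ≤ n + T → Conn (leftOf (n + T + 1)) R (M \ X) (i + k, 0) := by
    intro k
    induction k with
    | zero => intro _; simpa using hc'
    | succ k ih =>
      intro hk
      push_cast at hk ⊢
      refine .step (y := (i + k, 0)) (by rw [mem_leftOf]; simp only; omega) ?_ ?_ (ih (by omega))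
      · rw [Finset.mem_sdiff, mX]
        exact fun h => h.2 ⟨⟨by simp only; omega, by simp only; omega⟩, rfl⟩
      · rw [mem_nbrs]
        exact .inr (.inl (Prod.ext (by simp only; ring) rfl))
  have hTn : LeftConn R (n + T) (M \ X) := by
    have := hchain (n + T - i).toNat (by omega)
    rw [show i + ((n + T - i).toNat : ℤ) = n + T by omega] at this
    unfold LeftConn
    push_cast
    exact this
  have hlow : ∀ j, 1 ≤ j → j ≤ n → ¬ LeftConn R j (M \ X) := by
    intro j hj hjn hL
    refine hT j hj (by omega) ?_
    have : ∀ u, Conn (leftOf (j + 1)) R (M \ X) u → Conn (leftOf (j + 1)) R M u := by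
      intro u hu
      induction hu with
      | out h1 h2 => exact .out h1 h2
      | @step x y h1 h2 h3 _ ih =>
        refine .step h1 (fun h => h2 (Finset.mem_sdiff.2 ⟨h, fun h' => ?_⟩)) h3 ih
        rw [mX] at h'
        rw [mem_leftOf] at h1
        omega
    exact this _ hL
  have hex : ∃ p, 1 ≤ p ∧ LeftConn R p (M \ X) := ⟨n + T, by omega, hTn⟩
  refine ⟨Nat.find hex, ?_, Nat.find_min' hex ⟨by omega, hTn⟩, (Nat.find_spec hex).2, fun j hj hjp hL =>
    Nat.find_min hex hjp ⟨hj, hL⟩⟩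
  by_contra hcon
  exact hlow _ (Nat.find_spec hex).1 (by omega) (Nat.find_spec hex).2

theorem exists_leftConn_bound (hs : 0 < s) (ht : s ^ 2 < 1) (hq : s ^ 2 < (1 - s ^ 2) / (1 + s ^ 2))
    {ε : ℝ} (hε : 0 < ε) :
    ∃ N₀ : ℕ, ∀ S R : Finset Site, S ⊆ R → (∀ u ∈ S, u.1 < 0 ∧ u.2 = 0) →
      Pr s S R (fun M => ∀ n, 1 ≤ n → n ≤ N₀ → ¬ LeftConn R n M) ≤ ε := by
  have hs1 : s ≤ 1 := by nlinarith
  obtain ⟨C, θ, hC, hθ, hθ1, H⟩ := exists_noConn_left_bound' hs ht hq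
  obtain ⟨T, hT⟩ : ∃ T : ℕ, C * θ ^ T < ε / 2 := by
    have := (tendsto_pow_atTop_nhds_zero_of_lt_one hθ.le hθ1).const_mul C
    rw [mul_zero] at this
    exact (this.eventually (gt_mem_nhds (half_pos hε))).exists
  obtain ⟨K, hK⟩ : ∃ K : ℝ, K = (1 + (s ^ 8)⁻¹) ^ T := ⟨_, rfl⟩
  have hK0 : 0 ≤ K := by rw [hK]; positivity
  obtain ⟨k, hk⟩ := exists_nat_gt (K * T / (ε / 2))
  have hk0 : (0 : ℝ) < k := lt_of_le_of_lt (by positivity) hk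
  refine ⟨k + T, fun S R hSR hS => ?_⟩
  obtain ⟨p, hp⟩ : ∃ p, p = Pr s S R (fun M => ∀ n, 1 ≤ n → n ≤ k + T → ¬ LeftConn R n M) := ⟨_, rfl⟩
  rw [← hp]
  have hpn : ∀ n ∈ Finset.range k, p ≤ ε / 2 + K * Pr s S R (FirstLeftConn R n T) := by
    intro n hn
    rw [Finset.mem_range] at hn
    have h1 : p ≤ Pr s S R (NoConn (leftOf ((n + 1 : ℕ) + T)) R (n + 1 : ℕ) ((n + 1 : ℕ) + T))
        + Pr s S R (fun M => FirstLeftConn R n T (M \ seg (n + 1) (n + T + 1))) := by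
      rw [hp]
      refine Pr_or_le hs hSR fun M _ _ hM => ?_
      by_cases h : NoConn (leftOf ((n + 1 : ℕ) + T)) R (n + 1 : ℕ) ((n + 1 : ℕ) + T) M
      · exact .inl h
      · exact .inr (firstLeftConn_of_not (fun j hj hjn => hM j hj (by omega)) h)
    have h2 := H T (n + 1) S R hSR hS
    have h3 : Pr s S R (fun M => FirstLeftConn R n T (M \ seg (n + 1) (n + T + 1)))
        ≤ K * Pr s S R (FirstLeftConn R n T) := by
      have hcard : (seg ((n : ℤ) + 1) (n + T + 1)).card = T := by rw [card_seg]; omega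
      have h := Pr_sdiff_le hs hs1 (X := seg (n + 1) (n + T + 1)) (Finset.disjoint_left.2
        fun u h1 h2 => ?_) hSR (FirstLeftConn R n T)
      · rwa [hcard, ← hK] at h
      · rw [mem_seg] at h1
        have := hS u h2
        omega
    linarith
  have hsum := Finset.sum_le_sum hpn
  rw [Finset.sum_const, Finset.card_range, nsmul_eq_mul, Finset.sum_add_distrib, Finset.sum_const,
    Finset.card_range, nsmul_eq_mul, ← Finset.mul_sum] at hsum
  have hT' : ∑ n ∈ Finset.range k, Pr s S R (FirstLeftConn R n T) ≤ T := by
    refine sum_Pr_le hs hSR _ T _ fun M => ?_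
    by_cases hex : ∃ p, 1 ≤ p ∧ LeftConn R p M
    · classical
      refine ⟨Finset.Ico (Nat.find hex - T) (Nat.find hex), by rw [Nat.card_Ico]; omega,
        fun n _ ⟨q, h1, h2, h3, h4⟩ => ?_⟩
      have : Nat.find hex = q := by
        refine le_antisymm (Nat.find_min' hex ⟨by omega, h3⟩) ?_
        by_contra hlt
        exact h4 _ (Nat.find_spec hex).1 (by omega) (Nat.find_spec hex).2
      rw [this, Finset.mem_Ico]
      omega
    · exact ⟨∅, by simp, fun n _ ⟨q, h1, h2, h3, h4⟩ => absurd ⟨q, by omega, h3⟩ hex⟩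
  have hKT : K * T < k * (ε / 2) := by rwa [div_lt_iff₀ (half_pos hε)] at hk
  have := mul_le_mul_of_nonneg_left hT' hK0
  have h5 : (k : ℝ) * p ≤ k * ε := by linarith
  exact le_of_mul_le_mul_left h5 hk0

end FirstPath

section Paths

variable {η : Cfg2} {n k : ℕ} {γ : ℕ → Site}

/-- The first `k` steps of `γ` form a self-avoiding path of pluses from `(n, 0)` in `{x ≤ n}`. -/
def IsPlusPath (η : Cfg2) (n k : ℕ) (γ : ℕ → Site) : Prop :=
  γ 0 = ((n : ℤ), 0) ∧ (∀ j < k, adj2 (γ j) (γ (j + 1))) ∧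
    (∀ i ≤ k, ∀ j ≤ k, γ i = γ j → i = j) ∧ ∀ j ≤ k, (γ j).1 ≤ n ∧ η (γ j) = true

theorem IsPlusPath.of_le {l : ℕ} (h : IsPlusPath η n k γ) (hl : l ≤ k) : IsPlusPath η n l γ :=
  ⟨h.1, fun j hj => h.2.1 j (by omega), fun i hi j hj => h.2.2.1 i (by omega) j (by omega),
    fun j hj => h.2.2.2 j (by omega)⟩

theorem IsPlusPath.congr {η' : Cfg2} (h : IsPlusPath η n k γ) (hη : ∀ j ≤ k, η (γ j) = η' (γ j)) :
    IsPlusPath η' n k γ :=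
  ⟨h.1, h.2.1, h.2.2.1, fun j hj => ⟨(h.2.2.2 j hj).1, hη j hj ▸ (h.2.2.2 j hj).2⟩⟩

theorem mem_box {m : ℕ} {x : Site} :
    x ∈ box m ↔ (-(m : ℤ) ≤ x.1 ∧ x.1 ≤ m) ∧ -(m : ℤ) ≤ x.2 ∧ x.2 ≤ m := by
  rw [box, Finset.mem_product, Finset.mem_Icc, Finset.mem_Icc]

theorem mem_box_of_adj {k n : ℕ} {γ : ℕ → Site} (h0 : γ 0 = ((n : ℤ), 0))
    (h : ∀ j < k, adj2 (γ j) (γ (j + 1))) : ∀ j ≤ k, γ j ∈ box (n + j) := by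
  intro j hj
  induction j with
  | zero => rw [h0, mem_box]; simp only; omega
  | succ j ih =>
    have h1 := ih (by omega)
    have h2 := h j (by omega)
    rw [mem_box] at *
    unfold adj2 at h2
    omega

theorem mem_plusPathEvt (h : ∀ k, ∃ γ, IsPlusPath η n k γ) : η ∈ plusPathEvt n := by
  choose γ hγ using h
  have hlim : ∀ j, ∃ v, ∀ᶠ k in (hyperfilter ℕ : Filter ℕ), γ k j = v := by
    intro j
    have hev : ∀ᶠ k in (hyperfilter ℕ : Filter ℕ), ∃ v ∈ (box (n + j) : Set Site), γ k j = v := by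
      filter_upwards [Nat.hyperfilter_le_atTop (eventually_ge_atTop j)] with k hk
      exact ⟨_, mem_box_of_adj (hγ k).1 (hγ k).2.1 j hk, rfl⟩
    obtain ⟨v, -, hv⟩ := (Ultrafilter.eventually_exists_mem_iff (Finset.finite_toSet _)).1 hev
    exact ⟨v, hv⟩
  choose δ hδ using hlim
  have hge : ∀ j, ∀ᶠ k in (hyperfilter ℕ : Filter ℕ), j ≤ k := fun j =>
    Nat.hyperfilter_le_atTop (eventually_ge_atTop j)
  refine ⟨δ, ?_, fun j => ?_, fun i j hij => ?_, fun j => ?_, fun j => ?_⟩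
  · obtain ⟨k, hk⟩ := (hδ 0).exists
    rw [← hk]; exact (hγ k).1
  · obtain ⟨k, ⟨h1, h2⟩, h3⟩ := (((hδ j).and (hδ (j + 1))).and (hge (j + 1))).exists
    rw [← h1, ← h2]; exact (hγ k).2.1 j h3
  · obtain ⟨k, ⟨h1, h2⟩, h3⟩ := (((hδ i).and (hδ j)).and (hge (i + j))).exists
    exact (hγ k).2.2.1 i (by omega) j (by omega) (by rw [h1, h2, hij])
  · obtain ⟨k, h1, h3⟩ := ((hδ j).and (hge j)).exists
    rw [← h1]; exact ((hγ k).2.2.2 j h3).1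
  · obtain ⟨k, h1, h3⟩ := ((hδ j).and (hge j)).exists
    rw [← h1]; exact ((hγ k).2.2.2 j h3).2

/-- No self-avoiding path of `k` steps as in `IsPlusPath` starts from `(n, 0)` with `1 ≤ n ≤ N`. -/
def noPath (N k : ℕ) : Set Cfg2 := {η | ∀ n, 1 ≤ n → n ≤ N → ∀ γ, ¬ IsPlusPath η n k γ}

theorem monotone_noPath (N : ℕ) : Monotone (noPath N) := fun _ _ hkl _ hη n h1 h2 γ h =>
  hη n h1 h2 γ (h.of_le hkl)

theorem mem_noPath_congr {N : ℕ} {η η' : Cfg2} (h : ∀ x ∈ box (N + k), η x = η' x) :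
    η ∈ noPath N k ↔ η' ∈ noPath N k := by
  have : ∀ η η' : Cfg2, (∀ x ∈ box (N + k), η x = η' x) → η' ∈ noPath N k → η ∈ noPath N k := by
    intro η η' h hη n h1 h2 γ hγ
    refine hη n h1 h2 γ (hγ.congr fun j hj => h _ ?_)
    have := mem_box_of_adj hγ.1 hγ.2.1 j hj
    rw [mem_box] at *
    omega
  exact ⟨this _ _ fun x hx => (h x hx).symm, this _ _ h⟩

theorem univ_subset_union (N : ℕ) :
    (Set.univ : Set Cfg2) ⊆ (⋃ n ∈ Finset.Icc 1 N, plusPathEvt n) ∪ ⋃ k, noPath N k := by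
  intro η _
  by_cases h : η ∈ ⋃ k, noPath N k
  · exact .inr h
  refine .inl ?_
  rw [Set.mem_iUnion, not_exists] at h
  have h1 : ∀ k, ∃ n ∈ (Finset.Icc 1 N : Set ℕ), ∃ γ, IsPlusPath η n k γ := by
    intro k
    have := h k
    unfold noPath at this
    rw [Set.mem_ofPred_eq] at this
    push Not at this
    obtain ⟨n, h1, h2, γ, hγ⟩ := this
    exact ⟨n, Finset.mem_coe.2 (Finset.mem_Icc.2 ⟨h1, h2⟩), γ, hγ⟩
  obtain ⟨n, hn, hev⟩ := (Ultrafilter.eventually_exists_mem_iff (f := hyperfilter ℕ)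
    (Finset.finite_toSet _)).1 (Eventually.of_forall h1)
  rw [Set.mem_iUnion₂]
  refine ⟨n, hn, mem_plusPathEvt fun k => ?_⟩
  obtain ⟨l, ⟨γ, hγ⟩, hl⟩ := (hev.and (Nat.hyperfilter_le_atTop (eventually_ge_atTop k))).exists
  exact ⟨γ, hγ.of_le hl⟩

/-- The configuration with set of minus spins `M`. -/
noncomputable def cfg (M : Finset Site) : Cfg2 := fun x => decide (x ∉ M)

/-- Nearest-neighbour graph induced on `P`. -/
def graphOn (P : Set Site) : SimpleGraph Site where
  Adj x y := y ∈ nbrs x ∧ x ∈ P ∧ y ∈ P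
  symm := ⟨fun _ _ h => ⟨nbrs_symm _ _ h.1, h.2.2, h.2.1⟩⟩
  loopless := ⟨fun x h => by
    have := h.1
    rw [mem_nbrs, Prod.ext_iff, Prod.ext_iff, Prod.ext_iff, Prod.ext_iff] at this
    simp only at this
    omega⟩

theorem Conn.exists_reachable {H : Set Site} {R M : Finset Site} (hMR : M ⊆ R) {x : Site}
    (h : Conn H R M x) : ∃ z, z ∉ R ∧ (graphOn {u | u ∈ H ∧ u ∉ M}).Reachable x z := by
  induction h with
  | @out x _ hR => exact ⟨x, hR, .refl _⟩
  | @step x y hx hM hy h ih =>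
    obtain ⟨z, hz, hyz⟩ := ih
    refine ⟨z, hz, SimpleGraph.Reachable.trans (SimpleGraph.Adj.reachable ?_) hyz⟩
    exact ⟨hy, ⟨hx, hM⟩, h.mem, h.notMem hMR⟩

theorem adj2_of_mem_nbrs {x y : Site} (h : y ∈ nbrs x) : adj2 x y := by
  rw [mem_nbrs, Prod.ext_iff, Prod.ext_iff, Prod.ext_iff, Prod.ext_iff] at h
  unfold adj2
  simp only at h
  omega

theorem exists_isPlusPath {L : ℕ} (hL : n + k ≤ L) {M : Finset Site} (hM : M ⊆ box L)
    (h : LeftConn (box L) n M) : ∃ γ, IsPlusPath (cfg M) n k γ := by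
  classical
  obtain ⟨z, hz, ⟨p₀⟩⟩ := h.exists_reachable hM
  obtain ⟨p, hp⟩ := p₀.toPath
  have h0 : p.getVert 0 = ((n : ℤ), 0) := p.getVert_zero
  have hadj : ∀ j < p.length, adj2 (p.getVert j) (p.getVert (j + 1)) := fun j hj =>
    adj2_of_mem_nbrs (p.adj_getVert_succ hj).1
  have hlen : k ≤ p.length := by
    have := mem_box_of_adj h0 hadj p.length le_rfl
    rw [p.getVert_length] at this
    rw [mem_box] at *
    omega
  refine ⟨p.getVert, h0, fun j hj => hadj j (by omega), fun i hi j hj hij =>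
    hp.getVert_injOn (by rw [Set.mem_ofPred_eq]; omega) (by rw [Set.mem_ofPred_eq]; omega) hij,
    fun j hj => ?_⟩
  have hmem : ∀ j ≤ p.length, p.getVert j ∈ leftOf (n + 1) ∧ p.getVert j ∉ M := by
    intro j hj
    cases j with
    | zero => rw [h0]; exact ⟨h.mem, h.notMem hM⟩
    | succ j => exact (p.adj_getVert_succ hj).2.2
  have := hmem j (by omega)
  rw [mem_leftOf] at this
  exact ⟨by omega, by simpa [cfg] using this.2⟩

end Paths

section Measure

variable {β : ℝ}

theorem fill_cfg {Λ : Finset Site} (τ : ↥Λ → Bool) :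
    fill Λ (fun _ => true) τ = cfg (Λ.filter fun x => fill Λ (fun _ => true) τ x = false) := by
  funext x
  unfold cfg
  by_cases hx : x ∈ Λ
  · cases h : fill Λ (fun _ => true) τ x <;> simp [hx, h]
  · simp [hx, fill]

theorem sum_fill {Λ : Finset Site} {α : Type*} [AddCommMonoid α] (g : Cfg2 → α) :
    ∑ τ : ↥Λ → Bool, g (fill Λ (fun _ => true) τ) = ∑ M ∈ Finset.Icc ∅ Λ, g (cfg M) := by
  refine Finset.sum_bij (fun τ _ => Λ.filter fun x => fill Λ (fun _ => true) τ x = false) ?_ ?_ ?_ ?_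
  · intro τ _
    exact Finset.mem_Icc.2 ⟨Finset.empty_subset _, Finset.filter_subset _ _⟩
  · intro τ _ τ' _ h
    have h' : fill Λ (fun _ => true) τ = fill Λ (fun _ => true) τ' := by
      rw [fill_cfg τ, fill_cfg τ', h]
    funext x
    have := congrFun h' x
    simpa [fill] using this
  · intro M hM
    rw [Finset.mem_Icc] at hM
    refine ⟨fun x => cfg M x, Finset.mem_univ _, ?_⟩
    ext x
    rw [Finset.mem_filter]
    constructor
    · rintro ⟨hx, h⟩
      simpa [fill, hx, cfg] using h
    · intro hx
      exact ⟨hM.2 hx, by simp [fill, hM.2 hx, cfg, hx]⟩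
  · intro τ _
    rw [← fill_cfg]

theorem sval_mul_cfg (M : Finset Site) (x y : Site) :
    sval (cfg M x) * sval (cfg M y) = 1 - 2 * (if x ∈ M ↔ y ∈ M then 0 else 1) := by
  by_cases hx : x ∈ M <;> by_cases hy : y ∈ M <;> simp [sval, cfg, hx, hy] <;> norm_num

theorem exists_isingWeight_eq (β : ℝ) (Λ : Finset Site) :
    ∃ c : ℝ, 0 < c ∧ ∀ M ⊆ Λ, isingWeight β 0 Λ (fun _ => true) (cfg M) = c * wt (Real.exp (-β)) M := by
  refine ⟨Real.exp (β * ((∑ x ∈ Λ, ∑ y ∈ nbrs x, if y ∈ Λ then (1 : ℝ) else 2) / 2)),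
    Real.exp_pos _, fun M hM => ?_⟩
  have h1 : (2 * cut nbrs M : ℕ) = energy nbrs Λ (M : Set Site) := by
    have := two_mul_cut nbrs nbrs_symm (F := Λ) (A := ∅) (f := M) (by simp) hM
    rw [Finset.empty_union] at this
    rw [this]
    simp [outerCut]
  unfold wt isingWeight
  rw [h1, ← Real.exp_nat_mul, ← Real.exp_add]
  congr 1
  rw [zero_mul, sub_zero]
  have h2 : ∑ x ∈ Λ, ∑ y ∈ Λ.filter (fun y => y ∈ nbrs x), sval (cfg M x) * sval (cfg M y)
      = ∑ x ∈ Λ, ∑ y ∈ nbrs x, if y ∈ Λ then sval (cfg M x) * sval (cfg M y) else 0 := by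
    refine Finset.sum_congr rfl fun x _ => ?_
    rw [← Finset.sum_filter]
    refine Finset.sum_congr ?_ fun _ _ => rfl
    ext y; simp [and_comm]
  have h3 : ∑ x ∈ Λ, ∑ y ∈ (nbrs x).filter (fun y => y ∉ Λ), sval (cfg M x) * sval true
      = ∑ x ∈ Λ, ∑ y ∈ nbrs x, if y ∈ Λ then 0 else sval (cfg M x) * sval (cfg M y) := by
    refine Finset.sum_congr rfl fun x _ => ?_
    rw [Finset.sum_filter]
    refine Finset.sum_congr rfl fun y _ => ?_
    by_cases hy : y ∈ Λ
    · simp [hy]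
    · have : cfg M y = true := by simpa [cfg] using fun h => hy (hM h)
      simp [hy, this]
  rw [h2, h3]
  have h4 : (energy nbrs Λ (M : Set Site) : ℝ) = ∑ x ∈ Λ, ∑ y ∈ nbrs x,
      (if y ∈ Λ then (1 : ℝ) else 2) * (if x ∈ M ↔ y ∈ M then 0 else 1) := by
    unfold energy
    push_cast
    simp only [Finset.mem_coe]
  have h5 : (∑ x ∈ Λ, ∑ y ∈ nbrs x, if y ∈ Λ then sval (cfg M x) * sval (cfg M y) else 0) / 2
      + (∑ x ∈ Λ, ∑ y ∈ nbrs x, if y ∈ Λ then 0 else sval (cfg M x) * sval (cfg M y))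
      = (∑ x ∈ Λ, ∑ y ∈ nbrs x, if y ∈ Λ then (1 : ℝ) else 2) / 2
        - energy nbrs Λ (M : Set Site) := by
    rw [h4, Finset.sum_div, Finset.sum_div, ← Finset.sum_add_distrib, ← Finset.sum_sub_distrib]
    refine Finset.sum_congr rfl fun x _ => ?_
    rw [Finset.sum_div, Finset.sum_div, ← Finset.sum_add_distrib, ← Finset.sum_sub_distrib]
    refine Finset.sum_congr rfl fun y _ => ?_
    rw [sval_mul_cfg]
    by_cases hy : y ∈ Λ <;> simp only [hy, if_true, if_false] <;> ring
  rw [h5]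
  ring

theorem isingFV_apply (β : ℝ) (Λ : Finset Site) {G : Set Cfg2} (hG : MeasurableSet G) :
    isingFV β 0 Λ (fun _ => true) G
      = ENNReal.ofReal (Wev (Real.exp (-β)) ∅ Λ (fun M => cfg M ∈ G) / Zp (Real.exp (-β)) ∅ Λ) := by
  classical
  obtain ⟨c, hc, hw⟩ := exists_isingWeight_eq β Λ
  have hs := Real.exp_pos (-β)
  have hZ := Zp_pos hs (Finset.empty_subset Λ)
  unfold isingFV
  rw [sum_fill fun ω => ENNReal.ofReal (isingWeight β 0 Λ (fun _ => true) ω),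
    sum_fill fun ω => ENNReal.ofReal (isingWeight β 0 Λ (fun _ => true) ω) • Measure.dirac ω,
    Measure.smul_apply, Measure.finsetSum_apply]
  have hZ' : ∑ M ∈ Finset.Icc ∅ Λ, ENNReal.ofReal (isingWeight β 0 Λ (fun _ => true) (cfg M))
      = ENNReal.ofReal (c * Zp (Real.exp (-β)) ∅ Λ) := by
    unfold Zp
    rw [Finset.mul_sum, ENNReal.ofReal_sum_of_nonneg fun M _ => (mul_pos hc (wt_pos hs M)).le]
    exact Finset.sum_congr rfl fun M hM => by rw [hw M (Finset.mem_Icc.1 hM).2]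
  have hW : ∑ M ∈ Finset.Icc ∅ Λ,
      (ENNReal.ofReal (isingWeight β 0 Λ (fun _ => true) (cfg M)) • Measure.dirac (cfg M)) G
      = ENNReal.ofReal (c * Wev (Real.exp (-β)) ∅ Λ (fun M => cfg M ∈ G)) := by
    unfold Wev
    rw [Finset.mul_sum, ENNReal.ofReal_sum_of_nonneg]
    · refine Finset.sum_congr rfl fun M hM => ?_
      rw [Measure.smul_apply, Measure.dirac_apply' _ hG, hw M (Finset.mem_Icc.1 hM).2]
      by_cases h : cfg M ∈ G <;> simp [h]
    · intro M _
      have := wt_pos hs M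
      split_ifs <;> positivity
  rw [hZ', hW, smul_eq_mul, ← ENNReal.ofReal_inv_of_pos (by positivity), ← ENNReal.ofReal_mul
    (by positivity)]
  congr 1
  field_simp

theorem measurableSet_cylinder (S : Finset Site) (f : Cfg2) :
    MeasurableSet {η : Cfg2 | ∀ i ∈ S, η i = f i} := by
  have : {η : Cfg2 | ∀ i ∈ S, η i = f i} = ⋂ i ∈ S, {η | η i = f i} := by ext; simp
  rw [this]
  exact Finset.measurableSet_biInter _ fun i _ => measurable_pi_apply i (measurableSet_singleton _)

/-- The event `G` only depends on the spins in `S`. -/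
def IsLocal (S : Finset Site) (G : Set Cfg2) : Prop :=
  ∀ η η' : Cfg2, (∀ x ∈ S, η x = η' x) → (η ∈ G ↔ η' ∈ G)

open Classical in
theorem IsLocal.eq_biUnion {S : Finset Site} {G : Set Cfg2} (h : IsLocal S G) :
    G = ⋃ f ∈ (Finset.univ.filter fun f : ↥S → Bool => fill S (fun _ => true) f ∈ G),
      {η : Cfg2 | ∀ i ∈ S, η i = fill S (fun _ => true) f i} := by
  ext η
  simp only [Finset.mem_filter, Finset.mem_univ, true_and, Set.mem_iUnion, exists_prop]
  have hη : ∀ x ∈ S, η x = fill S (fun _ => true) (fun i : ↥S => η i) x := fun x hx => by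
    simp [fill, hx]
  constructor
  · intro hG
    exact ⟨fun i => η i, (h _ _ hη).1 hG, hη⟩
  · rintro ⟨f, hf, hηf⟩
    exact (h _ _ hηf).2 hf

theorem IsLocal.measurableSet {S : Finset Site} {G : Set Cfg2} (h : IsLocal S G) :
    MeasurableSet G := by
  rw [h.eq_biUnion]
  exact Finset.measurableSet_biUnion _ fun f _ => measurableSet_cylinder _ _

theorem IsLocal.tendsto {S : Finset Site} {G : Set Cfg2} (h : IsLocal S G) {μs : ℕ → Measure Cfg2}
    {μ : Measure Cfg2} (hμ : CylTendsto μs μ) : Tendsto (fun n => μs n G) atTop (𝓝 (μ G)) := by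
  classical
  have key : ∀ ν : Measure Cfg2, ν G
      = ∑ f ∈ (Finset.univ.filter fun f : ↥S → Bool => fill S (fun _ => true) f ∈ G),
        ν {η : Cfg2 | ∀ i ∈ S, η i = fill S (fun _ => true) f i} := by
    intro ν
    conv_lhs => rw [h.eq_biUnion]
    refine measure_biUnion_finset (fun f _ g _ hfg => ?_) fun f _ => measurableSet_cylinder _ _
    rw [Function.onFun, Set.disjoint_left]
    intro η h1 h2
    refine hfg (funext fun i => ?_)
    have := (h1 i i.2).symm.trans (h2 i i.2)
    simpa [fill] using this
  simp only [key]
  exact tendsto_finsetSum _ fun f _ => hμ S _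

theorem IsLocal.inter {S S' : Finset Site} {G G' : Set Cfg2} (h : IsLocal S G) (h' : IsLocal S' G') :
    IsLocal (S ∪ S') (G ∩ G') := fun η η' hη =>
  and_congr (h η η' fun x hx => hη x (Finset.mem_union_left _ hx))
    (h' η η' fun x hx => hη x (Finset.mem_union_right _ hx))

theorem isLocal_lineMinusEvt (m : ℕ) : IsLocal (seg (-m) 0) (lineMinusEvt 1 m) := by
  intro η η' h
  unfold lineMinusEvt
  rw [Set.mem_ofPred_eq, Set.mem_ofPred_eq]
  refine forall_congr' fun i => forall_congr' fun h1 => forall_congr' fun h2 => ?_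
  rw [h (i, 0) (mem_seg.2 ⟨⟨h1, by simp only; push_cast at h2; omega⟩, rfl⟩)]

theorem isLocal_noPath (N k : ℕ) : IsLocal (box (N + k)) (noPath N k) := fun _ _ h =>
  mem_noPath_congr h

theorem cfg_mem_lineMinusEvt {m : ℕ} {M : Finset Site} :
    cfg M ∈ lineMinusEvt 1 m ↔ seg (-m) 0 ⊆ M := by
  unfold lineMinusEvt cfg
  rw [Set.mem_ofPred_eq]
  simp only [decide_eq_false_iff_not, not_not]
  constructor
  · intro h u hu
    rw [mem_seg] at hu
    rw [show u = (u.1, 0) from Prod.ext rfl hu.2]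
    exact h _ (by omega) (by push_cast; omega)
  · intro h i h1 h2
    push_cast at h2
    exact h (mem_seg.2 ⟨⟨h1, by simp only; omega⟩, rfl⟩)

theorem exp_conditions (hβ : betaCrit < β) : Real.exp (-β) ^ 2 < 1 ∧
    Real.exp (-β) ^ 2 < (1 - Real.exp (-β) ^ 2) / (1 + Real.exp (-β) ^ 2) := by
  have h2 : (0 : ℝ) < 1 + Real.sqrt 2 := by positivity
  have hsq := Real.mul_self_sqrt (show (0 : ℝ) ≤ 2 by norm_num)
  have h1 : 1 + Real.sqrt 2 < Real.exp (2 * β) := by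
    rw [← Real.log_lt_iff_lt_exp h2]
    unfold betaCrit at hβ
    linarith
  obtain ⟨t, ht⟩ : ∃ t, t = Real.exp (-β) ^ 2 := ⟨_, rfl⟩
  have ht0 : 0 < t := by rw [ht]; positivity
  have htm : t * Real.exp (2 * β) = 1 := by
    rw [ht, ← Real.exp_nat_mul, ← Real.exp_add]
    simp
  rw [← ht]
  have h3 : t * (1 + Real.sqrt 2) < 1 := by
    have := mul_lt_mul_of_pos_left h1 ht0
    linarith
  have h4 := Real.sqrt_nonneg 2
  have h5 : t < Real.sqrt 2 - 1 := by nlinarith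
  refine ⟨by nlinarith, ?_⟩
  rw [lt_div_iff₀ (by linarith)]
  nlinarith

theorem isingFV_inter_noPath_le (hβ : betaCrit < β) {ε : ℝ} (hε : 0 < ε) :
    ∃ N : ℕ, ∀ m k : ℕ, ∀ᶠ L : ℕ in atTop,
      isingFV β 0 (box L) (fun _ => true) (lineMinusEvt 1 m ∩ noPath N k)
        ≤ ENNReal.ofReal ε * isingFV β 0 (box L) (fun _ => true) (lineMinusEvt 1 m) := by
  obtain ⟨ht, hq⟩ := exp_conditions hβ
  have hs := Real.exp_pos (-β)
  obtain ⟨N, hN⟩ := exists_leftConn_bound hs ht hq hε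
  refine ⟨N, fun m k => ?_⟩
  filter_upwards [eventually_ge_atTop (m + (N + k))] with L hL
  have hSB : seg (-m) 0 ⊆ box L := fun u hu => by
    rw [mem_seg] at hu
    rw [mem_box]; omega
  have h := hN (seg (-m) 0) (box L) hSB fun u hu => by rw [mem_seg] at hu; omega
  have h' : Pr (Real.exp (-β)) (seg (-m) 0) (box L) (fun M => cfg M ∈ noPath N k) ≤ ε := by
    refine (Pr_mono_event hs fun M _ hM hP => ?_).trans h
    intro n h1 h2 hc
    obtain ⟨γ, hγ⟩ := exists_isPlusPath (k := k) (by omega) hM hc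
    exact hP n h1 h2 γ hγ
  rw [isingFV_apply _ _ ((isLocal_lineMinusEvt m).inter (isLocal_noPath N k)).measurableSet,
    isingFV_apply _ _ (isLocal_lineMinusEvt m).measurableSet, ← ENNReal.ofReal_mul hε.le]
  refine ENNReal.ofReal_le_ofReal ?_
  rw [← mul_div_assoc]
  refine div_le_div_of_nonneg_right ?_ (Zp_pos hs (Finset.empty_subset _)).le
  have hW1 : Wev (Real.exp (-β)) ∅ (box L) (fun M => cfg M ∈ lineMinusEvt 1 m)
      = Zp (Real.exp (-β)) (seg (-m) 0) (box L) := by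
    rw [← Wev_superset (Finset.empty_subset _)]
    exact Wev_congr fun M _ _ => cfg_mem_lineMinusEvt
  have hW2 : Wev (Real.exp (-β)) ∅ (box L) (fun M => cfg M ∈ lineMinusEvt 1 m ∩ noPath N k)
      = Wev (Real.exp (-β)) (seg (-m) 0) (box L) (fun M => cfg M ∈ noPath N k) := by
    refine (Wev_congr (E' := fun M => seg (-m) 0 ⊆ M ∧ cfg M ∈ noPath N k) fun M _ _ =>
      and_congr_left fun _ => cfg_mem_lineMinusEvt).trans ?_
    unfold Wev
    symm
    refine Finset.sum_subset_zero_on_sdiff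
      (Finset.Icc_subset_Icc_left (Finset.empty_subset _)) (fun M hM => ?_) fun M hM => ?_
    · rw [Finset.mem_sdiff, Finset.mem_Icc, Finset.mem_Icc] at hM
      exact if_neg fun h => hM.2 ⟨h.1, hM.1.2⟩
    · have hA : seg (-m) 0 ⊆ M := (Finset.mem_Icc.1 hM).1
      by_cases hP : cfg M ∈ noPath N k
      · rw [if_pos hP, if_pos ⟨hA, hP⟩]
      · rw [if_neg hP, if_neg fun h => hP h.2]
  rw [hW1, hW2]
  unfold Pr at h'
  rwa [div_le_iff₀ (Zp_pos hs hSB)] at h'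

theorem exists_measure_union_ge (hβ : betaCrit < β) {μp : Measure Cfg2} (hμp : IsPlusPhase β 0 μp)
    {μh : Measure Cfg2} (hμhP : IsProbabilityMeasure μh)
    (hμh : CylTendsto (fun m => μp[|lineMinusEvt 1 m]) μh) {ε : ℝ} (hε : 0 < ε) :
    ∃ N : ℕ, 1 ≤ μh (⋃ n ∈ Finset.Icc 1 N, plusPathEvt n) + ENNReal.ofReal ε := by
  obtain ⟨N, hN⟩ := isingFV_inter_noPath_le hβ hε
  refine ⟨N, ?_⟩
  have hp := hμp.1
  have h1 : ∀ m k, μp (lineMinusEvt 1 m ∩ noPath N k)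
      ≤ ENNReal.ofReal ε * μp (lineMinusEvt 1 m) := fun m k =>
    le_of_tendsto_of_tendsto (((isLocal_lineMinusEvt m).inter (isLocal_noPath N k)).tendsto hμp.2)
      (ENNReal.Tendsto.const_mul ((isLocal_lineMinusEvt m).tendsto hμp.2)
        (.inr ENNReal.ofReal_ne_top)) (hN m k)
  have h2 : ∀ m k, μp[|lineMinusEvt 1 m] (noPath N k) ≤ ENNReal.ofReal ε := fun m k => by
    rw [cond_apply (isLocal_lineMinusEvt m).measurableSet]
    calc _ ≤ (μp (lineMinusEvt 1 m))⁻¹ * (ENNReal.ofReal ε * μp (lineMinusEvt 1 m)) :=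
          mul_le_mul_right (h1 m k) _
      _ = ENNReal.ofReal ε * ((μp (lineMinusEvt 1 m))⁻¹ * μp (lineMinusEvt 1 m)) := by ring
      _ ≤ ENNReal.ofReal ε * 1 := mul_le_mul_right (ENNReal.inv_mul_le_one _) _
      _ = _ := mul_one _
  have h3 : ∀ k, μh (noPath N k) ≤ ENNReal.ofReal ε := fun k =>
    le_of_tendsto ((isLocal_noPath N k).tendsto hμh) (Eventually.of_forall fun m => h2 m k)
  have h4 : μh (⋃ k, noPath N k) ≤ ENNReal.ofReal ε := by
    rw [(monotone_noPath N).measure_iUnion]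
    exact iSup_le h3
  calc (1 : ENNReal) = μh Set.univ := measure_univ.symm
    _ ≤ μh ((⋃ n ∈ Finset.Icc 1 N, plusPathEvt n) ∪ ⋃ k, noPath N k) :=
        measure_mono (univ_subset_union N)
    _ ≤ _ := (measure_union_le _ _).trans (by gcongr)

end Measure

end PlusPath

/-- Let `β > β_c`, `h = 0`, and let `μ̂` be the weak limit of
`μ⁺(·|η(i,0) = −1, i ∈ {−m,…,−1})` as `m → ∞`. With `B_m = ⋃_{n=1}^m A_n`, the probabilities
`μ̂(B_m)` increase to `1` as `m → ∞`. -/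
theorem union_of_path_events_increases_to_one
    (β : ℝ) (hβ : betaCrit < β) (μp : Measure Cfg2) (hμp : IsPlusPhase β 0 μp)
    (μh : Measure Cfg2) (hμhP : IsProbabilityMeasure μh)
    (hμh : CylTendsto (fun m => μp[|lineMinusEvt 1 m]) μh) :
    Monotone (fun m : ℕ => μh (⋃ n ∈ Finset.Icc 1 m, plusPathEvt n)) ∧
    Tendsto (fun m : ℕ => μh (⋃ n ∈ Finset.Icc 1 m, plusPathEvt n)) atTop (𝓝 1) := by
  have hmono : Monotone (fun m : ℕ => μh (⋃ n ∈ Finset.Icc 1 m, plusPathEvt n)) := fun a b hab =>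
    measure_mono (Set.biUnion_subset_biUnion_left fun n hn =>
      Finset.Icc_subset_Icc_right hab hn)
  refine ⟨hmono, ?_⟩
  have hsup : ⨆ m : ℕ, μh (⋃ n ∈ Finset.Icc 1 m, plusPathEvt n) = 1 := by
    refine le_antisymm (iSup_le fun _ => prob_le_one) ?_
    refine ENNReal.le_of_forall_pos_le_add fun ε hε _ => ?_
    obtain ⟨N, hN⟩ := PlusPath.exists_measure_union_ge hβ hμp hμhP hμh (NNReal.coe_pos.2 hε)
    rw [ENNReal.ofReal_coe_nnreal] at hN
    exact hN.trans (add_le_add_left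
      (le_iSup (fun m : ℕ => μh (⋃ n ∈ Finset.Icc 1 m, plusPathEvt n)) N) _)
  rw [← hsup]
  exact tendsto_atTop_iSup hmono
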